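/- Fix a number field K and let S be a set of prime ideals of K possessing a natural density δ(S). Then the limit lim_{X→∞} Σ_{2 ≤ N(a) ≤ X, a ∈ D(K,S)} μ_K(a)/N(a) exists and equals −δ(S). -/

import Mathlib

section Frozen
open NumberField Ideal Filter

noncomputable section

namespace AlladiGen

variable (K : Type*) [Field K] [NumberField K]

open Classical in
/-- The generalized Möbius function on integral ideals. -/
def muK (a : Ideal (𝓞 K)) : ℤ :=
  if Squarefree a then (-1) ^ (Nat.card {p : Ideal (𝓞 K) // p.IsPrime ∧ a ≤ p}) else 0

/-- `p` is a prime ideal of minimal norm among those containing `a`. -/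
def MinimalPrime (a p : Ideal (𝓞 K)) : Prop :=
  p.IsPrime ∧ a ≤ p ∧ ∀ q : Ideal (𝓞 K), q.IsPrime → a ≤ q → absNorm p ≤ absNorm q

/-- `a ∈ D(K,S)`: `a` is distinguishable with minimal prime in `S`. -/
def InD (S : Set (Ideal (𝓞 K))) (a : Ideal (𝓞 K)) : Prop :=
  ∃ p : Ideal (𝓞 K), MinimalPrime K a p ∧ p ∈ S ∧ ∀ q : Ideal (𝓞 K), MinimalPrime K a q → q = p

/-- `π_S(K; X)`: number of prime ideals in `S` of norm at most `X`. -/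
def primeCount (S : Set (Ideal (𝓞 K))) (X : ℝ) : ℕ :=
  Nat.card {p : Ideal (𝓞 K) // p.IsPrime ∧ p ∈ S ∧ (absNorm p : ℝ) ≤ X}

/-- `S` has natural density `δ` within the prime ideals of `K`. -/
def HasPrimeDensity (S : Set (Ideal (𝓞 K))) (δ : ℝ) : Prop :=
  Tendsto (fun X : ℝ => (primeCount K S X : ℝ) / (primeCount K Set.univ X : ℝ))
    atTop (nhds δ)

/-- `M(a)`: the maximal norm of a prime ideal containing `a`. -/
def maxNorm (a : Ideal (𝓞 K)) : ℕ :=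
  sSup (absNorm '' {p : Ideal (𝓞 K) | p.IsPrime ∧ a ≤ p})

/-- `Q_S(a)`: number of primes in `S` containing `a` of maximal norm. -/
def QS (S : Set (Ideal (𝓞 K))) (a : Ideal (𝓞 K)) : ℕ :=
  Nat.card {p : Ideal (𝓞 K) // p.IsPrime ∧ a ≤ p ∧ p ∈ S ∧ absNorm p = maxNorm K a}

/-- `c_K`: residue of the Dedekind zeta function at 1, via the analytic class number formula. -/
def cK : ℝ :=
  (2 ^ (InfinitePlace.nrRealPlaces K) * (2 * Real.pi) ^ (InfinitePlace.nrComplexPlaces K) *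
    NumberField.Units.regulator K * (NumberField.classNumber K)) /
  ((NumberField.Units.torsionOrder K : ℝ) * Real.sqrt |(NumberField.discr K : ℝ)|)

/-- `Ψ(X,Y)`: number of `Y`-smooth nonzero integral ideals of norm at most `X`. -/
def Psi (X Y : ℝ) : ℕ :=
  Nat.card {a : Ideal (𝓞 K) // a ≠ ⊥ ∧ (absNorm a : ℝ) ≤ X ∧
    ∀ p : Ideal (𝓞 K), p.IsPrime → a ≤ p → (absNorm p : ℝ) ≤ Y}

/-- `[X]_K`: number of nonzero integral ideals of norm at most `X`. -/
def idealCount (X : ℝ) : ℕ := Nat.card {a : Ideal (𝓞 K) // a ≠ ⊥ ∧ (absNorm a : ℝ) ≤ X}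

/-- The logarithmic integral `Li(X) = ∫_2^X dt / log t`. -/
def Li (X : ℝ) : ℝ := ∫ t in (2:ℝ)..X, 1 / Real.log t

end AlladiGen

end

end Frozen

section PartA1
open Filter Topology MeasureTheory
namespace Beu

section generic
variable {ι : Type*} (n : ι → ℕ)

/-- the finset of elements with norm at most `x` -/
noncomputable def fs (hf : ∀ x : ℝ, {i | (n i : ℝ) ≤ x}.Finite) (x : ℝ) : Finset ι := (hf x).toFinset

@[simp] lemma mem_fs (hf : ∀ x : ℝ, {i | (n i : ℝ) ≤ x}.Finite) (x : ℝ) (i : ι) :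
    i ∈ fs n hf x ↔ (n i : ℝ) ≤ x := by simp [fs]

open Classical in
lemma sum_Icc_eq (hn : ∀ i, 1 ≤ n i) (hf : ∀ x : ℝ, {i | (n i : ℝ) ≤ x}.Finite)
    {E : Type*} [AddCommMonoid E] (w : ι → E) (t : ℝ) (ht : 0 ≤ t) :
    ∑ k ∈ Finset.Icc 1 ⌊t⌋₊, ∑ i ∈ (fs n hf k).filter (fun i => n i = k), w i
      = ∑ i ∈ fs n hf t, w i := by
  rw [← Finset.sum_fiberwise_of_maps_to (s := fs n hf t) (t := Finset.Icc 1 ⌊t⌋₊) (g := n)]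
  · refine Finset.sum_congr rfl fun k hk => Finset.sum_congr ?_ fun _ _ => rfl
    ext i
    simp only [Finset.mem_filter, mem_fs, Finset.mem_Icc] at hk ⊢
    constructor
    · rintro ⟨h1, rfl⟩
      exact ⟨(Nat.le_floor_iff ht).1 hk.2, rfl⟩
    · rintro ⟨h1, rfl⟩
      exact ⟨le_rfl, rfl⟩
  · intro i hi
    simp only [mem_fs, Finset.mem_Icc] at hi ⊢
    exact ⟨hn i, Nat.le_floor hi⟩

open Classical in
lemma fiber_bigO (hn : ∀ i, 1 ≤ n i) (hf : ∀ x : ℝ, {i | (n i : ℝ) ≤ x}.Finite)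
    (B : ℝ) (hB : ∀ x : ℝ, 0 ≤ x → ((fs n hf x).card : ℝ) ≤ B * x)
    (w : ι → ℂ) (hw : ∀ i, ‖w i‖ ≤ 1) :
    (fun N : ℕ ↦ ∑ k ∈ Finset.Icc 1 N, ‖∑ i ∈ (fs n hf k).filter (fun i => n i = k), w i‖)
      =O[atTop] fun N ↦ (N : ℝ) ^ (1 : ℝ) := by
  refine Asymptotics.IsBigO.of_bound B (Eventually.of_forall fun N => ?_)
  rw [Real.rpow_one, Real.norm_of_nonneg (by positivity), Real.norm_of_nonneg (by positivity)]
  calc _ ≤ ∑ k ∈ Finset.Icc 1 N, ∑ i ∈ (fs n hf k).filter (fun i => n i = k), (1 : ℝ) := by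
        refine Finset.sum_le_sum fun k _ => (norm_sum_le _ _).trans
          (Finset.sum_le_sum fun i _ => hw i)
    _ = ((fs n hf N).card : ℝ) := by
        have := sum_Icc_eq n hn hf (fun _ => (1 : ℝ)) N (by positivity)
        rw [Nat.floor_natCast] at this
        rw [this]; simp
    _ ≤ _ := hB _ (by positivity)

open Classical in
/-- absolute convergence on `1 < re s` -/
lemma summable_gen (hn : ∀ i, 1 ≤ n i) (hf : ∀ x : ℝ, {i | (n i : ℝ) ≤ x}.Finite)
    (B : ℝ) (hB : ∀ x : ℝ, 0 ≤ x → ((fs n hf x).card : ℝ) ≤ B * x)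
    (w : ι → ℂ) (hw : ∀ i, ‖w i‖ ≤ 1) (s : ℂ) (hs : 1 < s.re) :
    Summable fun i => w i * (n i : ℂ) ^ (-s) := by
  have h1 := LSeriesSummable_of_sum_norm_bigO (s := s)
    (fiber_bigO n hn hf B hB (fun _ => 1) (by simp)) zero_le_one hs
  have key : Summable fun i => (n i : ℝ) ^ (-s.re) := by
    refine summable_of_sum_le (fun i => by positivity)
      (c := ∑' k, ‖LSeries.term (fun k => ∑ i ∈ (fs n hf k).filter (fun i => n i = k), (1:ℂ)) s k‖) ?_
    intro u
    rw [← Finset.sum_fiberwise_of_maps_to (s := u) (t := u.image n) (g := n)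
      (fun i hi => Finset.mem_image_of_mem _ hi)]
    refine le_trans (Finset.sum_le_sum fun k hk => ?_)
      (h1.norm.sum_le_tsum (u.image n) (fun _ _ => norm_nonneg _))
    obtain ⟨j, hj, rfl⟩ := Finset.mem_image.1 hk
    have hj0 : n j ≠ 0 := by have := hn j; omega
    rw [LSeries.norm_term_eq, if_neg hj0]
    calc _ = ∑ i ∈ u.filter (fun i => n i = n j), (n j : ℝ) ^ (-s.re) :=
          Finset.sum_congr rfl fun i hi => by rw [(Finset.mem_filter.1 hi).2]
      _ ≤ ∑ i ∈ (fs n hf (n j)).filter (fun i => n i = n j), (n j : ℝ) ^ (-s.re) := by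
          refine Finset.sum_le_sum_of_subset_of_nonneg ?_ (fun _ _ _ => by positivity)
          intro i hi
          simp only [Finset.mem_filter, mem_fs] at hi ⊢
          exact ⟨by rw [hi.2], hi.2⟩
      _ = _ := by
          rw [Finset.sum_const, Finset.sum_const, nsmul_eq_mul, Real.rpow_neg (by positivity)]
          simp [div_eq_mul_inv]
  refine Summable.of_norm_bounded key fun i => ?_
  have hi : 0 < n i := hn i
  rw [norm_mul, Complex.norm_natCast_cpow_of_pos hi, Complex.neg_re]
  exact mul_le_of_le_one_left (by positivity) (hw i)

open Classical in
lemma mellin_gen (hn : ∀ i, 1 ≤ n i) (hf : ∀ x : ℝ, {i | (n i : ℝ) ≤ x}.Finite)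
    (B : ℝ) (hB : ∀ x : ℝ, 0 ≤ x → ((fs n hf x).card : ℝ) ≤ B * x)
    (w : ι → ℂ) (hw : ∀ i, ‖w i‖ ≤ 1) (s : ℂ) (hs : 1 < s.re) :
    ∑' i, w i * (n i : ℂ) ^ (-s) =
      s * ∫ t in Set.Ioi (1 : ℝ), (∑ i ∈ fs n hf t, w i) * (t : ℂ) ^ (-(s + 1)) := by
  have h1 := LSeries_eq_mul_integral' (s := s) _ zero_le_one hs (fiber_bigO n hn hf B hB w hw)
  have h2 : LSeries (fun k => ∑ i ∈ (fs n hf k).filter (fun i => n i = k), w i) s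
      = ∑' i, w i * (n i : ℂ) ^ (-s) := by
    have hs' := summable_gen n hn hf B hB w hw s hs
    rw [← hs'.hasSum.tsum_fiberwise n |>.tsum_eq]
    refine tsum_congr fun k => ?_
    rw [LSeries.term_def]
    split_ifs with hk
    · subst hk
      have : IsEmpty (n ⁻¹' {0}) := ⟨fun ⟨i, hi⟩ => by
        have := hn i; simp at hi; omega⟩
      rw [tsum_empty]
    · have : n ⁻¹' {k} = ((fs n hf k).filter (fun i => n i = k) : Finset ι) := by
        ext i
        simp only [Set.mem_preimage, Set.mem_singleton_iff, Finset.coe_filter, mem_fs,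
          Set.mem_ofPred_eq]
        constructor
        · rintro rfl; exact ⟨le_rfl, rfl⟩
        · exact fun h => h.2
      rw [this, Finset.tsum_subtype' ((fs n hf k).filter (fun i => n i = k))
        (fun i => w i * (n i : ℂ) ^ (-s)), Finset.sum_div]
      refine Finset.sum_congr rfl fun i hi => ?_
      rw [(Finset.mem_filter.1 hi).2, Complex.cpow_neg, div_eq_mul_inv]
  rw [← h2, h1]
  congr 1
  refine setIntegral_congr_fun measurableSet_Ioi fun t ht => ?_
  have ht' : (1:ℝ) < t := ht
  simp only [sum_Icc_eq n hn hf w t (by linarith)]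

end generic
end Beu
end PartA1

section PartA2
open Filter Topology MeasureTheory
namespace Beu

lemma re_log_comb {a : ℝ} (ha₀ : 0 ≤ a) (ha₁ : a < 1) {z : ℂ} (hz : ‖z‖ = 1) :
      0 ≤ 3 * (-Complex.log (1 - a)).re + 4 * (-Complex.log (1 - a * z)).re
        + (-Complex.log (1 - a * z ^ 2)).re := by
  have hac₀ : ‖(a : ℂ)‖ < 1 := by
    simp only [Complex.norm_of_nonneg ha₀, ha₁]
  have hac₁ : ‖a * z‖ < 1 := by rwa [norm_mul, hz, mul_one]
  have hac₂ : ‖a * z ^ 2‖ < 1 := by rwa [norm_mul, norm_pow, hz, one_pow, mul_one]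
  rw [← ((Complex.hasSum_re <| Complex.hasSum_taylorSeries_neg_log hac₀).mul_left 3).add
    ((Complex.hasSum_re <| Complex.hasSum_taylorSeries_neg_log hac₁).mul_left 4) |>.add
    (Complex.hasSum_re <| Complex.hasSum_taylorSeries_neg_log hac₂) |>.tsum_eq]
  refine tsum_nonneg fun n ↦ ?_
  simp only [← Complex.ofReal_pow, Complex.div_natCast_re, Complex.ofReal_re, mul_pow,
    Complex.mul_re, Complex.ofReal_im, zero_mul, sub_zero]
  rcases n.eq_zero_or_pos with rfl | hn
  · simp
  · simp only [← mul_div_assoc, ← add_div]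
    refine div_nonneg ?_ n.cast_nonneg
    rw [← pow_mul, pow_mul', sq, Complex.mul_re, ← sq, ← sq, ← Complex.sq_norm_sub_sq_re,
      norm_pow, hz]
    convert! (show 0 ≤ 2 * a ^ n * ((z ^ n).re + 1) ^ 2 by positivity) using 1
    ring

lemma local_341 {a : ℝ} (ha₀ : 0 ≤ a) (ha₁ : a < 1) {z : ℂ} (hz : ‖z‖ = 1) :
    ‖1 - (a:ℂ)‖ ^ 3 * ‖1 - a * z‖ ^ 4 * ‖1 - a * z ^ 2‖ ≤ 1 := by
  have h := re_log_comb ha₀ ha₁ hz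
  have hne : ∀ w : ℂ, ‖w‖ = 1 → 0 < ‖1 - a * w‖ := fun w hw => by
    rw [norm_pos_iff]
    intro h
    have : (a:ℂ) * w = 1 := (sub_eq_zero.1 h).symm
    have := congrArg norm this
    rw [norm_mul, hw, Complex.norm_of_nonneg ha₀] at this
    simp at this; linarith
  have h0 : 0 < ‖1 - (a:ℂ)‖ := by simpa using hne 1 (by simp)
  have h1 := hne z hz
  have h2 := hne (z ^ 2) (by simp [hz])
  simp only [Complex.neg_re, Complex.log_re] at h
  rw [← Real.log_nonpos_iff (by positivity), Real.log_mul (by positivity) (by positivity),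
    Real.log_mul (by positivity) (by positivity), Real.log_pow, Real.log_pow]
  push_cast
  linarith

/-- norm of a multiset of primes -/
def nm {P : Type*} (N : P → ℕ) (m : Multiset P) : ℕ := (m.map N).prod

/-- a system of generalized primes with power-saving count of generalized integers -/
structure Sys (P : Type*) where
  N : P → ℕ
  two_le : ∀ p, 2 ≤ N p
  fin : ∀ x : ℝ, {m : Multiset P | (nm N m : ℝ) ≤ x}.Finite
  c : ℝ
  θ : ℝ
  C : ℝ
  A : ℝ
  d : ℕ
  hc : 0 < c
  hθ : 0 < θ
  hθ1 : θ < 1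
  hcnt : ∀ x : ℝ, 1 ≤ x → |((fs (nm N) fin x).card : ℝ) - c * x| ≤ C * x ^ (1 - θ)
  hpi : ∀ x : ℝ, 2 ≤ x → (Set.ncard {p | (N p : ℝ) ≤ x} : ℝ) ≤ A * x / Real.log x
  hd : ∀ n : ℕ, Set.ncard {p | N p = n} ≤ d

namespace Sys
variable {P : Type*} (Q : Sys P)

/-- norm -/
def n (m : Multiset P) : ℕ := nm Q.N m
/-- elements of norm at most `x` -/
noncomputable def I (x : ℝ) : Finset (Multiset P) := fs (nm Q.N) Q.fin x
/-- counting function -/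
noncomputable def cnt (x : ℝ) : ℝ := (Q.I x).card

@[simp] lemma mem_I (x : ℝ) (m : Multiset P) : m ∈ Q.I x ↔ (Q.n m : ℝ) ≤ x := by
  simp [I, n]

@[simp] lemma n_zero : Q.n 0 = 1 := by simp [n, nm]
@[simp] lemma n_cons (p : P) (m : Multiset P) : Q.n (p ::ₘ m) = Q.N p * Q.n m := by simp [n, nm]
@[simp] lemma n_add (m m' : Multiset P) : Q.n (m + m') = Q.n m * Q.n m' := by simp [n, nm]
lemma n_pos (m : Multiset P) : 1 ≤ Q.n m := by
  induction m using Multiset.induction_on with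
  | empty => simp
  | cons p m ih => rw [n_cons]; have := Q.two_le p; nlinarith
lemma n_pos' (m : Multiset P) : (0:ℝ) < Q.n m := by exact_mod_cast Q.n_pos m
lemma n_ge' (m : Multiset P) : (1:ℝ) ≤ Q.n m := by exact_mod_cast Q.n_pos m
lemma N_ge' (p : P) : (2:ℝ) ≤ Q.N p := by exact_mod_cast Q.two_le p
lemma N_pos' (p : P) : (0:ℝ) < Q.N p := by linarith [Q.N_ge' p]

/-- squarefree elements of norm at most `x` -/
lemma finF (x : ℝ) : {u : Finset P | (Q.n u.val : ℝ) ≤ x}.Finite :=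
  Set.Finite.preimage (f := Finset.val) (Finset.val_injective.injOn) (Q.fin x)
noncomputable def F (x : ℝ) : Finset (Finset P) := fs (fun u : Finset P => Q.n u.val) Q.finF x
@[simp] lemma mem_F (x : ℝ) (u : Finset P) : u ∈ Q.F x ↔ (Q.n u.val : ℝ) ≤ x := by
  simp [F]

lemma finP (x : ℝ) : {p : P | (Q.N p : ℝ) ≤ x}.Finite := by
  have := Set.Finite.preimage (f := fun p : P => ({p} : Multiset P))
    (fun a _ b _ h => Multiset.singleton_inj.1 h) (Q.fin x)
  convert this using 1
  ext p; simp [nm]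
/-- primes of norm at most `x` -/
noncomputable def Pr (x : ℝ) : Finset P := (Q.finP x).toFinset
@[simp] lemma mem_Pr (x : ℝ) (p : P) : p ∈ Q.Pr x ↔ (Q.N p : ℝ) ≤ x := by simp [Pr]

lemma I_lt_one (x : ℝ) (hx : x < 1) : Q.I x = ∅ := by
  ext m; simp; linarith [Q.n_ge' m]
lemma cnt_lt_one (x : ℝ) (hx : x < 1) : Q.cnt x = 0 := by simp [cnt, I_lt_one Q x hx]
lemma F_lt_one (x : ℝ) (hx : x < 1) : Q.F x = ∅ := by
  ext m; simp; linarith [Q.n_ge' m.val]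
lemma cnt_nonneg (x : ℝ) : 0 ≤ Q.cnt x := by simp [cnt]
lemma I_mono {x y : ℝ} (h : x ≤ y) : Q.I x ⊆ Q.I y := fun m hm => by
  simp at hm ⊢; linarith
lemma cnt_mono {x y : ℝ} (h : x ≤ y) : Q.cnt x ≤ Q.cnt y := by
  unfold cnt; exact_mod_cast Finset.card_le_card (Q.I_mono h)

lemma C_nonneg : 0 ≤ Q.C := by
  have := Q.hcnt 1 le_rfl
  simp only [Real.one_rpow, mul_one] at this
  exact (abs_nonneg _).trans this

lemma hcnt' (x : ℝ) (hx : 1 ≤ x) : |Q.cnt x - Q.c * x| ≤ Q.C * x ^ (1 - Q.θ) := Q.hcnt x hx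

/-- linear bound constant -/
noncomputable def B : ℝ := Q.c + Q.C
lemma B_pos : 0 < Q.B := by have := Q.hc; have := Q.C_nonneg; unfold B; linarith
lemma cnt_le (x : ℝ) (hx : 0 ≤ x) : Q.cnt x ≤ Q.B * x := by
  rcases lt_or_ge x 1 with h | h
  · rw [Q.cnt_lt_one x h]; exact mul_nonneg Q.B_pos.le hx
  · have h1 := (abs_le.1 (Q.hcnt' x h)).2
    have h2 : x ^ (1 - Q.θ) ≤ x := by
      conv_rhs => rw [← Real.rpow_one x]
      exact Real.rpow_le_rpow_of_exponent_le h (by linarith [Q.hθ])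
    unfold B
    nlinarith [Q.C_nonneg]

lemma card_F_le (x : ℝ) : ((Q.F x).card : ℝ) ≤ Q.cnt x := by
  unfold cnt
  have : (Q.F x).card ≤ (Q.I x).card := by
    refine Finset.card_le_card_of_injOn Finset.val ?_ (Finset.val_injective.injOn)
    intro u hu
    simpa using hu
  exact_mod_cast this

/-- zeta function -/
noncomputable def zeta (s : ℂ) : ℂ := ∑' m : Multiset P, (Q.n m : ℂ) ^ (-s)

lemma summable_zeta (s : ℂ) (hs : 1 < s.re) : Summable fun m : Multiset P => (Q.n m : ℂ) ^ (-s) := by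
  have := summable_gen (nm Q.N) Q.n_pos Q.fin Q.B Q.cnt_le (fun _ => 1) (by simp) s hs
  simp only [one_mul] at this
  exact this

lemma n_cpow_cons (p : P) (m : Multiset P) (s : ℂ) :
    (Q.n (p ::ₘ m) : ℂ) ^ s = (Q.N p : ℂ) ^ s * (Q.n m : ℂ) ^ s := by
  rw [n_cons, Nat.cast_mul, Complex.natCast_mul_natCast_cpow]

lemma norm_n_cpow (m : Multiset P) (s : ℂ) : ‖(Q.n m : ℂ) ^ s‖ = (Q.n m : ℝ) ^ s.re :=
  Complex.norm_natCast_cpow_of_pos (Q.n_pos m) s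

open Classical in
lemma euler_partial (s : ℂ) (hs : 1 < s.re) (T : Finset P) :
    Q.zeta s * ∏ p ∈ T, (1 - (Q.N p : ℂ) ^ (-s)) =
      ∑' m : Multiset P, if (∀ p ∈ T, p ∉ m) then (Q.n m : ℂ) ^ (-s) else 0 := by
  have hsum : ∀ T : Finset P, Summable fun m : Multiset P =>
      if (∀ p ∈ T, p ∉ m) then (Q.n m : ℂ) ^ (-s) else 0 := fun T => by
    refine Summable.of_norm_bounded (Q.summable_zeta s hs).norm fun m => ?_
    split_ifs <;> simp
  induction T using Finset.induction_on with
  | empty => simp [zeta]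
  | insert q T hq ih =>
    rw [Finset.prod_insert hq, mul_left_comm, ih, sub_mul, one_mul, sub_eq_iff_eq_add]
    have h1 : (Q.N q : ℂ) ^ (-s) * (∑' m : Multiset P, if (∀ p ∈ T, p ∉ m) then (Q.n m : ℂ) ^ (-s) else 0)
      = ∑' m : Multiset P, if ((∀ p ∈ T, p ∉ m) ∧ q ∈ m) then (Q.n m : ℂ) ^ (-s) else 0 := by
      rw [← tsum_mul_left]
      have hinj : Function.Injective (fun m : Multiset P => q ::ₘ m) :=
        fun a b h => (Multiset.cons_inj_right q).1 h
      rw [← hinj.tsum_eq (f := fun m : Multiset P =>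
        if ((∀ p ∈ T, p ∉ m) ∧ q ∈ m) then (Q.n m : ℂ) ^ (-s) else 0)]
      · refine tsum_congr fun m => ?_
        have : ((∀ p ∈ T, p ∉ q ::ₘ m) ∧ q ∈ q ::ₘ m) ↔ (∀ p ∈ T, p ∉ m) := by
          simp only [Multiset.mem_cons, true_or, and_true, not_or]
          exact ⟨fun h p hp => (h p hp).2, fun h p hp => ⟨fun e => hq (e ▸ hp), h p hp⟩⟩
        simp only [this, mul_ite, mul_zero, n_cpow_cons]
      · intro m hm
        simp only [Function.mem_support, ne_eq, ite_eq_right_iff, Classical.not_imp] at hm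
        obtain ⟨t, ht⟩ := Multiset.exists_cons_of_mem hm.1.2
        exact ⟨t, ht.symm⟩
    have hsum2 : Summable fun m : Multiset P =>
      if ((∀ p ∈ T, p ∉ m) ∧ q ∈ m) then (Q.n m : ℂ) ^ (-s) else 0 := by
      refine Summable.of_norm_bounded (Q.summable_zeta s hs).norm fun m => ?_
      split_ifs <;> simp
    rw [h1, ← (hsum _).tsum_add hsum2]
    refine tsum_congr fun m => ?_
    by_cases h1 : ∀ p ∈ T, p ∉ m <;> by_cases h2 : q ∈ m <;> simp [h1, h2]

lemma tendsto_euler (s : ℂ) (hs : 1 < s.re) :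
    Tendsto (fun T : Finset P => Q.zeta s * ∏ p ∈ T, (1 - (Q.N p : ℂ) ^ (-s))) atTop (𝓝 1) := by
  classical
  simp_rw [Q.euler_partial s hs]
  have h1 : (1:ℂ) = ∑' m : Multiset P, if m = 0 then (1:ℂ) else 0 := by
    rw [tsum_ite_eq]
  rw [h1]
  refine tendsto_tsum_of_dominated_convergence (Q.summable_zeta s hs).norm ?_ ?_
  · intro m
    by_cases hm : m = 0
    · subst hm; simp
    · rw [if_neg hm]
      obtain ⟨p, hp⟩ := Multiset.exists_mem_of_ne_zero hm
      refine tendsto_const_nhds.congr' ?_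
      filter_upwards [eventually_ge_atTop {p}] with T hT
      rw [if_neg]
      intro h
      exact h p (hT (by simp)) hp
  · refine Eventually.of_forall fun T m => ?_
    split_ifs <;> simp

lemma zeta_ne_zero (s : ℂ) (hs : 1 < s.re) : Q.zeta s ≠ 0 := by
  intro h
  have := Q.tendsto_euler s hs
  simp only [h, zero_mul] at this
  exact zero_ne_one (tendsto_nhds_unique tendsto_const_nhds this)

lemma tendsto_euler' (s : ℂ) (hs : 1 < s.re) :
    Tendsto (fun T : Finset P => ∏ p ∈ T, (1 - (Q.N p : ℂ) ^ (-s))) atTop (𝓝 (Q.zeta s)⁻¹) := by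
  have := (Q.tendsto_euler s hs).const_mul (Q.zeta s)⁻¹
  simpa [← mul_assoc, inv_mul_cancel₀ (Q.zeta_ne_zero s hs)] using this

lemma n_val_cpow (u : Finset P) (s : ℂ) : (Q.n u.val : ℂ) ^ s = ∏ p ∈ u, (Q.N p : ℂ) ^ s := by
  classical
  induction u using Finset.induction_on with
  | empty => simp
  | insert q u hq ih => rw [Finset.insert_val_of_notMem hq, n_cpow_cons, Finset.prod_insert hq, ih]

lemma mu_series (s : ℂ) (hs : 1 < s.re) :
    ∑' u : Finset P, (-1 : ℂ) ^ u.card * (Q.n u.val : ℂ) ^ (-s) = (Q.zeta s)⁻¹ := by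
  have h1 : Summable fun u : Finset P => (-1 : ℂ) ^ u.card * (Q.n u.val : ℂ) ^ (-s) := by
    refine Summable.of_norm_bounded (g := fun u : Finset P => ‖(Q.n u.val : ℂ) ^ (-s)‖)
      ((Q.summable_zeta s hs).norm.comp_injective Finset.val_injective) fun u => by simp
  have h2 : ∀ u : Finset P, (-1 : ℂ) ^ u.card * (Q.n u.val : ℂ) ^ (-s)
      = ∏ p ∈ u, (-(Q.N p : ℂ) ^ (-s)) := fun u => by
    rw [n_val_cpow, Finset.prod_neg]
  simp_rw [h2] at h1 ⊢
  have h3 := hasProd_one_add_of_hasSum_prod h1.hasSum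
  simp only [HasProd, ← sub_eq_add_neg, SummationFilter.unconditional_filter] at h3
  exact tendsto_nhds_unique h3 (Q.tendsto_euler' s hs)

/-- partial sums of Möbius -/
noncomputable def M (x : ℝ) : ℝ := ∑ u ∈ Q.F x, (-1 : ℝ) ^ u.card

lemma abs_M_le (x : ℝ) (hx : 0 ≤ x) : |Q.M x| ≤ Q.B * x := by
  refine le_trans ?_ ((Q.card_F_le x).trans (Q.cnt_le x hx))
  refine (Finset.abs_sum_le_sum_abs _ _).trans ?_
  simp

lemma zeta_mellin (s : ℂ) (hs : 1 < s.re) :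
    Q.zeta s = s * ∫ t in Set.Ioi (1:ℝ), (Q.cnt t : ℂ) * (t : ℂ) ^ (-(s + 1)) := by
  have := mellin_gen (nm Q.N) Q.n_pos Q.fin Q.B Q.cnt_le (fun _ => 1) (by simp) s hs
  simp only [one_mul, Finset.sum_const, nsmul_eq_mul, mul_one] at this
  exact this

lemma M_mellin (s : ℂ) (hs : 1 < s.re) :
    (Q.zeta s)⁻¹ = s * ∫ t in Set.Ioi (1:ℝ), (Q.M t : ℂ) * (t : ℂ) ^ (-(s + 1)) := by
  have := mellin_gen (fun u : Finset P => Q.n u.val) (fun u => Q.n_pos u.val) Q.finF Q.B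
    (fun x hx => (Q.card_F_le x).trans (Q.cnt_le x hx)) (fun u => (-1) ^ u.card) (by simp) s hs
  rw [Q.mu_series s hs] at this
  rw [this]
  simp [M, F]

/-- `3-4-1` local inequality in product form -/
lemma three_four_one (s : ℝ) (hs : 1 < s) (t : ℝ) :
    1 ≤ ‖Q.zeta s‖ ^ 3 * ‖Q.zeta (s + t * Complex.I)‖ ^ 4 * ‖Q.zeta (s + 2 * t * Complex.I)‖ := by
  have e0 := (Q.tendsto_euler' s (by simpa using hs)).norm.pow 3
  have e1 := (Q.tendsto_euler' (s + t * Complex.I) (by simpa using hs)).norm.pow 4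
  have e2 := (Q.tendsto_euler' (s + 2 * t * Complex.I) (by simpa using hs)).norm
  have key : ‖(Q.zeta s)⁻¹‖ ^ 3 * ‖(Q.zeta (s + t * Complex.I))⁻¹‖ ^ 4 *
      ‖(Q.zeta (s + 2 * t * Complex.I))⁻¹‖ ≤ 1 := by
    refine le_of_tendsto ((e0.mul e1).mul e2) (Eventually.of_forall fun T => ?_)
    simp only [norm_prod, ← Finset.prod_pow, ← Finset.prod_mul_distrib]
    refine Finset.prod_le_one (fun p _ => by positivity) fun p _ => ?_
    have hp : 0 < Q.N p := by have := Q.two_le p; omega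
    have hp0 : (Q.N p : ℂ) ≠ 0 := by exact_mod_cast hp.ne'
    have ha : (Q.N p : ℝ) ^ (-s) < 1 :=
      Real.rpow_lt_one_of_one_lt_of_neg (by linarith [Q.N_ge' p]) (by linarith)
    have hz : ‖(Q.N p : ℂ) ^ (-(t * Complex.I))‖ = 1 := by
      rw [Complex.norm_natCast_cpow_of_pos hp]; simp
    have := local_341 (by positivity) ha hz
    have e1 : (Q.N p : ℂ) ^ (-(s:ℂ)) = (((Q.N p : ℝ) ^ (-s) : ℝ) : ℂ) := by
      rw [Complex.ofReal_cpow (by positivity)]; simp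
    have e2 : (Q.N p : ℂ) ^ (-((s:ℂ) + t * Complex.I)) =
        (((Q.N p : ℝ) ^ (-s) : ℝ) : ℂ) * (Q.N p : ℂ) ^ (-(t * Complex.I)) := by
      rw [neg_add, Complex.cpow_add _ _ hp0, e1]
    have e3 : (Q.N p : ℂ) ^ (-((s:ℂ) + 2 * t * Complex.I)) =
        (((Q.N p : ℝ) ^ (-s) : ℝ) : ℂ) * ((Q.N p : ℂ) ^ (-(t * Complex.I))) ^ 2 := by
      rw [neg_add, Complex.cpow_add _ _ hp0, e1,
        show -(2 * (t:ℂ) * Complex.I) = (2:ℕ) * (-(t * Complex.I)) by push_cast; ring,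
        Complex.cpow_nat_mul]
    rw [e1, e2, e3]
    exact this
  have h0 : 0 < ‖Q.zeta s‖ := norm_pos_iff.2 (Q.zeta_ne_zero _ (by simpa using hs))
  have h1 : 0 < ‖Q.zeta (s + t * Complex.I)‖ := norm_pos_iff.2 (Q.zeta_ne_zero _ (by simpa using hs))
  have h2 : 0 < ‖Q.zeta (s + 2 * t * Complex.I)‖ := norm_pos_iff.2 (Q.zeta_ne_zero _ (by simpa using hs))
  simp only [norm_inv, inv_pow, ← mul_inv] at key
  exact (inv_le_one₀ (by positivity)).1 key

end Sys
end Beu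
end PartA2

section PartA3
open Filter Topology MeasureTheory
namespace Beu

/-- Fejér kernel -/
noncomputable def fk (u : ℝ) : ℝ := 2 * (1 - Real.cos u) / u ^ 2

lemma fk_nonneg (u : ℝ) : 0 ≤ fk u := by
  unfold fk; have := Real.cos_le_one u
  exact div_nonneg (by linarith) (sq_nonneg _)

lemma fk_le (u : ℝ) : fk u ≤ 6 * (1 + u ^ 2)⁻¹ := by
  unfold fk
  have h1 := Real.one_sub_sq_div_two_le_cos (x := u)
  have h2 := Real.neg_one_le_cos u
  rcases eq_or_ne u 0 with rfl | hu
  · simp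
  have hu2 : 0 < u ^ 2 := by positivity
  rw [← div_eq_mul_inv, div_le_div_iff₀ hu2 (by positivity)]
  nlinarith

lemma fk_meas : Measurable fk := by unfold fk; fun_prop

lemma fk_int : Integrable fk := by
  refine Integrable.mono' (integrable_inv_one_add_sq.const_mul 6) fk_meas.aestronglyMeasurable
    (Eventually.of_forall fun u => ?_)
  rw [Real.norm_of_nonneg (fk_nonneg u)]; exact fk_le u

lemma fk_pos : 0 < ∫ u, fk u := by
  rw [integral_pos_iff_support_of_nonneg fk_nonneg fk_int]
  refine lt_of_lt_of_le ?_ (measure_mono (s := Set.Ioo (0:ℝ) 1) ?_)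
  · simp
  · intro u hu
    have h1 : Real.cos u < 1 := by
      have := Real.cos_lt_cos_of_nonneg_of_le_pi_div_two le_rfl (by linarith [Real.two_le_pi, hu.2]) hu.1
      simpa using this
    have : 0 < fk u := by
      unfold fk
      have := hu.1
      exact div_pos (by linarith) (by positivity)
    exact this.ne'

lemma fk_scale (l : ℝ) (hl : 0 < l) (u : ℝ) (hu : u ≠ 0) :
    2 * ∫ τ in (0:ℝ)..l, (1 - τ / l) * Real.cos (τ * u) = l * fk (l * u) := by
  have h : ∀ τ ∈ Set.uIcc 0 l, HasDerivAt
      (fun τ : ℝ => (1 - τ / l) * (Real.sin (τ * u) / u) - Real.cos (τ * u) / (l * u ^ 2))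
      ((1 - τ / l) * Real.cos (τ * u)) τ := fun τ _ => by
    have h1 : HasDerivAt (fun τ : ℝ => τ * u) u τ := by simpa using (hasDerivAt_id τ).mul_const u
    have h2 : HasDerivAt (fun τ : ℝ => 1 - τ / l) (-(1 / l)) τ := by
      simpa using ((hasDerivAt_id τ).div_const l).const_sub 1
    have h3 := (h2.mul (h1.sin.div_const u)).sub (h1.cos.div_const (l * u ^ 2))
    refine h3.congr_deriv ?_
    field_simp
    ring
  rw [intervalIntegral.integral_eq_sub_of_hasDerivAt h]
  · unfold fk
    simp
    field_simp
    ring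
  · apply Continuous.intervalIntegrable; fun_prop

section taub
lemma taub_int (f : ℝ → ℝ) (hm : Measurable f) (B : ℝ) (hB : ∀ t, |f t| ≤ B) (s : ℂ) (hs : 0 < s.re) :
    IntegrableOn (fun t : ℝ => (f t : ℂ) * Complex.exp (-s * t)) (Set.Ioi 0) := by
  have h1 : IntegrableOn (fun t : ℝ => Complex.exp (-s * t)) (Set.Ioi 0) :=
    integrableOn_exp_mul_complex_Ioi (by simpa using hs) 0
  refine Integrable.bdd_mul (c := B) h1 (by fun_prop) (Eventually.of_forall fun t => ?_)
  rw [Complex.norm_real]; exact hB t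

lemma taub_step1 (f : ℝ → ℝ) (hm : Measurable f) (B : ℝ) (hB : ∀ t, |f t| ≤ B)
    (G : ℂ → ℂ)
    (hGf : ∀ s : ℂ, 0 < s.re → G s = ∫ t in Set.Ioi (0:ℝ), (f t : ℂ) * Complex.exp (-s * t))
    (l : ℝ) (hl : 0 < l) (σ : ℝ) (hσ : 0 < σ) (x : ℝ) :
    ∫ t in Set.Ioi (0:ℝ), f t * Real.exp (-σ * t) * (l * fk (l * (x - t)))
     = 2 * ∫ τ in Set.Ioc 0 l, (1 - τ / l) *
        (Complex.exp (τ * x * Complex.I) * G (σ + τ * Complex.I)).re := by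
  have e1 : ∀ τ : ℝ, (1 - τ / l) * (Complex.exp (τ * x * Complex.I) * G (σ + τ * Complex.I)).re
      = ∫ t in Set.Ioi (0:ℝ), f t * Real.exp (-σ * t) * ((1 - τ / l) * Real.cos (τ * (x - t))) := by
    intro τ
    rw [hGf _ (by simpa using hσ), ← integral_const_mul]
    have hInt := (taub_int f hm B hB (σ + τ * Complex.I) (by simpa using hσ)).const_mul
      (Complex.exp (τ * x * Complex.I))
    have := integral_re hInt
    simp only [RCLike.re_eq_complex_re] at this
    rw [← this, ← integral_const_mul]
    refine integral_congr_ae (Eventually.of_forall fun t => ?_)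
    simp only
    rw [mul_left_comm, ← Complex.exp_add, Complex.re_ofReal_mul, Complex.exp_re]
    have a1 : (τ * x * Complex.I + -(σ + τ * Complex.I) * t).re = -σ * t := by simp
    have a2 : (τ * x * Complex.I + -(σ + τ * Complex.I) * t).im = τ * (x - t) := by simp; ring
    rw [a1, a2]; ring
  simp_rw [e1]
  rw [integral_integral_swap]
  · rw [← integral_const_mul]
    refine setIntegral_congr_ae measurableSet_Ioi ?_
    have : ∀ᵐ t : ℝ, t ≠ x := by simp [ae_iff]
    filter_upwards [this] with t ht _
    rw [← fk_scale l hl (x - t) (sub_ne_zero.2 ht.symm), integral_const_mul,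
      intervalIntegral.integral_of_le hl.le]
    ring
  · have i1 : Integrable (fun τ : ℝ => (1 : ℝ)) (volume.restrict (Set.Ioc 0 l)) := by
      simp
    have i2 : Integrable (fun t : ℝ => Real.exp (-σ * t)) (volume.restrict (Set.Ioi 0)) := by
      exact exp_neg_integrableOn_Ioi 0 hσ
    have i3 := i1.mul_prod i2
    simp only [one_mul] at i3
    have i4 : Integrable (fun z : ℝ × ℝ => B * Real.exp (-σ * z.2))
      ((volume.restrict (Set.Ioc 0 l)).prod (volume.restrict (Set.Ioi 0))) := i3.const_mul B
    refine Integrable.mono' i4 ?_ ?_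
    · apply Measurable.aestronglyMeasurable
      simp only [Function.uncurry_def]
      fun_prop
    · rw [Measure.prod_restrict]
      refine (ae_restrict_iff' (measurableSet_Ioc.prod measurableSet_Ioi)).2
        (Eventually.of_forall fun z hz => ?_)
      obtain ⟨⟨h1, h2⟩, h3⟩ := hz
      simp only [Function.uncurry, norm_mul, Real.norm_eq_abs, Real.abs_exp]
      have hB0 : 0 ≤ B := (abs_nonneg _).trans (hB 0)
      have b1 : |1 - z.1 / l| ≤ 1 := by
        have : z.1 / l ≤ 1 := (div_le_one hl).2 h2
        have : 0 < z.1 / l := div_pos h1 hl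
        rw [abs_le]; constructor <;> linarith
      have b2 := Real.abs_cos_le_one (z.1 * (x - z.2))
      have b3 := hB z.2
      calc |f z.2| * Real.exp (-σ * z.2) * (|1 - z.1 / l| * |Real.cos (z.1 * (x - z.2))|)
          ≤ B * Real.exp (-σ * z.2) * (1 * 1) := by gcongr
        _ = _ := by ring

lemma taub_step2 (f : ℝ → ℝ) (hm : Measurable f) (B : ℝ) (hB : ∀ t, |f t| ≤ B)
    (G : ℂ → ℂ) (hG : ContinuousOn G {s | 0 ≤ s.re})
    (hGf : ∀ s : ℂ, 0 < s.re → G s = ∫ t in Set.Ioi (0:ℝ), (f t : ℂ) * Complex.exp (-s * t))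
    (l : ℝ) (hl : 0 < l) (x : ℝ) :
    ∫ t in Set.Ioi (0:ℝ), f t * (l * fk (l * (x - t)))
     = 2 * ∫ τ in Set.Ioc 0 l, (1 - τ / l) *
        (Complex.exp (τ * x * Complex.I) * G (τ * Complex.I)).re := by
  have hB0 : 0 ≤ B := (abs_nonneg _).trans (hB 0)
  have t1 : Tendsto (fun σ : ℝ => ∫ t in Set.Ioi (0:ℝ), f t * Real.exp (-σ * t) * (l * fk (l * (x - t))))
      (𝓝[>] 0) (𝓝 (∫ t in Set.Ioi (0:ℝ), f t * (l * fk (l * (x - t))))) := by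
    refine tendsto_integral_filter_of_dominated_convergence
      (fun t => B * (l * fk (l * (x - t)))) ?_ ?_ ?_ ?_
    · refine Eventually.of_forall fun σ => Measurable.aestronglyMeasurable ?_
      have := fk_meas; fun_prop
    · filter_upwards [self_mem_nhdsWithin] with σ hσ
      refine (ae_restrict_iff' measurableSet_Ioi).2 (Eventually.of_forall fun t ht => ?_)
      have hσ' : 0 < σ := hσ
      have ht' : 0 < t := ht
      have : Real.exp (-σ * t) ≤ 1 := Real.exp_le_one_iff.2 (by nlinarith)
      have hk := fk_nonneg (l * (x - t))
      rw [norm_mul, norm_mul, Real.norm_eq_abs, Real.norm_eq_abs, Real.abs_exp,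
        Real.norm_of_nonneg (by positivity)]
      have := hB t
      calc _ ≤ B * 1 * (l * fk (l * (x - t))) := by gcongr
        _ = _ := by ring
    · apply Integrable.integrableOn
      have := (fk_int.comp_mul_left' hl.ne').comp_sub_left x
      exact (this.const_mul l).const_mul B
    · refine Eventually.of_forall fun t => ?_
      have : Continuous fun σ : ℝ => f t * Real.exp (-σ * t) * (l * fk (l * (x - t))) := by fun_prop
      have := (this.tendsto 0).mono_left (nhdsWithin_le_nhds (s := Set.Ioi 0))
      simpa using this
  have hK : IsCompact ((fun p : ℝ × ℝ => (p.1 : ℂ) + p.2 * Complex.I) '' (Set.Icc 0 1 ×ˢ Set.Icc 0 l)) :=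
    (isCompact_Icc.prod isCompact_Icc).image (by fun_prop)
  have hKs : ((fun p : ℝ × ℝ => (p.1 : ℂ) + p.2 * Complex.I) '' (Set.Icc 0 1 ×ˢ Set.Icc 0 l))
      ⊆ {s : ℂ | 0 ≤ s.re} := by
    rintro _ ⟨p, hp, rfl⟩
    simpa using hp.1.1
  obtain ⟨Cb, hCb⟩ := hK.exists_bound_of_continuousOn (hG.mono hKs)
  have t2 : Tendsto (fun σ : ℝ => 2 * ∫ τ in Set.Ioc 0 l, (1 - τ / l) *
        (Complex.exp (τ * x * Complex.I) * G (σ + τ * Complex.I)).re) (𝓝[>] 0)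
      (𝓝 (2 * ∫ τ in Set.Ioc 0 l, (1 - τ / l) *
        (Complex.exp (τ * x * Complex.I) * G (τ * Complex.I)).re)) := by
    refine Tendsto.const_mul _ ?_
    refine tendsto_integral_filter_of_dominated_convergence (fun t => Cb) ?_ ?_ ?_ ?_
    · filter_upwards [self_mem_nhdsWithin] with σ hσ
      have hσ' : 0 < σ := hσ
      apply Continuous.aestronglyMeasurable
      have : Continuous fun τ : ℝ => G (σ + τ * Complex.I) :=
        hG.comp_continuous (by fun_prop) (fun τ => by simpa using hσ'.le)
      have h2 : Continuous fun τ : ℝ => Complex.exp (τ * x * Complex.I) := by fun_prop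
      exact (by fun_prop : Continuous fun τ : ℝ => 1 - τ / l).mul
        (Complex.continuous_re.comp (h2.mul this))
    · filter_upwards [Ioo_mem_nhdsGT (zero_lt_one' ℝ)] with σ hσ
      refine (ae_restrict_iff' measurableSet_Ioc).2 (Eventually.of_forall fun τ ht => ?_)
      have b1 : ‖1 - τ / l‖ ≤ 1 := by
        have : τ / l ≤ 1 := (div_le_one hl).2 ht.2
        have : 0 < τ / l := div_pos ht.1 hl
        rw [Real.norm_eq_abs, abs_le]; constructor <;> linarith
      have b2 := hCb _ ⟨(σ, τ), ⟨⟨hσ.1.le, hσ.2.le⟩, ⟨ht.1.le, ht.2⟩⟩, rfl⟩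
      have b3 := Complex.abs_re_le_norm (Complex.exp (τ * x * Complex.I) * G (σ + τ * Complex.I))
      have b4 : ‖Complex.exp (τ * x * Complex.I)‖ = 1 := by
        rw [← Complex.ofReal_mul, Complex.norm_exp_ofReal_mul_I]
      rw [norm_mul, b4, one_mul] at b3
      rw [norm_mul]
      calc _ ≤ 1 * Cb := mul_le_mul b1 (b3.trans b2) (abs_nonneg _) zero_le_one
        _ = _ := one_mul _
    · simp
    · refine (ae_restrict_iff' measurableSet_Ioc).2 (Eventually.of_forall fun τ ht => ?_)
      have c1 : Tendsto (fun σ : ℝ => G (σ + τ * Complex.I)) (𝓝[>] 0) (𝓝 (G (τ * Complex.I))) := by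
        have c2 := hG (τ * Complex.I) (by simp)
        refine Tendsto.comp c2 (tendsto_nhdsWithin_iff.2 ⟨?_, ?_⟩)
        · have : Continuous fun σ : ℝ => (σ : ℂ) + τ * Complex.I := by fun_prop
          have := (this.tendsto 0).mono_left (nhdsWithin_le_nhds (s := Set.Ioi 0))
          simpa using this
        · filter_upwards [self_mem_nhdsWithin] with σ hσ
          have hσ' : 0 < σ := hσ
          simpa using hσ'.le
      exact ((Complex.continuous_re.tendsto _).comp (c1.const_mul _)).const_mul _
  refine tendsto_nhds_unique t1 (t2.congr' ?_)
  filter_upwards [self_mem_nhdsWithin] with σ hσ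
  exact (taub_step1 f hm B hB G hGf l hl σ hσ x).symm

lemma taub_step3 (f : ℝ → ℝ) (hm : Measurable f) (B : ℝ) (hB : ∀ t, |f t| ≤ B)
    (G : ℂ → ℂ) (hG : ContinuousOn G {s | 0 ≤ s.re})
    (hGf : ∀ s : ℂ, 0 < s.re → G s = ∫ t in Set.Ioi (0:ℝ), (f t : ℂ) * Complex.exp (-s * t))
    (l : ℝ) (hl : 0 < l) :
    Tendsto (fun x : ℝ => ∫ t in Set.Ioi (0:ℝ), f t * (l * fk (l * (x - t)))) atTop (𝓝 0) := by
  simp_rw [taub_step2 f hm B hB G hG hGf l hl]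
  have rl := Real.tendsto_integral_exp_smul_cocompact
    (Set.indicator (Set.Ioc 0 l) fun τ : ℝ => ((1 - τ / l : ℝ) : ℂ) * G (τ * Complex.I))
  have hx : Tendsto (fun x : ℝ => -x / (2 * Real.pi)) atTop (cocompact ℝ) := by
    refine Tendsto.mono_right ?_ atBot_le_cocompact
    exact tendsto_neg_atTop_atBot.atBot_div_const (by positivity)
  have r2 := rl.comp hx
  have r3 := ((Complex.continuous_re.tendsto _).comp r2).const_mul 2
  simp only [Complex.zero_re, mul_zero] at r3
  refine r3.congr fun x => ?_
  simp only [Function.comp]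
  congr 1
  have e : ∀ v : ℝ, (Real.fourierChar (-(v * (-x / (2 * Real.pi)))) •
      (Set.indicator (Set.Ioc 0 l) (fun τ : ℝ => ((1 - τ / l : ℝ) : ℂ) * G (τ * Complex.I)) v))
      = Set.indicator (Set.Ioc 0 l) (fun τ : ℝ => ((1 - τ / l : ℝ) : ℂ) *
        (Complex.exp (τ * x * Complex.I) * G (τ * Complex.I))) v := by
    intro v
    by_cases hv : v ∈ Set.Ioc 0 l
    · simp only [Set.indicator_of_mem hv, Circle.smul_def, Real.fourierChar_apply]
      have : 2 * Real.pi * -(v * (-x / (2 * Real.pi))) = v * x := by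
        have := Real.pi_pos
        field_simp
      rw [this]
      simp only [smul_eq_mul]; push_cast; ring
    · simp [Set.indicator_of_notMem hv]
  simp_rw [e]
  rw [integral_indicator measurableSet_Ioc]
  have hcont : Continuous fun τ : ℝ => G (τ * Complex.I) :=
    hG.comp_continuous (by fun_prop) (fun τ => by simp)
  have hInt : Integrable (fun τ : ℝ => ((1 - τ / l : ℝ) : ℂ) *
        (Complex.exp (τ * x * Complex.I) * G (τ * Complex.I))) (volume.restrict (Set.Ioc 0 l)) := by
    have : Continuous (fun τ : ℝ => ((1 - τ / l : ℝ) : ℂ) *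
        (Complex.exp (τ * x * Complex.I) * G (τ * Complex.I))) := by
      have h2 : Continuous fun τ : ℝ => Complex.exp (τ * x * Complex.I) := by fun_prop
      exact (by fun_prop : Continuous fun τ : ℝ => ((1 - τ / l : ℝ) : ℂ)).mul (h2.mul hcont)
    exact (this.integrableOn_Icc).mono_set Set.Ioc_subset_Icc_self
  have := integral_re hInt
  simp only [RCLike.re_eq_complex_re] at this
  rw [← this]
  refine integral_congr_ae (Eventually.of_forall fun t => ?_)
  simp only [Complex.re_ofReal_mul]

theorem taub (f : ℝ → ℝ) (hm : Measurable f) (B : ℝ) (hB : ∀ t, |f t| ≤ B)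
    (h0 : ∀ t < 0, f t = 0) (G : ℂ → ℂ) (hG : ContinuousOn G {s | 0 ≤ s.re})
    (hGf : ∀ s : ℂ, 0 < s.re → G s = ∫ t in Set.Ioi (0:ℝ), (f t : ℂ) * Complex.exp (-s * t))
    (hslow : ∀ η > 0, ∃ δ > 0, ∃ X0 : ℝ, ∀ x y, X0 ≤ x → |x - y| ≤ δ → |f x - f y| ≤ η) :
    Tendsto f atTop (𝓝 0) := by
  have hB0 : 0 ≤ B := (abs_nonneg _).trans (hB 0)
  have hk0 := fk_pos
  set κ := ∫ u, fk u with hκ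
  rw [Metric.tendsto_atTop]
  intro ε hε
  -- choose V
  have hV : Tendsto (fun V : ℝ => ∫ u in Set.Icc (-V) V, fk u) atTop (𝓝 κ) := by
    have := intervalIntegral_tendsto_integral fk_int tendsto_neg_atTop_atBot tendsto_id
    refine this.congr' ?_
    filter_upwards [eventually_ge_atTop 0] with V hV
    simp only [id]
    rw [intervalIntegral.integral_of_le (by linarith), integral_Icc_eq_integral_Ioc]
  obtain ⟨V, hVpos, hV2⟩ : ∃ V : ℝ, 0 < V ∧ κ - (∫ u in Set.Icc (-V) V, fk u) < ε * κ / (4 * (2 * B + 1)) := by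
    have h1 := hV.eventually (lt_mem_nhds (show κ - ε * κ / (4 * (2 * B + 1)) < κ by
      have : 0 < ε * κ / (4 * (2 * B + 1)) := by positivity
      linarith))
    obtain ⟨V, hV1, hV2⟩ := (h1.and (eventually_gt_atTop 0)).exists
    exact ⟨V, hV2, by linarith⟩
  obtain ⟨δ, hδ, X0, hX0⟩ := hslow (ε / 4) (by positivity)
  set l := V / δ with hl
  have hlpos : 0 < l := by positivity
  have h3 := taub_step3 f hm B hB G hG hGf l hlpos
  rw [Metric.tendsto_atTop] at h3
  obtain ⟨X1, hX1⟩ := h3 (ε * κ / 4) (by positivity)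
  refine ⟨max X0 X1, fun x hx => ?_⟩
  have hx0 : X0 ≤ x := (le_max_left _ _).trans hx
  have hx1 := hX1 x ((le_max_right _ _).trans hx)
  rw [dist_zero_right, Real.norm_eq_abs] at hx1 ⊢
  have e1 : ∫ t in Set.Ioi (0:ℝ), f t * (l * fk (l * (x - t))) = ∫ v, f (x - v / l) * fk v := by
    have a1 : ∫ t in Set.Ioi (0:ℝ), f t * (l * fk (l * (x - t)))
        = ∫ t : ℝ, f t * (l * fk (l * (x - t))) := by
      rw [← integral_Ici_eq_integral_Ioi]
      refine setIntegral_eq_integral_of_forall_compl_eq_zero fun t ht => ?_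
      rw [h0 t (by simpa using ht), zero_mul]
    rw [a1, ← integral_sub_left_eq_self (fun t => f t * (l * fk (l * (x - t)))) volume x]
    have a2 := Measure.integral_comp_mul_left (fun v => f (x - v / l) * fk v) l
    rw [abs_of_pos (by positivity), smul_eq_mul] at a2
    have a3 : ∫ v, f (x - v / l) * fk v = l * ∫ v, f (x - (l * v) / l) * fk (l * v) := by
      rw [a2]; field_simp
    rw [a3, ← integral_const_mul]
    refine integral_congr_ae (Eventually.of_forall fun v => ?_)
    simp only [sub_sub_cancel, mul_div_cancel_left₀ v hlpos.ne']
    ring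
  have i1 : Integrable fun v => f (x - v / l) * fk v :=
    fk_int.bdd_mul (c := B) (hm.comp (by fun_prop)).aestronglyMeasurable (Eventually.of_forall fun v => hB _)
  have e2 : f x * κ - ∫ v, f (x - v / l) * fk v = ∫ v, (f x - f (x - v / l)) * fk v := by
    rw [hκ, ← integral_const_mul, ← integral_sub (fk_int.const_mul _) i1]
    congr 1; ext v; ring
  have e3 : |∫ v, (f x - f (x - v / l)) * fk v| ≤ ε / 4 * κ + 2 * B * (κ - ∫ u in Set.Icc (-V) V, fk u) := by
    have j : ∫ v, (ε / 4 * fk v + 2 * B * (fk v - Set.indicator (Set.Icc (-V) V) fk v)) =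
        ε / 4 * κ + 2 * B * (κ - ∫ u in Set.Icc (-V) V, fk u) := by
      rw [integral_add, integral_const_mul, integral_const_mul, integral_sub,
        integral_indicator measurableSet_Icc]
      · exact fk_int
      · exact fk_int.indicator measurableSet_Icc
      · exact fk_int.const_mul _
      · exact (fk_int.sub (fk_int.indicator measurableSet_Icc)).const_mul _
    rw [← j, ← Real.norm_eq_abs]
    refine norm_integral_le_of_norm_le ?_ (Eventually.of_forall fun v => ?_)
    · exact (fk_int.const_mul _).add ((fk_int.sub (fk_int.indicator measurableSet_Icc)).const_mul _)
    · have hk := fk_nonneg v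
      rw [norm_mul, Real.norm_eq_abs, Real.norm_of_nonneg hk]
      by_cases hv : v ∈ Set.Icc (-V) V
      · rw [Set.indicator_of_mem hv, sub_self, mul_zero, add_zero]
        refine mul_le_mul_of_nonneg_right (hX0 _ _ hx0 ?_) hk
        rw [sub_sub_cancel, abs_div, abs_of_pos hlpos, div_le_iff₀ hlpos, hl]
        have := abs_le.2 hv
        field_simp; linarith
      · rw [Set.indicator_of_notMem hv, sub_zero]
        have b1 := hB x
        have b2 := hB (x - v / l)
        have b3 := abs_sub (f x) (f (x - v / l))
        nlinarith
  rw [e1] at hx1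
  have e4 : |f x * κ| < ε * κ := by
    have : f x * κ = (∫ v, f (x - v / l) * fk v) + ∫ v, (f x - f (x - v / l)) * fk v := by
      rw [← e2]; ring
    have h5 : 2 * B * (κ - ∫ u in Set.Icc (-V) V, fk u) ≤ ε * κ / 4 := by
      calc _ ≤ 2 * B * (ε * κ / (4 * (2 * B + 1))) := by gcongr
        _ = ε * κ / 4 * (2 * B / (2 * B + 1)) := by field_simp
        _ ≤ ε * κ / 4 * 1 := by
          gcongr
          rw [div_le_one (by positivity)]; linarith
        _ = _ := mul_one _
    calc |f x * κ| ≤ |∫ v, f (x - v / l) * fk v| + |∫ v, (f x - f (x - v / l)) * fk v| := by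
          rw [this]; exact abs_add_le _ _
      _ < ε * κ / 4 + (ε / 4 * κ + ε * κ / 4) := by linarith
      _ ≤ ε * κ := by nlinarith [mul_pos hε hk0]
  rw [abs_mul, abs_of_pos hk0] at e4
  exact lt_of_mul_lt_mul_right e4 hk0.le

end taub
end Beu
end PartA3

section PartA4
open Filter Topology MeasureTheory
namespace Beu
namespace Sys
variable {P : Type*} (Q : Sys P)

/-- truncated remainder -/
noncomputable def r (t : ℝ) : ℝ := Set.indicator (Set.Ioi 1) (fun t => Q.cnt t - Q.c * t) t
/-- Mellin transform of the remainder -/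
noncomputable def H (s : ℂ) : ℂ := mellin (fun t => (Q.r t : ℂ)) (-s)
/-- regularised zeta -/
noncomputable def W (s : ℂ) : ℂ := Q.c + (s - 1) * Q.H s

lemma cnt_meas : Measurable Q.cnt := Monotone.measurable fun _ _ h => Q.cnt_mono h
lemma r_meas : Measurable Q.r := by
  unfold r; refine Measurable.indicator ?_ measurableSet_Ioi
  have := Q.cnt_meas; fun_prop

lemma r_le (t : ℝ) (ht : 0 < t) : |Q.r t| ≤ Q.C * t ^ (1 - Q.θ) := by
  unfold r
  by_cases h : t ∈ Set.Ioi (1:ℝ)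
  · rw [Set.indicator_of_mem h]; exact Q.hcnt' t (le_of_lt h)
  · rw [Set.indicator_of_notMem h, abs_zero]
    exact mul_nonneg Q.C_nonneg (by positivity)

lemma r_locint : LocallyIntegrableOn (fun t => (Q.r t : ℂ)) (Set.Ioi 0) := by
  have h : LocallyIntegrableOn (fun t : ℝ => Q.C * |t| ^ (1 - Q.θ)) (Set.Ioi 0) := by
    refine (Continuous.locallyIntegrable ?_).locallyIntegrableOn _
    exact continuous_const.mul (continuous_abs.rpow_const fun t => Or.inr (by linarith [Q.hθ1]))
  refine LocallyIntegrableOn.mono h (Complex.measurable_ofReal.comp Q.r_meas).aestronglyMeasurable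
    (Eventually.of_forall fun t => ?_)
  have hp : 0 ≤ Q.C * |t| ^ (1 - Q.θ) := mul_nonneg Q.C_nonneg (by positivity)
  rw [Complex.norm_real, Real.norm_of_nonneg hp]
  rcases lt_or_ge 0 t with ht | ht
  · rw [abs_of_pos ht]; exact Q.r_le t ht
  · have : t ∉ Set.Ioi (1:ℝ) := by simp; linarith
    simp only [r, Set.indicator_of_notMem this, norm_zero]
    exact hp

lemma r_top : (fun t => (Q.r t : ℂ)) =O[atTop] (fun t : ℝ => t ^ (-(Q.θ - 1))) := by
  refine Asymptotics.IsBigO.of_bound Q.C ?_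
  filter_upwards [eventually_gt_atTop 0] with t ht
  have hp : 0 ≤ t ^ (-(Q.θ - 1)) := by positivity
  rw [Complex.norm_real, Real.norm_of_nonneg hp, neg_sub]
  exact Q.r_le t ht

lemma r_bot (b : ℝ) : (fun t => (Q.r t : ℂ)) =O[𝓝[>] 0] (fun t : ℝ => t ^ (-b)) := by
  refine Asymptotics.IsBigO.of_bound 0 ?_
  filter_upwards [Ioo_mem_nhdsGT (zero_lt_one' ℝ)] with t ht
  have : t ∉ Set.Ioi (1:ℝ) := by simpa using ht.2.le
  simp only [r, Set.indicator_of_notMem this]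
  simp

lemma H_diff (s : ℂ) (hs : 1 - Q.θ < s.re) : DifferentiableAt ℂ Q.H s := by
  have := mellin_differentiableAt_of_isBigO_rpow (s := -s) (b := (-s).re - 1) Q.r_locint Q.r_top
    (by simp; linarith) (Q.r_bot _) (by linarith)
  exact this.comp s (differentiableAt_id.neg)

lemma W_diff (s : ℂ) (hs : 1 - Q.θ < s.re) : DifferentiableAt ℂ Q.W s := by
  unfold W; have := Q.H_diff s hs
  fun_prop

lemma H_eq (s : ℂ) (hs : 1 < s.re) :
    ∫ t in Set.Ioi (1:ℝ), (Q.cnt t : ℂ) * (t : ℂ) ^ (-(s + 1)) = Q.c / (s - 1) + Q.H s := by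
  have conv := mellinConvergent_of_isBigO_rpow (s := -s) (b := (-s).re - 1) Q.r_locint Q.r_top
    (by simp; linarith [Q.hθ]) (Q.r_bot _) (by linarith)
  unfold MellinConvergent at conv
  have hsub : Set.Ioi (1:ℝ) ⊆ Set.Ioi 0 := Set.Ioi_subset_Ioi zero_le_one
  have eH : Q.H s = ∫ t in Set.Ioi (1:ℝ), (t : ℂ) ^ (-s - 1) • (Q.r t : ℂ) := by
    unfold H mellin
    refine setIntegral_eq_of_subset_of_forall_sdiff_eq_zero measurableSet_Ioi hsub fun t ht => ?_
    simp [r, Set.indicator_of_notMem ht.2]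
  have e2 : ∫ t in Set.Ioi (1:ℝ), (Q.c : ℂ) * (t : ℂ) ^ (-s) = Q.c / (s - 1) := by
    rw [integral_const_mul, integral_Ioi_cpow_of_lt (by simpa using hs) zero_lt_one]
    have : s - 1 ≠ 0 := fun h => by
      have := congrArg Complex.re h; simp at this; linarith
    have : -s + 1 ≠ 0 := fun h => this (by linear_combination -h)
    simp
    rw [show s - 1 = -(-s + 1) by ring, div_neg]
    field_simp
  rw [eH, ← e2, ← integral_add]
  · refine setIntegral_congr_fun measurableSet_Ioi fun t ht => ?_
    have ht' : (1:ℝ) < t := ht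
    have h0 : (t : ℂ) ≠ 0 := by exact_mod_cast (by linarith : t ≠ 0)
    simp only [r, Set.indicator_of_mem ht, smul_eq_mul]
    rw [show -s = -(s + 1) + 1 by ring, Complex.cpow_add _ _ h0, Complex.cpow_one,
      show -(s + 1) + 1 - 1 = -(s + 1) by ring]
    push_cast; ring
  · exact (integrableOn_Ioi_cpow_of_lt (by simpa using hs) zero_lt_one).const_mul _
  · exact conv.mono_set hsub

lemma zeta_W (s : ℂ) (hs : 1 < s.re) : Q.zeta s * (s - 1) = s * Q.W s := by
  rw [Q.zeta_mellin s hs, Q.H_eq s hs]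
  have : s - 1 ≠ 0 := fun h => by
    have := congrArg Complex.re h; simp at this; linarith
  unfold W; field_simp

lemma W_ne_zero (s : ℂ) (hs : 1 ≤ s.re) : Q.W s ≠ 0 := by
  have hθ := Q.hθ
  rcases hs.lt_or_eq with h | h
  · intro h0
    have h1 := Q.zeta_W s h
    have : s - 1 ≠ 0 := fun h => by
      have := congrArg Complex.re h; simp at this; linarith
    rw [h0, mul_zero] at h1
    exact mul_ne_zero (Q.zeta_ne_zero s h) this h1
  rcases eq_or_ne s.im 0 with hi | hi
  · have : s = 1 := Complex.ext (by simp [← h]) (by simp [hi])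
    subst this
    simp [W, Q.hc.ne']
  intro h0
  set t := s.im with ht
  have hs' : s = 1 + t * Complex.I := Complex.ext (by simp [← h]) (by simp [ht])
  have htC : (t : ℂ) ≠ 0 := by exact_mod_cast hi
  have hI := Complex.I_ne_zero
  -- limits as σ → 1+
  have l0 : ∀ a : ℝ, Tendsto (fun σ : ℝ => Q.W (σ + a * Complex.I)) (𝓝[>] 1) (𝓝 (Q.W (1 + a * Complex.I))) := by
    intro a
    have h1 := (Q.W_diff (1 + a * Complex.I) (by simp [hθ])).continuousAt
    have h2 : Continuous fun σ : ℝ => (σ : ℂ) + a * Complex.I := by fun_prop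
    have h3 := (h2.tendsto 1).mono_left (nhdsWithin_le_nhds (s := Set.Ioi 1))
    rw [Complex.ofReal_one] at h3
    exact h1.tendsto.comp h3
  have l1 : Tendsto (fun σ : ℝ => ‖(σ : ℂ) * Q.W σ‖ ^ 3) (𝓝[>] 1) (𝓝 (‖(1:ℂ) * Q.W 1‖ ^ 3)) := by
    have h1 := l0 0
    simp only [Complex.ofReal_zero, zero_mul, add_zero] at h1
    have h2 : Tendsto (fun σ : ℝ => (σ : ℂ)) (𝓝[>] 1) (𝓝 1) := by
      have := (Complex.continuous_ofReal.tendsto 1).mono_left (nhdsWithin_le_nhds (s := Set.Ioi 1))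
      simpa using this
    exact (h2.mul h1).norm.pow 3
  have l2 : Tendsto (fun σ : ℝ => ‖((σ : ℂ) + t * Complex.I) / ((σ : ℂ) + t * Complex.I - 1) *
      (Q.W (σ + t * Complex.I) / ((σ : ℂ) - 1))‖ ^ 4) (𝓝[>] 1)
      (𝓝 (‖((1 : ℂ) + t * Complex.I) / ((1 : ℂ) + t * Complex.I - 1) * deriv Q.W s‖ ^ 4)) := by
    have h1 := (Q.W_diff s (by linarith)).hasDerivAt
    rw [hasDerivAt_iff_tendsto_slope] at h1
    have h2 : Tendsto (fun σ : ℝ => (σ : ℂ) + t * Complex.I) (𝓝[>] 1) (𝓝[≠] s) := by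
      refine tendsto_nhdsWithin_iff.2 ⟨?_, ?_⟩
      · have h2 : Continuous fun σ : ℝ => (σ : ℂ) + t * Complex.I := by fun_prop
        have h3 := (h2.tendsto 1).mono_left (nhdsWithin_le_nhds (s := Set.Ioi 1))
        rwa [Complex.ofReal_one, ← hs'] at h3
      · filter_upwards [self_mem_nhdsWithin] with σ hσ he
        have hσ' : 1 < σ := hσ
        rw [hs'] at he
        have := congrArg Complex.re he
        simp at this; linarith
    have h3 := h1.comp h2
    have h4 : Tendsto (fun σ : ℝ => ((σ : ℂ) + t * Complex.I) / ((σ : ℂ) + t * Complex.I - 1)) (𝓝[>] 1)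
        (𝓝 (((1 : ℂ) + t * Complex.I) / ((1 : ℂ) + t * Complex.I - 1))) := by
      have h5 := h2.mono_right nhdsWithin_le_nhds
      rw [hs'] at h5
      exact h5.div (h5.sub_const 1) (by simp [htC])
    refine ((h4.mul h3).norm.pow 4).congr fun σ => ?_
    simp only [Function.comp, slope_def_field, h0, sub_zero]
    rw [hs']; congr 4; ring
  have l3 : Tendsto (fun σ : ℝ => ‖((σ : ℂ) + 2 * t * Complex.I) / ((σ : ℂ) + 2 * t * Complex.I - 1) *
      Q.W (σ + 2 * t * Complex.I)‖) (𝓝[>] 1) (𝓝 (‖((1 : ℂ) + 2 * t * Complex.I) /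
        ((1 : ℂ) + 2 * t * Complex.I - 1) * Q.W (1 + 2 * t * Complex.I)‖)) := by
    have h1 := l0 (2 * t)
    push_cast at h1
    have h2 : Continuous fun σ : ℝ => (σ : ℂ) + 2 * t * Complex.I := by fun_prop
    have h3 := (h2.tendsto 1).mono_left (nhdsWithin_le_nhds (s := Set.Ioi 1))
    rw [Complex.ofReal_one] at h3
    exact ((h3.div (h3.sub_const 1) (by simp [htC])).mul h1).norm
  have l4 : Tendsto (fun σ : ℝ => σ - 1) (𝓝[>] 1) (𝓝 0) := by
    have : Continuous fun σ : ℝ => σ - 1 := by fun_prop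
    simpa using (this.tendsto 1).mono_left (nhdsWithin_le_nhds (s := Set.Ioi 1))
  have l5 := ((l1.mul l2).mul l3).mul l4
  rw [mul_zero] at l5
  have : (1:ℝ) ≤ 0 := by
    refine ge_of_tendsto l5 ?_
    filter_upwards [self_mem_nhdsWithin] with σ hσ
    have hσ' : 1 < σ := hσ
    have h1 := Q.three_four_one σ hσ' t
    have hz : ∀ a : ℂ, a.re = 0 → Q.zeta (σ + a) = (σ + a) / (σ + a - 1) * Q.W (σ + a) := by
      intro a ha
      have hre : (1:ℝ) < ((σ:ℂ) + a).re := by simpa [ha] using hσ'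
      have hne : (σ:ℂ) + a - 1 ≠ 0 := fun h => by
        have := congrArg Complex.re h; simp [ha] at this; linarith
      have := Q.zeta_W _ hre
      field_simp
      linear_combination this
    have z0 := hz 0 (by simp)
    have z1 := hz (t * Complex.I) (by simp)
    have z2 := hz (2 * t * Complex.I) (by simp)
    rw [add_zero] at z0
    rw [z0, z1, z2] at h1
    have hσC : ‖(σ:ℂ) - 1‖ = σ - 1 := by
      rw [← Complex.ofReal_one, ← Complex.ofReal_sub, Complex.norm_of_nonneg (by linarith)]
    have hpos : 0 < σ - 1 := by linarith
    refine h1.trans (le_of_eq ?_)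
    simp only [norm_mul, norm_div, hσC]
    field_simp
  linarith

/-- normalised Möbius sum -/
noncomputable def f (t : ℝ) : ℝ := Real.exp (-t) * Q.M (Real.exp t)

lemma F_mono {x y : ℝ} (h : x ≤ y) : Q.F x ⊆ Q.F y := fun m hm => by
  simp at hm ⊢; linarith

lemma M_diff {x y : ℝ} (h : x ≤ y) : |Q.M y - Q.M x| ≤ Q.cnt y - Q.cnt x := by
  classical
  have h1 : Q.M y - Q.M x = ∑ u ∈ Q.F y \ Q.F x, (-1 : ℝ) ^ u.card := by
    unfold M
    rw [← Finset.sum_sdiff (Q.F_mono h)]; ring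
  have h2 : (Q.F y \ Q.F x).card ≤ (Q.I y \ Q.I x).card := by
    refine Finset.card_le_card_of_injOn Finset.val ?_ (Finset.val_injective.injOn)
    intro u hu
    simpa using hu
  have h3 : ((Q.I y \ Q.I x).card : ℝ) = Q.cnt y - Q.cnt x := by
    rw [Finset.card_sdiff_of_subset (Q.I_mono h), Nat.cast_sub (Finset.card_le_card (Q.I_mono h))]; rfl
  rw [h1, ← h3]
  refine (Finset.abs_sum_le_sum_abs _ _).trans ?_
  simpa using h2

lemma M_meas : Measurable Q.M := by
  have h : Q.M = fun x => (Q.M x + Q.cnt x) - Q.cnt x := by ext; ring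
  have hm : Monotone fun x => Q.M x + Q.cnt x := fun x y hxy => by
    have := (abs_le.1 (Q.M_diff hxy)).1
    simp only; linarith
  rw [h]
  exact hm.measurable.sub Q.cnt_meas

lemma f_slow : ∀ η > 0, ∃ δ > 0, ∃ X0 : ℝ, ∀ x y, X0 ≤ x → |x - y| ≤ δ → |Q.f x - Q.f y| ≤ η := by
  intro η hη
  have hc := Q.hc; have hC := Q.C_nonneg; have hB := Q.B_pos; have hθ := Q.hθ
  have key : ∀ x y : ℝ, 0 ≤ x → x ≤ y → |Q.f x - Q.f y| ≤ (Q.c + Q.B) * (y - x) + 2 * Q.C * Real.exp (-Q.θ * y) := by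
    intro x y hx hxy
    have hexy : Real.exp x ≤ Real.exp y := Real.exp_le_exp.2 hxy
    have h1 := Q.M_diff hexy
    have h2 := (abs_le.1 (Q.hcnt' (Real.exp y) (Real.one_le_exp (hx.trans hxy)))).2
    have h3 := (abs_le.1 (Q.hcnt' (Real.exp x) (Real.one_le_exp hx))).1
    have h4 := Q.abs_M_le (Real.exp x) (Real.exp_pos x).le
    have h5 : Real.exp x ^ (1 - Q.θ) ≤ Real.exp y ^ (1 - Q.θ) :=
      Real.rpow_le_rpow (Real.exp_pos x).le hexy (by linarith [Q.hθ1])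
    have h6 : Real.exp y ^ (1 - Q.θ) = Real.exp y * Real.exp (-Q.θ * y) := by
      rw [← Real.exp_mul, ← Real.exp_add]; congr 1; ring
    have h7 : Real.exp (-y) * Real.exp y = 1 := by rw [← Real.exp_add]; simp
    have h8 : Real.exp (-x) * Real.exp x = 1 := by rw [← Real.exp_add]; simp
    have h9 : 1 - (y - x) ≤ Real.exp (-y) * Real.exp x := by
      rw [← Real.exp_add]
      have := Real.add_one_le_exp (-y + x); linarith
    have h10 : Real.exp (-y) ≤ Real.exp (-x) := Real.exp_le_exp.2 (by linarith)
    have e : Q.f x - Q.f y = (Real.exp (-x) - Real.exp (-y)) * Q.M (Real.exp x)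
        - Real.exp (-y) * (Q.M (Real.exp y) - Q.M (Real.exp x)) := by unfold f; ring
    rw [e]
    have a1 : |(Real.exp (-x) - Real.exp (-y)) * Q.M (Real.exp x)| ≤ Q.B * (y - x) := by
      rw [abs_mul, abs_of_nonneg (by linarith)]
      calc _ ≤ (Real.exp (-x) - Real.exp (-y)) * (Q.B * Real.exp x) :=
            mul_le_mul_of_nonneg_left h4 (by linarith)
        _ = Q.B * (Real.exp (-x) * Real.exp x - Real.exp (-y) * Real.exp x) := by ring
        _ ≤ _ := by rw [h8]; exact mul_le_mul_of_nonneg_left (by linarith) hB.le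
    have a2 : |Real.exp (-y) * (Q.M (Real.exp y) - Q.M (Real.exp x))| ≤
        Q.c * (y - x) + 2 * Q.C * Real.exp (-Q.θ * y) := by
      rw [abs_mul, Real.abs_exp]
      calc _ ≤ Real.exp (-y) * (Q.c * (Real.exp y - Real.exp x) + 2 * Q.C * (Real.exp y * Real.exp (-Q.θ * y))) := by
            refine mul_le_mul_of_nonneg_left (h1.trans ?_) (Real.exp_pos _).le
            rw [← h6]
            nlinarith
        _ = Q.c * (Real.exp (-y) * Real.exp y - Real.exp (-y) * Real.exp x)
            + 2 * Q.C * (Real.exp (-y) * Real.exp y) * Real.exp (-Q.θ * y) := by ring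
        _ ≤ _ := by
          rw [h7, mul_one]
          have := mul_le_mul_of_nonneg_left (show 1 - Real.exp (-y) * Real.exp x ≤ y - x by linarith) hc.le
          linarith
    refine (abs_sub _ _).trans ?_
    linarith
  have hlim : Tendsto (fun y : ℝ => 2 * Q.C * Real.exp (-Q.θ * y)) atTop (𝓝 0) := by
    have : Tendsto (fun y : ℝ => Real.exp (-Q.θ * y)) atTop (𝓝 0) :=
      Real.tendsto_exp_atBot.comp (tendsto_id.const_mul_atTop_of_neg (by linarith))
    simpa using this.const_mul (2 * Q.C)
  obtain ⟨Y, hY⟩ := eventually_atTop.1 (hlim.eventually (gt_mem_nhds (show (0:ℝ) < η / 2 by positivity)))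
  refine ⟨min 1 (η / 2 / (Q.c + Q.B)), by positivity, max 0 Y + 1, fun x y hx hxy => ?_⟩
  have hm0 := le_max_left 0 Y
  have hmY := le_max_right 0 Y
  have b1 : |x - y| ≤ 1 := hxy.trans (min_le_left _ _)
  have b2 : (Q.c + Q.B) * |x - y| ≤ η / 2 := by
    have := hxy.trans (min_le_right _ _)
    rw [le_div_iff₀ (by positivity)] at this
    linarith
  have b3 := abs_le.1 b1
  rcases le_total x y with h | h
  · have := key x y (by linarith) h
    have h3 := hY y (by linarith)
    rw [abs_of_nonpos (by linarith)] at b2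
    nlinarith
  · have := key y x (by linarith) h
    have h3 := hY x (by linarith)
    rw [abs_of_nonneg (by linarith)] at b2
    rw [abs_sub_comm]
    nlinarith

lemma f_laplace (s : ℂ) (hs : 0 < s.re) :
    s / ((1 + s) ^ 2 * Q.W (1 + s)) = ∫ t in Set.Ioi (0:ℝ), (Q.f t : ℂ) * Complex.exp (-s * t) := by
  have hs1 : 1 < (1 + s).re := by simpa using hs
  have h1 := Q.M_mellin (1 + s) hs1
  have h2 := Q.zeta_W (1 + s) hs1
  have hz := Q.zeta_ne_zero (1 + s) hs1
  have hW := Q.W_ne_zero (1 + s) hs1.le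
  have hs0 : s ≠ 0 := fun h => by simp [h] at hs
  have hs2 : 1 + s ≠ 0 := fun h => by
    rw [h] at hs1; simp at hs1; linarith
  rw [add_sub_cancel_left] at h2
  have e1 : s / ((1 + s) ^ 2 * Q.W (1 + s)) = (Q.zeta (1 + s))⁻¹ / (1 + s) := by
    field_simp
    linear_combination h2
  rw [e1, h1, mul_div_cancel_left₀ _ hs2]
  have himg : Real.exp '' (Set.Ioi 0) = Set.Ioi 1 := by
    ext y
    constructor
    · rintro ⟨t, ht, rfl⟩
      exact Real.one_lt_exp_iff.2 ht
    · intro hy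
      have hy' : 1 < y := hy
      exact ⟨Real.log y, Real.log_pos hy', Real.exp_log (by linarith)⟩
  have h3 := integral_image_eq_integral_abs_deriv_smul (s := Set.Ioi 0) measurableSet_Ioi
    (fun x _ => (Real.hasDerivAt_exp x).hasDerivWithinAt) Real.exp_injective.injOn
    (fun t : ℝ => (Q.M t : ℂ) * (t : ℂ) ^ (-(1 + s + 1)))
  rw [himg] at h3
  rw [h3]
  refine setIntegral_congr_fun measurableSet_Ioi fun t ht => ?_
  have e : ((Real.exp t : ℝ) : ℂ) ^ (-(1 + s + 1)) = Complex.exp (t * (-(1 + s + 1))) := by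
    rw [Complex.cpow_def_of_ne_zero (by exact_mod_cast (Real.exp_pos t).ne'), ← Complex.ofReal_log (Real.exp_pos t).le,
      Real.log_exp]
  simp only [Real.abs_exp, Complex.real_smul, f]
  rw [e]
  push_cast
  have e2 : Complex.exp (-(t:ℂ)) * Complex.exp (-s * t) = Complex.exp t * Complex.exp (t * (-(1 + s + 1))) := by
    rw [← Complex.exp_add, ← Complex.exp_add]; congr 1; ring
  linear_combination -(Q.M (Real.exp t) : ℂ) * e2

theorem M_o : Tendsto (fun x : ℝ => Q.M x / x) atTop (𝓝 0) := by
  have hW : ContinuousOn (fun s : ℂ => s / ((1 + s) ^ 2 * Q.W (1 + s))) {s | 0 ≤ s.re} := by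
    intro s hs
    have hs' : 0 ≤ s.re := hs
    have h1 : ContinuousAt (fun s : ℂ => Q.W (1 + s)) s := by
      have := (Q.W_diff (1 + s) (by simp; linarith [Q.hθ])).continuousAt
      exact this.comp (f := fun s : ℂ => 1 + s) (by fun_prop)
    have h2 := Q.W_ne_zero (1 + s) (by simpa using hs')
    have hs2 : 1 + s ≠ 0 := fun h => by
      have := congrArg Complex.re h; simp at this; linarith
    refine ContinuousAt.continuousWithinAt ?_
    refine ContinuousAt.div (by fun_prop) (ContinuousAt.mul (by fun_prop) h1) ?_
    exact mul_ne_zero (pow_ne_zero _ hs2) h2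
  have := taub Q.f ?_ Q.B ?_ ?_ _ hW (fun s hs => Q.f_laplace s hs) Q.f_slow
  · have h1 := this.comp Real.tendsto_log_atTop
    refine h1.congr' ?_
    filter_upwards [eventually_gt_atTop 0] with x hx
    simp only [Function.comp, f]
    rw [Real.exp_neg, Real.exp_log hx]; ring
  · have := Q.M_meas
    unfold f; fun_prop
  · intro t
    unfold f
    rw [abs_mul, Real.abs_exp]
    have := Q.abs_M_le (Real.exp t) (Real.exp_pos t).le
    calc _ ≤ Real.exp (-t) * (Q.B * Real.exp t) := by gcongr
      _ = Q.B * (Real.exp (-t) * Real.exp t) := by ring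
      _ = Q.B := by rw [← Real.exp_add]; simp
  · intro t ht
    unfold f M
    rw [Q.F_lt_one _ (Real.exp_lt_one_iff.2 ht)]
    simp

end Sys
end Beu
end PartA4

section PartA5
open Filter Topology MeasureTheory
namespace Beu

/-- little-o of `y`, uniform version -/
def lo (f : ℝ → ℝ) : Prop := ∀ ε > 0, ∃ C, 0 ≤ C ∧ ∀ y, 0 ≤ y → |f y| ≤ ε * y + C

lemma lo.add {f g : ℝ → ℝ} (hf : lo f) (hg : lo g) : lo fun y => f y + g y := fun ε hε => by
  obtain ⟨C, hC, h1⟩ := hf (ε / 2) (by positivity)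
  obtain ⟨D, hD, h2⟩ := hg (ε / 2) (by positivity)
  refine ⟨C + D, by positivity, fun y hy => (abs_add_le _ _).trans ?_⟩
  linarith [h1 y hy, h2 y hy]

lemma lo.const_mul {f : ℝ → ℝ} (hf : lo f) (a : ℝ) : lo fun y => a * f y := fun ε hε => by
  obtain ⟨C, hC, h1⟩ := hf (ε / (|a| + 1)) (by positivity)
  refine ⟨|a| * C, by positivity, fun y hy => ?_⟩
  rw [abs_mul]
  calc _ ≤ |a| * (ε / (|a| + 1) * y + C) := by gcongr; exact h1 y hy
    _ = ε * y * (|a| / (|a| + 1)) + |a| * C := by ring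
    _ ≤ ε * y * 1 + |a| * C := by
      gcongr
      rw [div_le_one (by positivity)]; linarith
    _ = _ := by ring

lemma lo.neg {f : ℝ → ℝ} (hf : lo f) : lo fun y => - f y := by
  simpa using hf.const_mul (-1)
lemma lo.sub {f g : ℝ → ℝ} (hf : lo f) (hg : lo g) : lo fun y => f y - g y := by
  simpa [sub_eq_add_neg] using hf.add hg.neg

lemma lo.mono {f g : ℝ → ℝ} (hf : lo f) (h : ∀ y, 0 ≤ y → |g y| ≤ |f y|) : lo g := fun ε hε => by
  obtain ⟨C, hC, h1⟩ := hf ε hε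
  exact ⟨C, hC, fun y hy => (h y hy).trans (h1 y hy)⟩

lemma lo.congr {f g : ℝ → ℝ} (hf : lo f) (h : ∀ y, 0 ≤ y → g y = f y) : lo g :=
  hf.mono fun y hy => by rw [h y hy]

lemma lo.div {f : ℝ → ℝ} (hf : lo f) (q : ℝ) (hq : 0 < q) : lo fun y => f (y / q) := fun ε hε => by
  obtain ⟨C, hC, h1⟩ := hf (ε * q) (by positivity)
  refine ⟨C, hC, fun y hy => (h1 _ (by positivity)).trans ?_⟩
  rw [mul_assoc, mul_div_cancel₀ _ hq.ne']

lemma lo_zero : lo fun _ => 0 := fun ε hε => ⟨0, le_rfl, fun y hy => by simp; positivity⟩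
lemma lo_const (a : ℝ) : lo fun _ => a := fun ε hε => ⟨|a|, abs_nonneg _, fun y hy => by
  have : 0 ≤ ε * y := by positivity
  linarith⟩

lemma lo_sum {ι : Type*} (s : Finset ι) (f : ι → ℝ → ℝ) (h : ∀ i ∈ s, lo (f i)) :
    lo fun y => ∑ i ∈ s, f i y := by
  classical
  induction s using Finset.induction_on with
  | empty => simpa using lo_zero
  | insert a s ha ih =>
    simp only [Finset.sum_insert ha]
    exact (h a (by simp)).add (ih fun i hi => h i (by simp [hi]))

lemma lo_of_tendsto {f : ℝ → ℝ} (B : ℝ) (hB : 0 ≤ B) (hb : ∀ y, 0 ≤ y → |f y| ≤ B * y)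
    (h : Tendsto (fun y => f y / y) atTop (𝓝 0)) : lo f := fun ε hε => by
  rw [Metric.tendsto_atTop] at h
  obtain ⟨Y, hY⟩ := h ε hε
  refine ⟨B * max Y 0, by positivity, fun y hy => ?_⟩
  have hpos : 0 ≤ B * max Y 0 := by positivity
  rcases le_or_gt Y y with hy' | hy'
  · rcases hy.eq_or_lt with rfl | hy0
    · have := hb 0 le_rfl; simp at this ⊢; rw [this]; simpa using hpos
    have := hY y hy'
    rw [dist_zero_right, Real.norm_eq_abs, abs_div, abs_of_pos hy0, div_lt_iff₀ hy0] at this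
    linarith
  · have h1 := hb y hy
    have : B * y ≤ B * max Y 0 := by gcongr; exact hy'.le.trans (le_max_left _ _)
    have : 0 ≤ ε * y := by positivity
    linarith

lemma lo.tendsto {f : ℝ → ℝ} (hf : lo f) : Tendsto (fun y => f y / y) atTop (𝓝 0) := by
  rw [Metric.tendsto_atTop]
  intro ε hε
  obtain ⟨C, hC, h1⟩ := hf (ε / 2) (by positivity)
  refine ⟨2 * C / ε + 1, fun y hy => ?_⟩
  have : 0 ≤ 2 * C / ε := by positivity
  have hy0 : 0 < y := by linarith
  rw [dist_zero_right, Real.norm_eq_abs, abs_div, abs_of_pos hy0, div_lt_iff₀ hy0]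
  have h2 : 2 * C / ε < y := by linarith
  rw [div_lt_iff₀ hε] at h2
  linarith [h1 y hy0.le]

/-- recursion principle -/
lemma lo_rec {f g : ℝ → ℝ} (q : ℝ) (hq : 2 ≤ q) (hf : lo f) (h0 : ∀ y < 1, g y = 0)
    (h : ∀ y, 0 ≤ y → g y = f y + g (y / q)) : lo g := fun ε hε => by
  obtain ⟨C, hC, h1⟩ := hf (ε / 4) (by positivity)
  have hsq : (1.4:ℝ) ≤ Real.sqrt 2 := Real.le_sqrt_of_sq_le (by norm_num)
  have key : ∀ k : ℕ, ∀ y : ℝ, 0 ≤ y → y < 2 ^ k → |g y| ≤ ε / 2 * y + 4 * C * Real.sqrt y := by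
    intro k
    induction k with
    | zero =>
      intro y hy hy1
      rw [h0 y (by simpa using hy1), abs_zero]; positivity
    | succ k ih =>
      intro y hy hyk
      rcases lt_or_ge y 1 with hy1 | hy1
      · rw [h0 y hy1, abs_zero]; positivity
      rw [h y hy]
      have hle : y / q ≤ y / 2 := by gcongr
      have h2 := ih (y / q) (by positivity) (by rw [pow_succ] at hyk; linarith)
      have h3 := h1 y hy
      have h4 : Real.sqrt (y / q) ≤ Real.sqrt y / 1.4 := by
        calc _ ≤ Real.sqrt (y / 2) := Real.sqrt_le_sqrt hle
          _ = Real.sqrt y / Real.sqrt 2 := Real.sqrt_div hy 2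
          _ ≤ _ := by gcongr
      have h5 : 1 ≤ Real.sqrt y := Real.one_le_sqrt.2 hy1
      have h6 : 4 * C * Real.sqrt (y / q) + C ≤ 4 * C * Real.sqrt y := by
        have : 4 * Real.sqrt (y / q) + 1 ≤ 4 * Real.sqrt y := by
          norm_num at h4; linarith
        nlinarith
      have h7 : ε / 2 * (y / q) ≤ ε / 2 * (y / 2) := by gcongr
      refine (abs_add_le _ _).trans ?_
      linarith
  refine ⟨8 * C ^ 2 / ε, by positivity, fun y hy => ?_⟩
  obtain ⟨k, hk⟩ := pow_unbounded_of_one_lt y (one_lt_two)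
  refine (key k y hy hk).trans ?_
  have h8 : Real.sqrt y ^ 2 = y := Real.sq_sqrt hy
  have h9 : 4 * C * Real.sqrt y ≤ ε / 2 * y + 8 * C ^ 2 / ε := by
    rw [← sub_nonneg, show ε / 2 * y + 8 * C ^ 2 / ε - 4 * C * Real.sqrt y
      = (ε * Real.sqrt y - 4 * C) ^ 2 / (2 * ε) by rw [← h8, Real.sqrt_sq (Real.sqrt_nonneg y)]; field_simp; ring]
    positivity
  linarith

namespace Sys
variable {P : Type*} (Q : Sys P)

lemma n_insert [DecidableEq P] (p : P) (u : Finset P) (h : p ∉ u) :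
    Q.n (insert p u).val = Q.N p * Q.n u.val := by
  rw [Finset.insert_val_of_notMem h, n_cons]

lemma mul_le_iff (p : P) (a y : ℝ) : (Q.N p : ℝ) * a ≤ y ↔ a ≤ y / Q.N p := by
  rw [le_div_iff₀ (Q.N_pos' p), mul_comm]

open Classical in
/-- Möbius sum over sets avoiding `T` -/
noncomputable def MT (T : Finset P) (y : ℝ) : ℝ := ∑ u ∈ (Q.F y).filter (fun u => Disjoint u T), (-1 : ℝ) ^ u.card

open Classical in
lemma MT_rec (T : Finset P) (q : P) (hq : q ∉ T) (y : ℝ) :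
    Q.MT (insert q T) y = Q.MT T y + Q.MT (insert q T) (y / Q.N q) := by
  have h1 : Q.MT T y = ∑ u ∈ ((Q.F y).filter (fun u => Disjoint u T)).filter (fun u => q ∉ u), (-1 : ℝ) ^ u.card
    + ∑ u ∈ ((Q.F y).filter (fun u => Disjoint u T)).filter (fun u => ¬ q ∉ u), (-1 : ℝ) ^ u.card := by
    rw [Finset.sum_filter_add_sum_filter_not]; rfl
  have h2 : ((Q.F y).filter (fun u => Disjoint u T)).filter (fun u => q ∉ u) =
      (Q.F y).filter (fun u => Disjoint u (insert q T)) := by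
    ext u; simp only [Finset.mem_filter, Finset.disjoint_insert_right]; tauto
  have h3 : ∑ u ∈ ((Q.F y).filter (fun u => Disjoint u T)).filter (fun u => ¬ q ∉ u), (-1 : ℝ) ^ u.card
      = - Q.MT (insert q T) (y / Q.N q) := by
    unfold MT
    rw [← Finset.sum_neg_distrib]
    symm
    refine Finset.sum_nbij' (fun u => insert q u) (fun u => u.erase q) ?_ ?_ ?_ ?_ ?_
    · intro u hu
      simp only [Finset.mem_filter, Finset.disjoint_insert_right, mem_F] at hu
      simp only [Finset.mem_filter, mem_F, Finset.disjoint_insert_left, Finset.mem_insert_self,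
        not_true_eq_false, not_false_eq_true, and_true, n_insert Q q u hu.2.1, Nat.cast_mul, mul_le_iff]
      exact ⟨hu.1, hq, hu.2.2⟩
    · intro u hu
      simp only [Finset.mem_filter, not_not, mem_F] at hu
      have e := Finset.insert_erase hu.2
      have := n_insert Q q (u.erase q) (by simp)
      rw [e] at this
      rw [this, Nat.cast_mul, mul_le_iff] at hu
      simp only [Finset.mem_filter, mem_F, Finset.disjoint_insert_right]
      exact ⟨hu.1.1, by simp, hu.1.2.mono_left (Finset.erase_subset _ _)⟩
    · intro u hu
      simp only [Finset.mem_filter, Finset.disjoint_insert_right, mem_F] at hu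
      exact Finset.erase_insert hu.2.1
    · intro u hu
      simp only [Finset.mem_filter, not_not] at hu
      exact Finset.insert_erase hu.2
    · intro u hu
      simp only [Finset.mem_filter, Finset.disjoint_insert_right, mem_F] at hu
      rw [Finset.card_insert_of_notMem hu.2.1, pow_succ]; ring
  rw [h1, h2, h3]; unfold MT; ring

lemma lo_MT (T : Finset P) : lo (Q.MT T) := by
  classical
  induction T using Finset.induction_on with
  | empty =>
    refine (lo_of_tendsto Q.B Q.B_pos.le Q.abs_M_le Q.M_o).congr fun y _ => ?_
    simp [MT, M]
  | insert q T hq ih =>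
    refine lo_rec (Q.N q) (Q.N_ge' q) ih (fun y hy => ?_) fun y _ => Q.MT_rec T q hq y
    simp [MT, Q.F_lt_one y hy]

open Classical in
/-- smooth count -/
noncomputable def Sm (T : Finset P) (y : ℝ) : ℝ := ((Q.I y).filter (fun m => ∀ p ∈ m, p ∈ T)).card

open Classical in
/-- rough count -/
noncomputable def Ro (T : Finset P) (y : ℝ) : ℝ := ((Q.I y).filter (fun m => ∀ p ∈ T, p ∉ m)).card

open Classical in
lemma card_cons (q : P) (y : ℝ) (A : Multiset P → Prop) [DecidablePred A]
    [DecidablePred fun m : Multiset P => q ∈ m ∧ A (m.erase q)] :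
    ((Q.I y).filter (fun m => q ∈ m ∧ A (m.erase q))).card = ((Q.I (y / Q.N q)).filter A).card := by
  symm
  refine Finset.card_nbij' (fun m => q ::ₘ m) (fun m => m.erase q) ?_ ?_ ?_ ?_
  · intro m hm
    simp only [Finset.coe_filter, mem_I, Set.mem_ofPred_eq] at hm ⊢
    simp only [n_cons, Nat.cast_mul, mul_le_iff, Multiset.mem_cons_self, Multiset.erase_cons_head]
    exact ⟨hm.1, trivial, hm.2⟩
  · intro m hm
    simp only [Finset.coe_filter, mem_I, Set.mem_ofPred_eq] at hm ⊢
    have e := Multiset.cons_erase hm.2.1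
    have := Q.n_cons q (m.erase q)
    rw [e] at this
    rw [this, Nat.cast_mul, mul_le_iff] at hm
    exact ⟨hm.1, hm.2.2⟩
  · intro m _; simp
  · intro m hm
    simp only [Finset.coe_filter, Set.mem_ofPred_eq] at hm
    exact Multiset.cons_erase hm.2.1

open Classical in
lemma lo_Sm (T : Finset P) : lo (Q.Sm T) := by
  induction T using Finset.induction_on with
  | empty =>
    refine (lo_const 1).mono fun y _ => ?_
    have : ((Q.I y).filter (fun m => ∀ p ∈ m, p ∈ (∅ : Finset P))).card ≤ 1 := by
      rw [Finset.card_le_one]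
      intro a ha b hb
      simp only [Finset.mem_filter, Finset.notMem_empty] at ha hb
      rw [Multiset.eq_zero_of_forall_notMem ha.2, Multiset.eq_zero_of_forall_notMem hb.2]
    simp only [Sm, Nat.abs_cast, abs_one]
    exact_mod_cast this
  | insert q T hq ih =>
    refine lo_rec (Q.N q) (Q.N_ge' q) ih (fun y hy => ?_) fun y _ => ?_
    · simp [Sm, Q.I_lt_one y hy]
    · unfold Sm
      rw [← Q.card_cons q y (fun m => ∀ p ∈ m, p ∈ insert q T), ← Nat.cast_add,
        ← Finset.card_filter_add_card_filter_not (s := (Q.I y).filter (fun m => ∀ p ∈ m, p ∈ insert q T)) (fun m => q ∉ m)]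
      congr 3
      · ext m
        simp only [Finset.mem_filter, and_assoc, and_congr_right_iff]
        intro _
        constructor
        · rintro ⟨h1, h2⟩ p hp
          rcases Finset.mem_insert.1 (h1 p hp) with rfl | h
          · exact absurd hp h2
          · exact h
        · intro h
          exact ⟨fun p hp => Finset.mem_insert_of_mem (h p hp), fun hh => hq (h q hh)⟩
      · ext m
        simp only [Finset.mem_filter, and_assoc, and_congr_right_iff, not_not]
        intro _
        constructor
        · rintro ⟨h1, h2⟩
          exact ⟨h2, fun p hp => h1 p (Multiset.mem_of_mem_erase hp)⟩
        · rintro ⟨h1, h2⟩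
          refine ⟨fun p hp => ?_, h1⟩
          rcases eq_or_ne p q with rfl | h
          · simp
          · exact h2 p ((Multiset.mem_erase_of_ne h).2 hp)

open Classical in
lemma Ro_rec (T : Finset P) (q : P) (hq : q ∉ T) (y : ℝ) :
    Q.Ro (insert q T) y = Q.Ro T y - Q.Ro T (y / Q.N q) := by
  have hcc := Q.card_cons q y (fun m => ∀ p ∈ T, p ∉ m)
  unfold Ro
  rw [eq_sub_iff_add_eq, ← Nat.cast_add,
    ← Finset.card_filter_add_card_filter_not (s := (Q.I y).filter (fun m => ∀ p ∈ T, p ∉ m)) (fun m => q ∉ m)]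
  congr 2
  · congr 1
    ext m
    simp only [Finset.mem_filter, and_assoc, and_congr_right_iff, Finset.mem_insert, forall_eq_or_imp]
    tauto
  · refine Eq.trans ?_ (hcc.symm.trans ?_)
    · congr!
    congr 1
    ext m
    simp only [Finset.mem_filter, and_assoc, and_congr_right_iff, not_not]
    intro _
    rw [and_comm]
    refine and_congr_left fun _ => forall_congr' fun p => forall_congr' fun hp => ?_
    rw [Multiset.mem_erase_of_ne]
    rintro rfl; exact hq hp

lemma lo_cnt : lo fun y => Q.cnt y - Q.c * y := by
  have hC := Q.C_nonneg
  have hc := Q.hc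
  refine lo_of_tendsto (Q.c + Q.B) (by linarith [Q.B_pos]) (fun y hy => ?_) ?_
  · have h1 := Q.cnt_le y hy
    have h2 := Q.cnt_nonneg y
    have : 0 ≤ Q.c * y := by positivity
    have : 0 ≤ Q.B * y := mul_nonneg Q.B_pos.le hy
    rw [abs_le]; constructor <;> linarith
  · have h1 : Tendsto (fun y : ℝ => Q.C * y ^ (-Q.θ)) atTop (𝓝 0) := by
      simpa using (tendsto_rpow_neg_atTop Q.hθ).const_mul Q.C
    refine squeeze_zero_norm' ?_ h1
    filter_upwards [eventually_ge_atTop 1] with y hy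
    have hy0 : 0 < y := by linarith
    rw [Real.norm_eq_abs, abs_div, abs_of_pos hy0, div_le_iff₀ hy0]
    refine (Q.hcnt' y hy).trans (le_of_eq ?_)
    rw [mul_assoc, ← Real.rpow_add_one hy0.ne']; congr 2; ring

lemma lo_Ro (T : Finset P) : lo fun y => Q.Ro T y - Q.c * (∏ q ∈ T, (1 - 1 / (Q.N q : ℝ))) * y := by
  classical
  induction T using Finset.induction_on with
  | empty => refine Q.lo_cnt.congr fun y _ => by simp [Ro, cnt]
  | insert q T hq ih =>
    refine (ih.sub (ih.div _ (Q.N_pos' q))).congr fun y _ => ?_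
    rw [Q.Ro_rec T q hq, Finset.prod_insert hq]
    have := (Q.N_pos' q).ne'
    field_simp
    ring

lemma prod_small (ε : ℝ) (hε : 0 < ε) :
    ∃ Z : ℝ, ∏ q ∈ Q.Pr Z, (1 - 1 / (Q.N q : ℝ)) < ε := by
  have hθ := Q.hθ
  have hW1 : Q.W 1 ≠ 0 := Q.W_ne_zero 1 (by simp)
  have h1 : Tendsto (fun σ : ℝ => ‖((σ : ℂ) - 1) / (σ * Q.W σ)‖) (𝓝[>] 1) (𝓝 0) := by
    have h2 : Tendsto (fun σ : ℝ => (σ : ℂ)) (𝓝[>] 1) (𝓝 1) := by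
      have := (Complex.continuous_ofReal.tendsto 1).mono_left (nhdsWithin_le_nhds (s := Set.Ioi 1))
      simpa using this
    have h3 : ContinuousAt Q.W 1 := (Q.W_diff 1 (by simp [hθ])).continuousAt
    have h4 := ((h2.sub_const 1).div (h2.mul (h3.tendsto.comp h2)) (by simpa using hW1)).norm
    simpa using h4
  obtain ⟨σ, hσ1, hσ⟩ := ((h1.eventually (gt_mem_nhds hε)).and self_mem_nhdsWithin).exists
  have hσ' : 1 < σ := hσ
  have hz := Q.zeta_ne_zero σ (by simpa using hσ')
  have hW := Q.zeta_W σ (by simpa using hσ')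
  have hWne := Q.W_ne_zero σ (by simpa using hσ'.le)
  have hσ0 : (σ : ℂ) ≠ 0 := by exact_mod_cast (by linarith : σ ≠ 0)
  have e : ((σ : ℂ) - 1) / (σ * Q.W σ) = (Q.zeta σ)⁻¹ := by
    field_simp; linear_combination hW
  rw [e] at hσ1
  have h5 := (Q.tendsto_euler' σ (by simpa using hσ')).norm.eventually (gt_mem_nhds hσ1)
  obtain ⟨T0, hT0⟩ := eventually_atTop.1 h5
  obtain ⟨Z, hZ⟩ : ∃ Z : ℝ, T0 ⊆ Q.Pr Z := by
    refine ⟨∑ q ∈ T0, (Q.N q : ℝ), fun q hq => ?_⟩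
    rw [mem_Pr]
    exact Finset.single_le_sum (f := fun q => (Q.N q : ℝ)) (fun i _ => (Q.N_pos' i).le) hq
  refine ⟨Z, lt_of_le_of_lt ?_ (hT0 _ hZ)⟩
  rw [norm_prod]
  refine Finset.prod_le_prod (fun q _ => ?_) fun q _ => ?_
  · have := Q.N_ge' q
    have : 1 / (Q.N q : ℝ) ≤ 1 := by rw [div_le_one (by linarith)]; linarith
    linarith
  · have h6 : (Q.N q : ℂ) ^ (-(σ:ℂ)) = (((Q.N q : ℝ) ^ (-σ) : ℝ) : ℂ) := by
      rw [Complex.ofReal_cpow (by positivity)]; simp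
    have h2 := Q.N_ge' q
    have h7 : (Q.N q : ℝ) ^ (-σ) ≤ 1 / Q.N q := by
      rw [one_div, ← Real.rpow_neg_one]
      exact Real.rpow_le_rpow_of_exponent_le (by linarith) (by linarith)
    rw [h6, ← Complex.ofReal_one, ← Complex.ofReal_sub, Complex.norm_real, Real.norm_eq_abs]
    refine le_trans ?_ (le_abs_self _)
    linarith

end Sys
end Beu
end PartA5

section PartA6
open Filter Topology MeasureTheory
namespace Beu
namespace Sys
variable {P : Type*} (Q : Sys P)

/-- distinguishable squarefree elements with smallest prime in `S` -/
def D (S : Set P) (u : Finset P) : Prop := ∃ p ∈ u, p ∈ S ∧ ∀ q ∈ u, q ≠ p → Q.N p < Q.N q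

open Classical in
lemma D_sum (A : Finset (Finset P)) (R : Finset P) (Bf : P → Finset (Finset P)) (g : Finset P → ℝ)
    (h1 : ∀ p ∈ R, ∀ u ∈ Bf p, (∀ q ∈ u, Q.N p < Q.N q) ∧ insert p u ∈ A)
    (h2 : ∀ u ∈ A, ∃ p ∈ u, p ∈ R ∧ u.erase p ∈ Bf p) :
    ∑ u ∈ A, g u = ∑ p ∈ R, ∑ u ∈ Bf p, g (insert p u) := by
  rw [Finset.sum_sigma']
  symm
  refine Finset.sum_bij (fun x _ => insert x.1 x.2) ?_ ?_ ?_ ?_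
  · rintro ⟨p, u⟩ h
    simp only [Finset.mem_sigma] at h
    exact (h1 p h.1 u h.2).2
  · rintro ⟨p, u⟩ h ⟨p', u'⟩ h' he
    simp only [Finset.mem_sigma] at h h' he
    have a1 := (h1 p h.1 u h.2).1
    have a2 := (h1 p' h'.1 u' h'.2).1
    have hpu : p ∉ u := fun hh => lt_irrefl _ (a1 p hh)
    have hpu' : p' ∉ u' := fun hh => lt_irrefl _ (a2 p' hh)
    have hp : p = p' := by
      by_contra hne
      have b1 : p ∈ insert p' u' := he ▸ Finset.mem_insert_self p u
      have b2 : p' ∈ insert p u := he.symm ▸ Finset.mem_insert_self p' u'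
      have c1 := a2 p ((Finset.mem_insert.1 b1).resolve_left hne)
      have c2 := a1 p' ((Finset.mem_insert.1 b2).resolve_left (Ne.symm hne))
      omega
    subst hp
    have : u = u' := by
      rw [← Finset.erase_insert hpu, he, Finset.erase_insert hpu']
    rw [this]
  · intro u hu
    obtain ⟨p, hp, hR, hB⟩ := h2 u hu
    exact ⟨⟨p, u.erase p⟩, Finset.mem_sigma.2 ⟨hR, hB⟩, Finset.insert_erase hp⟩
  · intro _ _; rfl

open Classical in
/-- Möbius sum over distinguishable sets -/
noncomputable def MS (S : Set P) (y : ℝ) : ℝ := ∑ u ∈ (Q.F y).filter (Q.D S), (-1 : ℝ) ^ u.card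

open Classical in
lemma MS_split (S : Set P) (Z y : ℝ) :
    ∑ u ∈ ((Q.F y).filter (Q.D S)).filter (fun u => ¬ Disjoint u (Q.Pr Z)), (-1 : ℝ) ^ u.card =
    - ∑ p ∈ (Q.Pr Z).filter (· ∈ S), Q.MT (Q.Pr (Q.N p)) (y / Q.N p) := by
  rw [Q.D_sum _ ((Q.Pr Z).filter (· ∈ S))
    (fun p => (Q.F (y / Q.N p)).filter (fun u => Disjoint u (Q.Pr (Q.N p)))), ← Finset.sum_neg_distrib]
  · refine Finset.sum_congr rfl fun p _ => ?_
    unfold MT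
    rw [← Finset.sum_neg_distrib]
    refine Finset.sum_congr rfl fun u hu => ?_
    have : p ∉ u := fun h => Finset.disjoint_left.1 (Finset.mem_filter.1 hu).2 h (by simp)
    rw [Finset.card_insert_of_notMem this, pow_succ]; ring
  · intro p hp u hu
    simp only [Finset.mem_filter, mem_Pr, mem_F] at hp hu
    have a1 : ∀ q ∈ u, Q.N p < Q.N q := fun q hq => by
      have := Finset.disjoint_left.1 hu.2 hq
      simpa using this
    have hpu : p ∉ u := fun hh => lt_irrefl _ (a1 p hh)
    refine ⟨a1, ?_⟩
    simp only [Finset.mem_filter, mem_F, Q.n_insert p u hpu, Nat.cast_mul, mul_le_iff]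
    refine ⟨⟨hu.1, p, by simp, hp.2, fun q hq hne => a1 q ((Finset.mem_insert.1 hq).resolve_left hne)⟩, ?_⟩
    rw [Finset.not_disjoint_iff]
    exact ⟨p, by simp, by simpa using hp.1⟩
  · intro u hu
    simp only [Finset.mem_filter, mem_F] at hu
    obtain ⟨⟨h1, p, hp, hpS, hmin⟩, h2⟩ := hu
    obtain ⟨q, hq, hqZ⟩ := Finset.not_disjoint_iff.1 h2
    have e := Finset.insert_erase hp
    have hn := n_insert Q p (u.erase p) (by simp)
    rw [e] at hn
    refine ⟨p, hp, ?_, ?_⟩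
    · simp only [Finset.mem_filter, mem_Pr] at hqZ ⊢
      refine ⟨?_, hpS⟩
      rcases eq_or_ne q p with rfl | hne
      · exact hqZ
      · have : (Q.N p : ℝ) < Q.N q := by exact_mod_cast hmin q hq hne
        linarith
    · simp only [Finset.mem_filter, mem_F]
      refine ⟨?_, ?_⟩
      · rw [hn, Nat.cast_mul, mul_le_iff] at h1; exact h1
      · rw [Finset.disjoint_left]
        intro q hq hq2
        have := hmin q (Finset.mem_of_mem_erase hq) (Finset.ne_of_mem_erase hq)
        simp at hq2; omega

open Classical in
lemma lo_MS (S : Set P) : lo (Q.MS S) := by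
  intro ε hε
  have hc := Q.hc
  obtain ⟨Z, hZ⟩ := Q.prod_small (ε / (4 * Q.c)) (by positivity)
  have l1 : lo fun y => - ∑ p ∈ (Q.Pr Z).filter (· ∈ S), Q.MT (Q.Pr (Q.N p)) (y / Q.N p) :=
    (lo_sum _ _ fun p _ => (Q.lo_MT _).div _ (Q.N_pos' p)).neg
  obtain ⟨C1, hC1, h1⟩ := l1 (ε / 4) (by positivity)
  obtain ⟨C2, hC2, h2⟩ := Q.lo_Ro (Q.Pr Z) (ε / 4) (by positivity)
  refine ⟨C1 + C2, by positivity, fun y hy => ?_⟩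
  have e : Q.MS S y = ∑ u ∈ ((Q.F y).filter (Q.D S)).filter (fun u => Disjoint u (Q.Pr Z)), (-1 : ℝ) ^ u.card
      + - ∑ p ∈ (Q.Pr Z).filter (· ∈ S), Q.MT (Q.Pr (Q.N p)) (y / Q.N p) := by
    rw [← Q.MS_split, Finset.sum_filter_add_sum_filter_not]; rfl
  have h3 : |∑ u ∈ ((Q.F y).filter (Q.D S)).filter (fun u => Disjoint u (Q.Pr Z)), (-1 : ℝ) ^ u.card|
      ≤ Q.Ro (Q.Pr Z) y := by
    refine (Finset.abs_sum_le_sum_abs _ _).trans ?_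
    simp only [abs_pow, abs_neg, abs_one, one_pow, Finset.sum_const, nsmul_eq_mul, mul_one]
    unfold Ro
    refine Nat.cast_le.2 (Finset.card_le_card_of_injOn Finset.val ?_ (Finset.val_injective.injOn))
    intro u hu
    simp only [Finset.coe_filter, Set.mem_ofPred_eq, Finset.mem_filter, mem_F, mem_I] at hu ⊢
    refine ⟨hu.1.1, fun p hp hpu => Finset.disjoint_left.1 hu.2 hpu hp⟩
  have h4 := (abs_le.1 (h2 y hy)).2
  have h5 := h1 y hy
  have h6 : Q.c * (∏ q ∈ Q.Pr Z, (1 - 1 / (Q.N q : ℝ))) * y ≤ ε / 4 * y := by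
    refine mul_le_mul_of_nonneg_right ?_ hy
    calc _ ≤ Q.c * (ε / (4 * Q.c)) := by gcongr
      _ = _ := by field_simp
  rw [e]
  refine (abs_add_le _ _).trans ?_
  have : 0 ≤ ε * y := by positivity
  linarith

/-- power sum bound -/
lemma pow_sum : ∃ A' : ℝ, 0 ≤ A' ∧ ∀ Y : ℝ, 0 ≤ Y →
    ∑ m ∈ Q.I Y, (Q.n m : ℝ) ^ (Q.θ - 1) ≤ A' * Y ^ Q.θ := by
  classical
  have hθ := Q.hθ; have hθ1 := Q.hθ1; have hB := Q.B_pos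
  have h2 : (2:ℝ) ^ (-Q.θ) < 1 := Real.rpow_lt_one_of_one_lt_of_neg one_lt_two (by linarith)
  set A' := 2 * Q.B / (1 - 2 ^ (-Q.θ)) with hA'
  have hpos : 0 < 1 - (2:ℝ) ^ (-Q.θ) := by linarith
  have hA0 : 0 ≤ A' := by positivity
  refine ⟨A', hA0, ?_⟩
  have key : ∀ k : ℕ, ∀ Y : ℝ, 0 ≤ Y → Y < 2 ^ k →
    ∑ m ∈ Q.I Y, (Q.n m : ℝ) ^ (Q.θ - 1) ≤ A' * Y ^ Q.θ := by
    intro k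
    induction k with
    | zero =>
      intro Y hY h
      rw [Q.I_lt_one Y (by simpa using h), Finset.sum_empty]; positivity
    | succ k ih =>
      intro Y hY h
      rcases hY.eq_or_lt with rfl | hY0
      · rw [Q.I_lt_one 0 (by norm_num), Finset.sum_empty]; positivity
      have i1 := ih (Y / 2) (by positivity) (by rw [pow_succ] at h; linarith)
      rw [← Finset.sum_sdiff (Q.I_mono (show Y / 2 ≤ Y by linarith))]
      have i2 : ∑ m ∈ Q.I Y \ Q.I (Y / 2), (Q.n m : ℝ) ^ (Q.θ - 1) ≤ Q.B * Y * (Y / 2) ^ (Q.θ - 1) := by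
        calc _ ≤ ∑ m ∈ Q.I Y \ Q.I (Y / 2), (Y / 2) ^ (Q.θ - 1) := by
              refine Finset.sum_le_sum fun m hm => ?_
              simp only [Finset.mem_sdiff, mem_I, not_le] at hm
              exact Real.rpow_le_rpow_of_nonpos (by positivity) hm.2.le (by linarith)
          _ = (Q.I Y \ Q.I (Y / 2)).card * (Y / 2) ^ (Q.θ - 1) := by simp
          _ ≤ _ := by
              gcongr
              refine le_trans ?_ (Q.cnt_le Y hY)
              unfold cnt
              exact_mod_cast Finset.card_le_card Finset.sdiff_subset
      have e1 : (Y / 2) ^ Q.θ = Y ^ Q.θ * 2 ^ (-Q.θ) := by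
        rw [Real.div_rpow hY (by norm_num), Real.rpow_neg (by norm_num)]; rfl
      have e2 : Q.B * Y * (Y / 2) ^ (Q.θ - 1) = 2 * Q.B * (Y ^ Q.θ * 2 ^ (-Q.θ)) := by
        rw [← e1, Real.rpow_sub_one (by positivity)]; field_simp
      have e3 : A' * (1 - 2 ^ (-Q.θ)) = 2 * Q.B := by rw [hA']; field_simp
      have hYθ : 0 ≤ Y ^ Q.θ := by positivity
      rw [e2] at i2
      rw [e1] at i1
      have e4 : A' * Y ^ Q.θ = A' * (Y ^ Q.θ * 2 ^ (-Q.θ)) + 2 * Q.B * Y ^ Q.θ := by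
        rw [← e3]; ring
      have e5 : 2 * Q.B * (Y ^ Q.θ * 2 ^ (-Q.θ)) ≤ 2 * Q.B * (Y ^ Q.θ * 1) := by gcongr
      linarith
  intro Y hY
  obtain ⟨k, hk⟩ := pow_unbounded_of_one_lt Y one_lt_two
  exact key k Y hY hk

open Classical in
lemma ax_step (a : Finset P → ℝ) (v L : ℝ) (hv : v ≤ L) (hL : 1 ≤ L) (X : ℝ) (hX : 0 ≤ X) :
    ∑ u ∈ Q.F X \ Q.F (X / L), a u * (if v ≤ X / Q.n u.val then 1 else 0) =
      ∑ u ∈ Q.F (X / max 1 v), a u - ∑ u ∈ Q.F (X / L), a u := by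
  have h1 : X / L ≤ X / max 1 v := by gcongr; exact max_le hL hv
  rw [eq_sub_iff_add_eq, ← Finset.sum_sdiff (Q.F_mono h1)]
  congr 1
  simp only [mul_ite, mul_one, mul_zero]
  rw [← Finset.sum_filter]
  refine Finset.sum_congr ?_ fun _ _ => rfl
  ext u
  have hn := Q.n_pos' u.val
  simp only [Finset.mem_filter, Finset.mem_sdiff, mem_F]
  rw [le_div_iff₀ (by positivity : (0:ℝ) < max 1 v), mul_max_of_nonneg _ _ hn.le, max_le_iff, le_div_iff₀ hn, mul_one,
    mul_comm v]
  tauto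

open Classical in
theorem axer (a : Finset P → ℝ) (ha : ∀ u, |a u| ≤ 1) (hA : lo fun y => ∑ u ∈ Q.F y, a u) :
    lo fun X => ∑ u ∈ Q.F X, a u * (Q.cnt (X / Q.n u.val) - Q.c * (X / Q.n u.val)) := by
  intro ε hε
  have hθ := Q.hθ; have hθ1 := Q.hθ1; have hB := Q.B_pos; have hC := Q.C_nonneg; have hc := Q.hc
  obtain ⟨A', hA0, hA'⟩ := Q.pow_sum
  obtain ⟨L, hL1, hL⟩ : ∃ L : ℕ, 1 ≤ L ∧ Q.C * A' * (L:ℝ) ^ (-Q.θ) ≤ ε / 4 := by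
    have h1 : Tendsto (fun L : ℕ => Q.C * A' * (L:ℝ) ^ (-Q.θ)) atTop (𝓝 0) := by
      simpa using ((tendsto_rpow_neg_atTop hθ).comp tendsto_natCast_atTop_atTop).const_mul (Q.C * A')
    obtain ⟨L, h, h'⟩ := ((h1.eventually (gt_mem_nhds (show (0:ℝ) < ε / 4 by positivity))).and
      (eventually_ge_atTop 1)).exists
    exact ⟨L, h', h.le⟩
  obtain ⟨K, hK⟩ := exists_nat_gt (4 * Q.c * Q.B / ε)
  have hK0 : (0:ℝ) < K := lt_of_le_of_lt (by positivity) hK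
  have hLr : (1:ℝ) ≤ L := by exact_mod_cast hL1
  have hKe : Q.c / K * Q.B ≤ ε / 4 := by
    rw [div_lt_iff₀ hε] at hK
    rw [div_mul_eq_mul_div, div_le_iff₀ hK0]
    linarith
  set A := fun y => ∑ u ∈ Q.F y, a u with hAdef
  have lmain : lo fun X => (∑ m ∈ Q.I L, (A (X / max 1 (Q.n m : ℝ)) - A (X / L)))
      + - (Q.c / K) * ∑ j ∈ Finset.Icc 1 (K * L), (A (X / max 1 ((j:ℝ) / K)) - A (X / L)) := by
    refine lo.add (lo_sum _ _ fun m _ => (hA.div _ (by positivity)).sub (hA.div _ (by positivity)))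
      (lo.const_mul (lo_sum _ _ fun m _ => (hA.div _ (by positivity)).sub (hA.div _ (by positivity))) _)
  obtain ⟨D, hD, hmain⟩ := lmain (ε / 4) (by positivity)
  refine ⟨D, hD, fun X hX => ?_⟩
  have hm := hmain X hX
  beta_reduce at hm ⊢
  have hXL : X / L ≤ X := div_le_self hX hLr
  rw [← Finset.sum_sdiff (Q.F_mono hXL)]
  -- part 1
  have p1 : |∑ u ∈ Q.F (X / L), a u * (Q.cnt (X / Q.n u.val) - Q.c * (X / Q.n u.val))| ≤ ε / 4 * X := by
    calc _ ≤ ∑ u ∈ Q.F (X / L), Q.C * X ^ (1 - Q.θ) * (Q.n u.val : ℝ) ^ (Q.θ - 1) := by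
          refine (Finset.abs_sum_le_sum_abs _ _).trans (Finset.sum_le_sum fun u hu => ?_)
          have hn := Q.n_pos' u.val
          have hu' : (Q.n u.val : ℝ) ≤ X := ((Q.mem_F _ _).1 hu).trans hXL
          rw [abs_mul]
          refine (mul_le_of_le_one_left (abs_nonneg _) (ha u)).trans ?_
          refine (Q.hcnt' _ ((one_le_div hn).2 hu')).trans (le_of_eq ?_)
          rw [Real.div_rpow hX hn.le, show Q.θ - 1 = -(1 - Q.θ) by ring, Real.rpow_neg hn.le]
          ring
      _ = Q.C * X ^ (1 - Q.θ) * ∑ u ∈ Q.F (X / L), (Q.n u.val : ℝ) ^ (Q.θ - 1) := by rw [Finset.mul_sum]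
      _ ≤ Q.C * X ^ (1 - Q.θ) * ∑ m ∈ Q.I (X / L), (Q.n m : ℝ) ^ (Q.θ - 1) := by
          gcongr
          rw [← Finset.sum_image (s := Q.F (X / L)) (g := Finset.val) (f := fun m => (Q.n m : ℝ) ^ (Q.θ - 1))
            (Finset.val_injective.injOn)]
          refine Finset.sum_le_sum_of_subset_of_nonneg ?_ fun _ _ _ => by positivity
          intro m hm
          obtain ⟨u, hu, rfl⟩ := Finset.mem_image.1 hm
          simpa using hu
      _ ≤ Q.C * X ^ (1 - Q.θ) * (A' * (X / L) ^ Q.θ) := by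
          gcongr; exact hA' _ (by positivity)
      _ = Q.C * A' * (L:ℝ) ^ (-Q.θ) * X := by
          rcases hX.eq_or_lt with rfl | hX0
          · simp [Real.zero_rpow (by linarith : 1 - Q.θ ≠ 0)]
          have e1 : X ^ (1 - Q.θ) * X ^ Q.θ = X := by
            rw [← Real.rpow_add hX0]; simp
          rw [Real.div_rpow hX (by positivity), Real.rpow_neg (by positivity)]
          linear_combination Q.C * A' * ((L:ℝ) ^ Q.θ)⁻¹ * e1
      _ ≤ _ := by gcongr
  -- part 2
  set R := Q.F X \ Q.F (X / L) with hR
  have hRmem : ∀ u ∈ R, 1 ≤ X / Q.n u.val ∧ X / Q.n u.val ≤ L := by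
    intro u hu
    have hn := Q.n_pos' u.val
    simp only [hR, Finset.mem_sdiff, mem_F, not_le] at hu
    refine ⟨(one_le_div hn).2 hu.1, ?_⟩
    rw [div_le_iff₀ hn]
    have := hu.2
    rw [div_lt_iff₀ (by positivity)] at this
    linarith
  have q1 : ∑ u ∈ R, a u * Q.cnt (X / Q.n u.val) = ∑ m ∈ Q.I L, (A (X / max 1 (Q.n m : ℝ)) - A (X / L)) := by
    have : ∀ m ∈ Q.I (L:ℝ), A (X / max 1 (Q.n m : ℝ)) - A (X / L) =
        ∑ u ∈ R, a u * (if (Q.n m : ℝ) ≤ X / Q.n u.val then 1 else 0) := fun m hm =>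
      (Q.ax_step a (Q.n m) L (by simpa using hm) hLr X hX).symm
    rw [Finset.sum_congr rfl this, Finset.sum_comm]
    refine Finset.sum_congr rfl fun u hu => ?_
    rw [← Finset.mul_sum]
    congr 1
    rw [Finset.sum_boole]
    unfold cnt
    congr 2
    ext m
    simp only [mem_I, Finset.mem_filter]
    exact ⟨fun h => ⟨h.trans (hRmem u hu).2, h⟩, fun h => h.2⟩
  have q2 : ∑ u ∈ R, a u * (⌊K * (X / Q.n u.val)⌋₊ : ℝ) =
      ∑ j ∈ Finset.Icc 1 (K * L), (A (X / max 1 ((j:ℝ) / K)) - A (X / L)) := by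
    have : ∀ j ∈ Finset.Icc 1 (K * L), A (X / max 1 ((j:ℝ) / K)) - A (X / L) =
        ∑ u ∈ R, a u * (if (j:ℝ) / K ≤ X / Q.n u.val then 1 else 0) := fun j hj =>
      (Q.ax_step a ((j:ℝ) / K) L (by
        rw [div_le_iff₀ hK0]
        have := (Finset.mem_Icc.1 hj).2
        have : (j:ℝ) ≤ K * L := by exact_mod_cast this
        linarith) hLr X hX).symm
    rw [Finset.sum_congr rfl this, Finset.sum_comm]
    refine Finset.sum_congr rfl fun u hu => ?_
    rw [← Finset.mul_sum]
    congr 1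
    rw [Finset.sum_boole]
    have hs : (Finset.Icc 1 (K * L)).filter (fun j : ℕ => (j:ℝ) / K ≤ X / Q.n u.val)
        = Finset.Icc 1 ⌊K * (X / Q.n u.val)⌋₊ := by
      ext j
      have h1 := (hRmem u hu).1
      simp only [Finset.mem_filter, Finset.mem_Icc]
      rw [Nat.le_floor_iff (by positivity), div_le_iff₀ hK0, mul_comm (K:ℝ)]
      constructor
      · rintro ⟨⟨h1, _⟩, h2⟩; exact ⟨h1, h2⟩
      · rintro ⟨h1, h2⟩
        refine ⟨⟨h1, ?_⟩, h2⟩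
        have := (hRmem u hu).2
        have : (j:ℝ) ≤ L * K := h2.trans (by gcongr)
        rw [mul_comm]; exact_mod_cast this
    rw [hs, Nat.card_Icc]; simp
  have q3 : |∑ u ∈ R, a u * (Q.cnt (X / Q.n u.val) - Q.c * (X / Q.n u.val)) -
      (∑ u ∈ R, a u * Q.cnt (X / Q.n u.val) + -(Q.c / K) * ∑ u ∈ R, a u * (⌊K * (X / Q.n u.val)⌋₊ : ℝ))|
      ≤ ε / 4 * X := by
    rw [Finset.mul_sum, ← Finset.sum_add_distrib, ← Finset.sum_sub_distrib]
    calc _ ≤ ∑ u ∈ R, Q.c / K := by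
          refine (Finset.abs_sum_le_sum_abs _ _).trans (Finset.sum_le_sum fun u hu => ?_)
          have e : a u * (Q.cnt (X / Q.n u.val) - Q.c * (X / Q.n u.val)) -
            (a u * Q.cnt (X / Q.n u.val) + -(Q.c / K) * (a u * (⌊K * (X / Q.n u.val)⌋₊ : ℝ)))
            = a u * (-(Q.c / K) * (K * (X / Q.n u.val) - ⌊K * (X / Q.n u.val)⌋₊)) := by
            field_simp; ring
          have hn := Q.n_pos' u.val
          rw [e, abs_mul, abs_mul, abs_neg, abs_of_pos (by positivity : 0 < Q.c / K)]
          have f1 := Nat.floor_le (by positivity : 0 ≤ K * (X / Q.n u.val))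
          have f2 := Nat.lt_floor_add_one (K * (X / Q.n u.val))
          rw [abs_of_nonneg (by linarith : 0 ≤ K * (X / Q.n u.val) - (⌊K * (X / Q.n u.val)⌋₊:ℝ))]
          refine (mul_le_of_le_one_left (by
            refine mul_nonneg (by positivity) (by linarith)) (ha u)).trans ?_
          refine mul_le_of_le_one_right (by positivity) (by linarith)
      _ = R.card * (Q.c / K) := by simp
      _ ≤ (Q.B * X) * (Q.c / K) := by
          gcongr
          refine le_trans ?_ ((Q.card_F_le X).trans (Q.cnt_le X hX))
          exact_mod_cast Finset.card_le_card Finset.sdiff_subset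
      _ = Q.c / K * Q.B * X := by ring
      _ ≤ _ := by gcongr
  rw [q1, q2] at q3
  have h1 := abs_le.1 p1
  have h2 := abs_le.1 q3
  have h3 := abs_le.1 hm
  have : 0 ≤ ε * X := by positivity
  rw [abs_le]
  constructor <;> linarith

/-- number of maximal-norm primes in `S` -/
noncomputable def Qs (S : Set P) (m : Multiset P) : ℝ :=
  Set.ncard {p | p ∈ m ∧ p ∈ S ∧ ∀ q ∈ m, Q.N q ≤ Q.N p}

open Classical in
lemma Qs_eq (S : Set P) (m : Multiset P) : Q.Qs S m =
    ((m.toFinset.filter (· ∈ S)).filter (fun p => ∀ q ∈ m, Q.N q ≤ Q.N p)).card := by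
  unfold Qs
  rw [← Set.ncard_coe_finset]
  congr 2
  ext p; simp [and_assoc]

open Classical in
lemma dual_inner (S : Set P) (m : Multiset P) :
    ∑ u ∈ m.toFinset.powerset.filter (Q.D S), (-1 : ℝ) ^ u.card = - Q.Qs S m := by
  rw [Q.D_sum _ (m.toFinset.filter (· ∈ S)) (fun p => (m.toFinset.filter (fun q => Q.N p < Q.N q)).powerset)]
  · have : ∀ p ∈ m.toFinset.filter (· ∈ S),
        ∑ u ∈ (m.toFinset.filter (fun q => Q.N p < Q.N q)).powerset, (-1 : ℝ) ^ (insert p u).card =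
        - (if ∀ q ∈ m, Q.N q ≤ Q.N p then 1 else 0) := by
      intro p hp
      have e : ∑ u ∈ (m.toFinset.filter (fun q => Q.N p < Q.N q)).powerset, (-1 : ℝ) ^ (insert p u).card
          = - ((∑ u ∈ (m.toFinset.filter (fun q => Q.N p < Q.N q)).powerset, (-1 : ℤ) ^ u.card : ℤ) : ℝ) := by
        push_cast
        rw [← Finset.sum_neg_distrib]
        refine Finset.sum_congr rfl fun u hu => ?_
        have : p ∉ u := fun h => by
          have := (Finset.mem_powerset.1 hu) h
          simp at this
        rw [Finset.card_insert_of_notMem this, pow_succ]; ring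
      rw [e, Finset.sum_powerset_neg_one_pow_card]
      have : (m.toFinset.filter (fun q => Q.N p < Q.N q)) = ∅ ↔ ∀ q ∈ m, Q.N q ≤ Q.N p := by
        simp [Finset.filter_eq_empty_iff]
      simp only [this]
      split_ifs <;> simp
    rw [Finset.sum_congr rfl this, Finset.sum_neg_distrib, Finset.sum_boole, Q.Qs_eq]
  · intro p hp u hu
    simp only [Finset.mem_filter, Finset.mem_powerset, Multiset.mem_toFinset] at hp hu
    have a1 : ∀ q ∈ u, Q.N p < Q.N q := fun q hq => by
      have := hu hq
      simp at this; exact this.2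
    refine ⟨a1, ?_⟩
    simp only [Finset.mem_filter, Finset.mem_powerset]
    refine ⟨?_, p, by simp, hp.2, fun q hq hne => a1 q ((Finset.mem_insert.1 hq).resolve_left hne)⟩
    intro q hq
    rcases Finset.mem_insert.1 hq with rfl | h
    · simpa using hp.1
    · exact Finset.filter_subset _ _ (hu h)
  · intro u hu
    simp only [Finset.mem_filter, Finset.mem_powerset] at hu
    obtain ⟨h1, p, hp, hpS, hmin⟩ := hu
    refine ⟨p, hp, by simpa [hpS] using h1 hp, ?_⟩
    simp only [Finset.mem_powerset]
    intro q hq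
    simp only [Finset.mem_filter]
    exact ⟨h1 (Finset.mem_of_mem_erase hq), hmin q (Finset.mem_of_mem_erase hq) (Finset.ne_of_mem_erase hq)⟩

open Classical in
theorem duality (S : Set P) (X : ℝ) :
    ∑ u ∈ (Q.F X).filter (Q.D S), (-1 : ℝ) ^ u.card * Q.cnt (X / Q.n u.val) = - ∑ m ∈ Q.I X, Q.Qs S m := by
  rw [← Finset.sum_neg_distrib]
  simp_rw [← Q.dual_inner S]
  have e : ∀ u ∈ (Q.F X).filter (Q.D S), (-1 : ℝ) ^ u.card * Q.cnt (X / Q.n u.val)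
      = ∑ m ∈ Q.I (X / Q.n u.val), (-1 : ℝ) ^ u.card := fun u _ => by
    rw [Finset.sum_const, nsmul_eq_mul, mul_comm]; rfl
  rw [Finset.sum_congr rfl e, Finset.sum_sigma', Finset.sum_sigma']
  refine Finset.sum_bij' (fun x _ => ⟨x.1.val + x.2, x.1⟩) (fun x _ => ⟨x.2, x.1 - x.2.val⟩) ?_ ?_ ?_ ?_ ?_
  · rintro ⟨u, m⟩ h
    simp only [Finset.mem_sigma, Finset.mem_filter, mem_F, mem_I, Finset.mem_powerset, n_add, Nat.cast_mul] at h ⊢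
    have hn := Q.n_pos' u.val
    have := h.2
    rw [le_div_iff₀ hn] at this
    refine ⟨by linarith, ?_, h.1.2⟩
    intro p hp
    simp
    exact Or.inl hp
  · rintro ⟨m, u⟩ h
    simp only [Finset.mem_sigma, Finset.mem_filter, mem_F, mem_I, Finset.mem_powerset] at h ⊢
    obtain ⟨h1, h2, h3⟩ := h
    have hle : u.val ≤ m := (Multiset.le_iff_subset u.nodup).2 fun p hp => by
      simpa using h2 hp
    have e := Q.n_add u.val (m - u.val)
    rw [add_tsub_cancel_of_le hle] at e
    have hn := Q.n_pos' u.val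
    have hn2 := Q.n_ge' (m - u.val)
    rw [e, Nat.cast_mul] at h1
    refine ⟨⟨by nlinarith, h3⟩, ?_⟩
    rw [le_div_iff₀ hn]; linarith
  · rintro ⟨u, m⟩ h; simp
  · rintro ⟨m, u⟩ h
    simp only [Finset.mem_sigma, Finset.mem_filter, Finset.mem_powerset] at h
    have hle : u.val ≤ m := (Multiset.le_iff_subset u.nodup).2 fun p hp => by
      simpa using h.2.1 hp
    simp [add_tsub_cancel_of_le hle]
  · rintro ⟨u, m⟩ h; rfl

end Sys
end Beu
end PartA6

section PartA7
open Filter Topology MeasureTheory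
namespace Beu
namespace Sys
variable {P : Type*} (Q : Sys P)

/-- maximal norm -/
noncomputable def mx (m : Multiset P) : ℕ := (m.map Q.N).sup

lemma le_mx {m : Multiset P} {q : P} (h : q ∈ m) : Q.N q ≤ Q.mx m :=
  Multiset.le_sup (Multiset.mem_map_of_mem _ h)
lemma mx_le {m : Multiset P} {a : ℕ} : Q.mx m ≤ a ↔ ∀ q ∈ m, Q.N q ≤ a := by
  unfold mx; rw [Multiset.sup_le]; simp
lemma exists_mx {m : Multiset P} (h : m ≠ 0) : ∃ q ∈ m, Q.N q = Q.mx m := by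
  by_contra! hne
  obtain ⟨q, hq⟩ := Multiset.exists_mem_of_ne_zero h
  have h2 := Q.two_le q
  have h3 := Q.le_mx hq
  have : Q.mx m ≤ Q.mx m - 1 := Q.mx_le.2 fun q hq => by
    have := Q.le_mx hq; have := hne q hq; omega
  omega

open Classical in
/-- counting of primes in `S` -/
noncomputable def piS (S : Set P) (y : ℝ) : ℝ := ((Q.Pr y).filter (· ∈ S)).card

open Classical in
/-- the auxiliary set -/
noncomputable def G (X : ℝ) : Finset (Multiset P) := (Q.I X).filter (fun m => (Q.mx m : ℝ) * Q.n m ≤ X)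

open Classical in
lemma Qs_sum (S : Set P) (X : ℝ) : ∑ m ∈ Q.I X, Q.Qs S m =
    ∑ m ∈ Q.G X, (Q.piS S (X / Q.n m) - Q.piS S (Q.mx m - 1)) := by
  have e1 : ∀ m ∈ Q.G X, Q.piS S (X / Q.n m) - Q.piS S (Q.mx m - 1) =
      (((Q.Pr (X / Q.n m)).filter (· ∈ S)).filter (fun p => Q.mx m ≤ Q.N p)).card := by
    intro m hm
    have hn := Q.n_pos' m
    have h2 : (Q.mx m : ℝ) ≤ X / Q.n m := by
      rw [le_div_iff₀ hn]; exact (Finset.mem_filter.1 hm).2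
    unfold piS
    rw [sub_eq_iff_eq_add, ← Nat.cast_add, ← Finset.card_filter_add_card_filter_not (fun p => Q.mx m ≤ Q.N p)]
    congr 3
    ext p
    simp only [Finset.mem_filter, mem_Pr, not_le]
    constructor
    · rintro ⟨⟨h1, h3⟩, h4⟩
      refine ⟨?_, h3⟩
      have : (Q.N p : ℝ) + 1 ≤ Q.mx m := by exact_mod_cast h4
      linarith
    · rintro ⟨h1, h3⟩
      refine ⟨⟨by linarith, h3⟩, ?_⟩
      have : (Q.N p : ℝ) < Q.mx m := by linarith
      exact_mod_cast this
  rw [Finset.sum_congr rfl e1]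
  simp_rw [Q.Qs_eq]
  rw [← Nat.cast_sum, ← Nat.cast_sum, ← Finset.card_sigma, ← Finset.card_sigma]
  congr 1
  refine Finset.card_bij' (fun x _ => ⟨x.1.erase x.2, x.2⟩) (fun x _ => ⟨x.2 ::ₘ x.1, x.2⟩) ?_ ?_ ?_ ?_
  · rintro ⟨m, p⟩ h
    simp only [Finset.mem_sigma, Finset.mem_filter, mem_I, Multiset.mem_toFinset] at h
    obtain ⟨h1, ⟨h2, h3⟩, h4⟩ := h
    have e := Multiset.cons_erase h2
    have e2 := Q.n_cons p (m.erase p)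
    rw [e] at e2
    rw [e2, Nat.cast_mul] at h1
    have hm : Q.mx (m.erase p) ≤ Q.N p := Q.mx_le.2 fun q hq => h4 q (Multiset.mem_of_mem_erase hq)
    have hm' : (Q.mx (m.erase p) : ℝ) ≤ Q.N p := by exact_mod_cast hm
    have hn := Q.n_pos' (m.erase p)
    have hN := Q.N_ge' p
    simp only [Finset.mem_sigma, Finset.mem_filter, mem_Pr, G, mem_I]
    refine ⟨⟨by nlinarith, by nlinarith⟩, ⟨?_, h3⟩, hm⟩
    rw [le_div_iff₀ hn]; exact h1
  · rintro ⟨m, p⟩ h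
    simp only [Finset.mem_sigma, Finset.mem_filter, mem_Pr, G, mem_I] at h
    obtain ⟨h1, ⟨h2, h3⟩, h4⟩ := h
    have hn := Q.n_pos' m
    rw [le_div_iff₀ hn] at h2
    simp only [Finset.mem_sigma, Finset.mem_filter, mem_I, Multiset.mem_toFinset, n_cons, Nat.cast_mul]
    refine ⟨h2, ⟨Multiset.mem_cons_self _ _, h3⟩, fun q hq => ?_⟩
    rcases Multiset.mem_cons.1 hq with rfl | h
    · exact le_rfl
    · exact (Q.le_mx h).trans h4
  · rintro ⟨m, p⟩ h
    simp only [Finset.mem_sigma, Finset.mem_filter, Multiset.mem_toFinset] at h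
    simp [Multiset.cons_erase h.2.1.1]
  · rintro ⟨m, p⟩ h
    simp

lemma lo_G : lo fun X => ((Q.G X).card : ℝ) := by
  classical
  intro ε hε
  have hB := Q.B_pos
  set Z := 2 * Q.B / ε with hZ
  have hZ0 : 0 < Z := by positivity
  obtain ⟨C, hC, h⟩ := Q.lo_Sm (Q.Pr Z) (ε / 2) (by positivity)
  refine ⟨C, hC, fun X hX => ?_⟩
  have h1 : Q.G X ⊆ (Q.I X).filter (fun m => ∀ p ∈ m, p ∈ Q.Pr Z) ∪ Q.I (X / Z) := by
    intro m hm
    simp only [G, Finset.mem_filter, mem_I] at hm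
    by_cases hh : ∀ p ∈ m, p ∈ Q.Pr Z
    · exact Finset.mem_union_left _ (by simp only [Finset.mem_filter, mem_I]; exact ⟨hm.1, hh⟩)
    · push Not at hh
      obtain ⟨p, hp, hpZ⟩ := hh
      simp only [mem_Pr, not_le] at hpZ
      have : (Q.N p : ℝ) ≤ Q.mx m := by exact_mod_cast Q.le_mx hp
      refine Finset.mem_union_right _ ?_
      rw [mem_I, le_div_iff₀ hZ0]
      have := Q.n_pos' m
      nlinarith [hm.2]
  have h2 := (Finset.card_le_card h1).trans (Finset.card_union_le _ _)
  have h3 := (abs_le.1 (h X hX)).2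
  have h4 := Q.cnt_le (X / Z) (by positivity)
  have h5 : Q.B * (X / Z) = ε / 2 * X := by rw [hZ]; field_simp
  have h6 : ((Q.G X).card : ℝ) ≤ Q.Sm (Q.Pr Z) X + Q.cnt (X / Z) := by
    unfold Sm cnt
    refine (Nat.cast_le.2 h2).trans (le_of_eq ?_)
    push_cast
    congr 3
  rw [abs_of_nonneg (by positivity)]
  linarith

lemma piS_univ (y : ℝ) : Q.piS Set.univ y = (Q.Pr y).card := by simp [piS]
lemma Pr_card (y : ℝ) (hy : 2 ≤ y) : ((Q.Pr y).card : ℝ) ≤ Q.A * y / Real.log y := by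
  refine le_trans (le_of_eq ?_) (Q.hpi y hy)
  rw [← Set.ncard_coe_finset]
  congr 2
  ext p; simp
lemma A_nonneg : 0 ≤ Q.A := by
  have h := (Nat.cast_nonneg _).trans (Q.hpi 2 le_rfl)
  have h2 := Real.log_pos one_lt_two
  by_contra hh
  push Not at hh
  have : Q.A * 2 / Real.log 2 < 0 := div_neg_of_neg_of_pos (by linarith) h2
  linarith

lemma sum_tele (K : ℕ) : ∑ k ∈ Finset.Icc 1 K, 1 / ((k : ℝ) * (k + 1)) ≤ 1 := by
  have : ∀ K : ℕ, ∑ k ∈ Finset.Icc 1 K, 1 / ((k : ℝ) * (k + 1)) = 1 - 1 / (K + 1) := by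
    intro K
    induction K with
    | zero => simp
    | succ K ih =>
      rw [Finset.sum_Icc_succ_top (by omega), ih]
      push_cast
      field_simp
      ring
  rw [this]
  have : (0:ℝ) ≤ 1 / (K + 1) := by positivity
  linarith

lemma pi_sum : ∃ E : ℝ, 0 ≤ E ∧ ∀ T : Finset P, ∑ q ∈ T, ((Q.Pr (Q.N q)).card : ℝ) / (Q.N q : ℝ) ^ 2 ≤ E := by
  classical
  have hA := Q.A_nonneg
  have hl := Real.log_pos one_lt_two
  refine ⟨2 * Q.A ^ 2 / Real.log 2 ^ 2, by positivity, fun T => ?_⟩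
  set K := T.sup (fun q => Nat.log 2 (Q.N q)) with hK
  have hmaps : ∀ q ∈ T, Nat.log 2 (Q.N q) ∈ Finset.Icc 1 K := fun q hq => by
    rw [Finset.mem_Icc]
    exact ⟨Nat.log_pos one_lt_two (Q.two_le q), Finset.le_sup (f := fun q => Nat.log 2 (Q.N q)) hq⟩
  rw [← Finset.sum_fiberwise_of_maps_to hmaps]
  calc _ ≤ ∑ k ∈ Finset.Icc 1 K, 2 * Q.A ^ 2 / Real.log 2 ^ 2 * (1 / ((k : ℝ) * (k + 1))) := by
        refine Finset.sum_le_sum fun k hk => ?_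
        have hk1 : (1:ℝ) ≤ k := by exact_mod_cast (Finset.mem_Icc.1 hk).1
        have hk0 := (Finset.mem_Icc.1 hk).1
        calc _ ≤ ∑ q ∈ T with Nat.log 2 (Q.N q) = k, Q.A / (2 ^ k * (k * Real.log 2)) := by
              refine Finset.sum_le_sum fun q hq => ?_
              have hq2 := (Finset.mem_filter.1 hq).2
              have hpow : 2 ^ k ≤ Q.N q := by
                rw [← hq2]; exact Nat.pow_log_le_self 2 (by have := Q.two_le q; omega)
              have hpow' : (2:ℝ) ^ k ≤ Q.N q := by exact_mod_cast hpow
              have hlog : k * Real.log 2 ≤ Real.log (Q.N q) := by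
                rw [← Real.log_pow]; exact Real.log_le_log (by positivity) hpow'
              have hN := Q.N_pos' q
              have hlp : 0 < Real.log (Q.N q) := Real.log_pos (by linarith [Q.N_ge' q])
              calc _ ≤ (Q.A * Q.N q / Real.log (Q.N q)) / (Q.N q : ℝ) ^ 2 := by
                    gcongr; exact Q.Pr_card _ (Q.N_ge' q)
                _ = Q.A / (Q.N q * Real.log (Q.N q)) := by field_simp
                _ ≤ _ := by gcongr
          _ = ((T.filter (fun q => Nat.log 2 (Q.N q) = k)).card : ℝ) * (Q.A / (2 ^ k * (k * Real.log 2))) := by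
              simp
          _ ≤ (Q.A * 2 ^ (k + 1) / ((k + 1) * Real.log 2)) * (Q.A / (2 ^ k * (k * Real.log 2))) := by
              gcongr
              have h1 := Q.Pr_card (2 ^ (k + 1)) (by
                have : (2:ℝ) ^ 1 ≤ 2 ^ (k + 1) := pow_le_pow_right₀ one_le_two (by omega)
                linarith)
              rw [Real.log_pow] at h1
              push_cast at h1
              refine le_trans ?_ h1
              refine Nat.cast_le.2 (Finset.card_le_card fun q hq => ?_)
              have hq2 := (Finset.mem_filter.1 hq).2
              have := Nat.lt_pow_succ_log_self (b := 2) one_lt_two (Q.N q)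
              rw [hq2] at this
              rw [mem_Pr]
              exact_mod_cast this.le
          _ = _ := by rw [pow_succ]; field_simp
    _ = 2 * Q.A ^ 2 / Real.log 2 ^ 2 * ∑ k ∈ Finset.Icc 1 K, (1 / ((k : ℝ) * (k + 1))) := by rw [Finset.mul_sum]
    _ ≤ 2 * Q.A ^ 2 / Real.log 2 ^ 2 * 1 := by gcongr; exact sum_tele K
    _ = _ := mul_one _

lemma tail_sq (ε : ℝ) (hε : 0 < ε) : ∃ Z : ℝ, ∀ T : Finset P, (∀ q ∈ T, Z < Q.N q) →
    ∑ q ∈ T, 1 / (Q.N q : ℝ) ^ 2 ≤ ε := by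
  classical
  obtain ⟨E, hE, h⟩ := Q.pi_sum
  have hs : Summable (fun q : P => 1 / (Q.N q : ℝ) ^ 2) := by
    refine summable_of_sum_le (c := E) (fun q => by positivity) fun T => (Finset.sum_le_sum fun q _ => ?_).trans (h T)
    gcongr
    have : q ∈ Q.Pr (Q.N q) := by simp
    exact_mod_cast Finset.card_pos.2 ⟨q, this⟩
  obtain ⟨s, hs⟩ := hs.vanishing (e := Set.Iio ε) (Iio_mem_nhds hε)
  refine ⟨(s.sup Q.N : ℕ), fun T hT => le_of_lt (hs T ?_)⟩
  rw [Finset.disjoint_left]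
  intro q hq hqs
  have h1 := hT q hq
  have : Q.N q ≤ s.sup Q.N := Finset.le_sup hqs
  have : (Q.N q : ℝ) ≤ (s.sup Q.N : ℕ) := by exact_mod_cast this
  linarith

lemma fiber_le (s : Finset P) (v : ℕ) (h : ∀ p ∈ s, Q.N p = v) : s.card ≤ Q.d := by
  refine le_trans ?_ (Q.hd v)
  rw [← Set.ncard_coe_finset]
  refine Set.ncard_le_ncard (fun p hp => h p hp) ?_
  refine (Q.finP v).subset fun p hp => ?_
  have : Q.N p = v := hp
  simp [this]

lemma Qs_le (S : Set P) (m : Multiset P) : Q.Qs S m ≤ Q.d := by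
  classical
  rw [Q.Qs_eq]
  refine Nat.cast_le.2 (Q.fiber_le _ (Q.mx m) fun p hp => ?_)
  simp only [Finset.mem_filter, Multiset.mem_toFinset] at hp
  exact le_antisymm (Q.le_mx hp.1.1) (Q.mx_le.2 hp.2)

lemma Qs_nonneg (S : Set P) (m : Multiset P) : 0 ≤ Q.Qs S m := by unfold Qs; positivity

lemma Qs_univ_ge (m : Multiset P) (hm : m ≠ 0) : 1 ≤ Q.Qs Set.univ m := by
  classical
  rw [Q.Qs_eq]
  obtain ⟨q, hq, h⟩ := Q.exists_mx hm
  refine Nat.one_le_cast.2 (Finset.card_pos.2 ⟨q, ?_⟩)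
  simp [hq, h]; exact fun p hp => Q.le_mx hp

/-- several primes of maximal norm -/
def bad (m : Multiset P) : Prop := ∃ p ∈ m, ∃ p' ∈ m, p ≠ p' ∧ Q.N p = Q.mx m ∧ Q.N p' = Q.mx m

lemma Qs_univ_le (m : Multiset P) (hm : ¬ Q.bad m) : Q.Qs Set.univ m ≤ 1 := by
  classical
  rw [Q.Qs_eq]
  refine Nat.cast_le_one.2 (Finset.card_le_one.2 ?_)
  intro a ha b hb
  simp only [Finset.mem_filter, Multiset.mem_toFinset] at ha hb
  by_contra hne
  exact hm ⟨a, ha.1.1, b, hb.1.1, hne, le_antisymm (Q.le_mx ha.1.1) (Q.mx_le.2 ha.2),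
    le_antisymm (Q.le_mx hb.1.1) (Q.mx_le.2 hb.2)⟩

open Classical in
lemma lo_bad : lo fun X => (((Q.I X).filter Q.bad).card : ℝ) := by
  intro ε hε
  have hB := Q.B_pos
  obtain ⟨Z, hZ⟩ := Q.tail_sq (ε / (2 * (Q.d + 1) * Q.B)) (by positivity)
  obtain ⟨C, hC, h⟩ := Q.lo_Sm (Q.Pr Z) (ε / 2) (by positivity)
  refine ⟨C, hC, fun X hX => ?_⟩
  set T := (Q.Pr X).filter (fun p => Z < Q.N p)
  have h1 : (Q.I X).filter Q.bad ⊆ (Q.I X).filter (fun m => ∀ p ∈ m, p ∈ Q.Pr Z) ∪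
      T.biUnion (fun p => ((Q.Pr X).filter (fun p' => Q.N p' = Q.N p)).biUnion
        (fun p' => (Q.I (X / (Q.N p : ℝ) ^ 2)).image (fun m => p ::ₘ p' ::ₘ m))) := by
    intro m hm
    simp only [Finset.mem_filter, mem_I] at hm
    obtain ⟨h1, p, hp, p', hp', hne, e1, e2⟩ := hm
    by_cases hh : ∀ p ∈ m, p ∈ Q.Pr Z
    · exact Finset.mem_union_left _ (by simp only [Finset.mem_filter, mem_I]; exact ⟨h1, hh⟩)
    · refine Finset.mem_union_right _ ?_
      push Not at hh
      obtain ⟨q, hq, hqZ⟩ := hh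
      simp only [mem_Pr, not_le] at hqZ
      have : (Q.N q : ℝ) ≤ Q.N p := by rw [e1]; exact_mod_cast Q.le_mx hq
      have hp'e : p' ∈ m.erase p := (Multiset.mem_erase_of_ne hne.symm).2 hp'
      have e : m = p ::ₘ p' ::ₘ (m.erase p).erase p' := by
        rw [Multiset.cons_erase hp'e, Multiset.cons_erase hp]
      have hn : Q.n m = Q.N p * (Q.N p * Q.n ((m.erase p).erase p')) := by
        conv_lhs => rw [e]
        rw [n_cons, n_cons, e2, e1]
      have hn1 := Q.n_ge' ((m.erase p).erase p')
      have hN := Q.N_ge' p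
      rw [hn] at h1
      push_cast at h1
      have hpX : (Q.N p : ℝ) ≤ X := by nlinarith [mul_nonneg (sub_nonneg.2 hn1) (Q.N_pos' p).le]
      simp only [T, Finset.mem_biUnion, Finset.mem_filter, mem_Pr, Finset.mem_image, mem_I]
      refine ⟨p, ⟨hpX, by linarith⟩, p', ⟨by rwa [e2, ← e1], by rw [e1, e2]⟩, _, ?_, e.symm⟩
      rw [le_div_iff₀ (by positivity)]; nlinarith
  have h2 : (((Q.I X).filter Q.bad).card : ℝ) ≤ Q.Sm (Q.Pr Z) X + ∑ p ∈ T, Q.d * Q.cnt (X / (Q.N p : ℝ) ^ 2) := by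
    refine (Nat.cast_le.2 ((Finset.card_le_card h1).trans (Finset.card_union_le _ _))).trans ?_
    push_cast
    unfold Sm
    gcongr
    refine (Nat.cast_le.2 Finset.card_biUnion_le).trans ?_
    push_cast
    gcongr with p hp
    refine (Nat.cast_le.2 (Finset.card_biUnion_le.trans (Finset.sum_le_sum fun p' _ => Finset.card_image_le))).trans ?_
    rw [Finset.sum_const, smul_eq_mul]
    push_cast
    unfold cnt
    gcongr
    exact Q.fiber_le _ (Q.N p) fun p' hp' => (Finset.mem_filter.1 hp').2
  have h3 : ∑ p ∈ T, Q.d * Q.cnt (X / (Q.N p : ℝ) ^ 2) ≤ ε / 2 * X := by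
    calc _ ≤ ∑ p ∈ T, (Q.d + 1) * Q.B * X * (1 / (Q.N p : ℝ) ^ 2) := by
          refine Finset.sum_le_sum fun p _ => ?_
          have := Q.cnt_le (X / (Q.N p : ℝ) ^ 2) (by positivity)
          have h0 := Q.cnt_nonneg (X / (Q.N p : ℝ) ^ 2)
          calc _ ≤ (Q.d + 1) * (Q.B * (X / (Q.N p : ℝ) ^ 2)) := by
                gcongr; linarith
            _ = _ := by ring
      _ = (Q.d + 1) * Q.B * X * ∑ p ∈ T, (1 / (Q.N p : ℝ) ^ 2) := by rw [Finset.mul_sum]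
      _ ≤ (Q.d + 1) * Q.B * X * (ε / (2 * (Q.d + 1) * Q.B)) := by
          gcongr
          exact hZ T fun q hq => (Finset.mem_filter.1 hq).2
      _ = _ := by field_simp
  have h4 := (abs_le.1 (h X hX)).2
  rw [abs_of_nonneg (by positivity)]
  linarith

lemma lo_Qs_univ : lo fun X => ∑ m ∈ Q.I X, Q.Qs Set.univ m - Q.c * X := by
  classical
  have l : lo fun X => (∑ m ∈ Q.I X, Q.Qs Set.univ m - Q.cnt X) + (Q.cnt X - Q.c * X) := by
    refine lo.add ?_ Q.lo_cnt
    refine ((lo_const 1).add (Q.lo_bad.const_mul Q.d)).mono fun X hX => ?_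
    have e : ∑ m ∈ Q.I X, Q.Qs Set.univ m - Q.cnt X = ∑ m ∈ Q.I X, (Q.Qs Set.univ m - 1) := by
      rw [Finset.sum_sub_distrib]; simp [cnt]
    rw [e, abs_of_nonneg (a := (1:ℝ) + _) (by positivity), abs_le]
    have hb : (0:ℝ) ≤ Q.d * ((Q.I X).filter Q.bad).card := by positivity
    constructor
    · have : ∑ m ∈ Q.I X, (if m = 0 then (-1:ℝ) else 0) ≤ ∑ m ∈ Q.I X, (Q.Qs Set.univ m - 1) := by
        refine Finset.sum_le_sum fun m _ => ?_
        split_ifs with h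
        · linarith [Q.Qs_nonneg Set.univ m]
        · linarith [Q.Qs_univ_ge m h]
      rw [Finset.sum_ite_eq'] at this
      split_ifs at this <;> linarith
    · have : ∑ m ∈ Q.I X, (Q.Qs Set.univ m - 1) ≤ ∑ m ∈ Q.I X, (if Q.bad m then (Q.d:ℝ) else 0) := by
        refine Finset.sum_le_sum fun m _ => ?_
        split_ifs with h
        · linarith [Q.Qs_le Set.univ m]
        · linarith [Q.Qs_univ_le m h]
      rw [← Finset.sum_filter, Finset.sum_const, nsmul_eq_mul] at this
      linarith
  exact l.congr fun X _ => by ring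

set_option maxHeartbeats 1000000 in
lemma G_pi : ∃ E : ℝ, 0 ≤ E ∧ ∀ X : ℝ, 0 ≤ X → ∑ m ∈ Q.G X, Q.piS Set.univ (X / Q.n m) ≤ E * X := by
  classical
  obtain ⟨E, hE, h⟩ := Q.pi_sum
  have hB := Q.B_pos
  refine ⟨Q.d * Q.B + Q.B * E, by positivity, fun X hX => ?_⟩
  have h1 : ∑ m ∈ Q.G X, (Q.piS Set.univ (X / Q.n m) - Q.piS Set.univ (Q.mx m - 1)) ≤ Q.d * Q.B * X := by
    rw [← Q.Qs_sum]
    calc _ ≤ ∑ m ∈ Q.I X, (Q.d : ℝ) := Finset.sum_le_sum fun m _ => Q.Qs_le _ m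
      _ = Q.d * Q.cnt X := by simp [cnt, mul_comm]
      _ ≤ Q.d * (Q.B * X) := by gcongr; exact Q.cnt_le X hX
      _ = _ := by ring
  have h2 : ∑ m ∈ Q.G X, Q.piS Set.univ (Q.mx m - 1) ≤ Q.B * E * X := by
    have hpi0 : ∀ y, 0 ≤ Q.piS Set.univ y := fun y => by unfold piS; positivity
    have hpim : ∀ v : ℕ, Q.piS Set.univ ((v:ℝ) - 1) ≤ (Q.Pr v).card := fun v => by
      rw [piS_univ]
      exact_mod_cast Finset.card_le_card fun p hp => by simp at hp ⊢; exact_mod_cast (by linarith : (Q.N p : ℝ) ≤ v)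
    calc _ ≤ ∑ m ∈ (Q.G X).filter (· ≠ 0), ((Q.Pr (Q.mx m)).card : ℝ) := by
          rw [Finset.sum_filter]
          refine Finset.sum_le_sum fun m _ => ?_
          split_ifs with hm
          · exact hpim _
          · push Not at hm
            subst hm
            rw [piS_univ]
            have : Q.Pr ((Q.mx 0 : ℕ) - 1) = ∅ := by
              ext p
              have := Q.N_pos' p
              simp [mx]; linarith
            rw [this]; simp
      _ ≤ ∑ q ∈ Q.Pr X, ∑ m ∈ Q.I (X / (Q.N q : ℝ) ^ 2), ((Q.Pr (Q.N q)).card : ℝ) := by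
          have hex : ∀ m ∈ (Q.G X).filter (· ≠ 0), ∃ q ∈ m, Q.N q = Q.mx m := fun m hm =>
            Q.exists_mx (Finset.mem_filter.1 hm).2
          rcases ((Q.G X).filter (· ≠ 0)).eq_empty_or_nonempty with h0 | ⟨m0, hm0⟩
          · rw [h0, Finset.sum_empty]
            exact Finset.sum_nonneg fun q _ => Finset.sum_nonneg fun m _ => Nat.cast_nonneg _
          have : Nonempty P := ⟨(hex m0 hm0).choose⟩
          choose! g hg1 hg2 using hex
          rw [Finset.sum_sigma']
          have hinj : Set.InjOn (fun m => (⟨g m, m.erase (g m)⟩ : (_ : P) × Multiset P)) ((Q.G X).filter (· ≠ 0)) := by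
            intro a ha b hb hab
            simp only [Sigma.mk.injEq, heq_eq_eq] at hab
            rw [← Multiset.cons_erase (hg1 a ha), ← Multiset.cons_erase (hg1 b hb), hab.1]
            rw [hab.1] at hab
            rw [hab.2]
          calc _ = ∑ m ∈ (Q.G X).filter (· ≠ 0), ((Q.Pr (Q.N (g m))).card : ℝ) :=
                Finset.sum_congr rfl fun m hm => by rw [hg2 m hm]
            _ = ∑ x ∈ ((Q.G X).filter (· ≠ 0)).image (fun m => (⟨g m, m.erase (g m)⟩ : (_ : P) × Multiset P)),
                  ((Q.Pr (Q.N x.1)).card : ℝ) := by rw [Finset.sum_image hinj]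
            _ ≤ _ := by
                refine Finset.sum_le_sum_of_subset_of_nonneg ?_ fun _ _ _ => by positivity
                intro x hx
                obtain ⟨m, hm, rfl⟩ := Finset.mem_image.1 hx
                have a1 := hg1 m hm
                have a2 := hg2 m hm
                simp only [G, Finset.mem_filter, mem_I] at hm
                have e := Q.n_cons (g m) (m.erase (g m))
                rw [Multiset.cons_erase a1] at e
                have hG := hm.1.2
                rw [← a2, e] at hG
                push_cast at hG
                have hn1 := Q.n_ge' (m.erase (g m))
                have hN := Q.N_ge' (g m)
                have hI := hm.1.1
                rw [e] at hI
                push_cast at hI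
                simp only [Finset.mem_sigma, mem_Pr, mem_I]
                refine ⟨by nlinarith, ?_⟩
                rw [le_div_iff₀ (by positivity)]; nlinarith
      _ = ∑ q ∈ Q.Pr X, Q.cnt (X / (Q.N q : ℝ) ^ 2) * ((Q.Pr (Q.N q)).card : ℝ) := by simp [cnt]
      _ ≤ ∑ q ∈ Q.Pr X, Q.B * X * (((Q.Pr (Q.N q)).card : ℝ) / (Q.N q : ℝ) ^ 2) := by
          refine Finset.sum_le_sum fun q _ => ?_
          calc _ ≤ (Q.B * (X / (Q.N q : ℝ) ^ 2)) * ((Q.Pr (Q.N q)).card : ℝ) := by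
                gcongr; exact Q.cnt_le _ (by positivity)
            _ = _ := by ring
      _ = Q.B * X * ∑ q ∈ Q.Pr X, (((Q.Pr (Q.N q)).card : ℝ) / (Q.N q : ℝ) ^ 2) := by rw [Finset.mul_sum]
      _ ≤ Q.B * X * E := by gcongr; exact h _
      _ = _ := by ring
  rw [Finset.sum_sub_distrib] at h1
  linarith

lemma lo_Qs (S : Set P) (δ : ℝ)
    (hS : ∀ ε > 0, ∃ C, 0 ≤ C ∧ ∀ y : ℝ, |Q.piS S y - δ * Q.piS Set.univ y| ≤ ε * Q.piS Set.univ y + C) :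
    lo fun X => ∑ m ∈ Q.I X, Q.Qs S m - δ * Q.c * X := by
  have l : lo fun X => (∑ m ∈ Q.I X, Q.Qs S m - δ * ∑ m ∈ Q.I X, Q.Qs Set.univ m)
      + δ * (∑ m ∈ Q.I X, Q.Qs Set.univ m - Q.c * X) := by
    refine lo.add ?_ (Q.lo_Qs_univ.const_mul δ)
    intro ε hε
    obtain ⟨E, hE, hG⟩ := Q.G_pi
    obtain ⟨C, hC, h⟩ := hS (ε / (4 * (E + 1))) (by positivity)
    obtain ⟨C', hC', h'⟩ := (Q.lo_G.const_mul (2 * C)) (ε / 2) (by positivity)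
    refine ⟨C', hC', fun X hX => ?_⟩
    have h1 := (abs_le.1 (h' X hX)).2
    have h2 := hG X hX
    set e := ε / (4 * (E + 1)) with he
    have he0 : 0 < e := by positivity
    have h3 : |∑ m ∈ Q.I X, Q.Qs S m - δ * ∑ m ∈ Q.I X, Q.Qs Set.univ m| ≤
        ∑ m ∈ Q.G X, (2 * e * Q.piS Set.univ (X / Q.n m) + 2 * C) := by
      rw [Q.Qs_sum, Q.Qs_sum, Finset.mul_sum, ← Finset.sum_sub_distrib]
      refine (Finset.abs_sum_le_sum_abs _ _).trans (Finset.sum_le_sum fun m hm => ?_)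
      have a1 := abs_le.1 (h (X / Q.n m))
      have a2 := abs_le.1 (h (Q.mx m - 1))
      have a3 : Q.piS Set.univ (Q.mx m - 1) ≤ Q.piS Set.univ (X / Q.n m) := by
        have hn := Q.n_pos' m
        have h2 : (Q.mx m : ℝ) ≤ X / Q.n m := by
          rw [le_div_iff₀ hn]; exact (Finset.mem_filter.1 hm).2
        rw [piS_univ, piS_univ]
        refine Nat.cast_le.2 (Finset.card_le_card fun p hp => ?_)
        simp only [mem_Pr] at hp ⊢; linarith
      have a4 : e * Q.piS Set.univ (Q.mx m - 1) ≤ e * Q.piS Set.univ (X / Q.n m) := by gcongr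
      rw [abs_le]
      constructor <;> linarith
    rw [Finset.sum_add_distrib, ← Finset.mul_sum] at h3
    simp only [Finset.sum_const, nsmul_eq_mul] at h3
    have h4 : 2 * e * ∑ m ∈ Q.G X, Q.piS Set.univ (X / Q.n m) ≤ 2 * e * (E * X) := by gcongr
    have h5 : 2 * e * (E * X) ≤ ε / 2 * X := by
      have : 2 * e * (E + 1) = ε / 2 := by rw [he]; field_simp; ring
      rw [← this]
      have : 0 ≤ e * X := by positivity
      nlinarith
    linarith
  exact l.congr fun X _ => by ring

open Classical in
/-- abstract main theorem -/
theorem main (S : Set P) (δ : ℝ)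
    (hS : ∀ ε > 0, ∃ C, 0 ≤ C ∧ ∀ y : ℝ, |Q.piS S y - δ * Q.piS Set.univ y| ≤ ε * Q.piS Set.univ y + C) :
    Tendsto (fun X => ∑ u ∈ (Q.F X).filter (Q.D S), (-1 : ℝ) ^ u.card / Q.n u.val) atTop (𝓝 (-δ)) := by
  have hc := Q.hc
  have l1 := Q.axer (fun u => if Q.D S u then (-1 : ℝ) ^ u.card else 0) (fun u => by split_ifs <;> simp)
    ((Q.lo_MS S).congr fun y _ => by rw [MS, Finset.sum_filter])
  have l2 := (l1.add (Q.lo_Qs S δ hS)).tendsto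
  have l3 : Tendsto (fun X => -(1 / Q.c) * ((∑ u ∈ Q.F X, (if Q.D S u then (-1 : ℝ) ^ u.card else 0) *
      (Q.cnt (X / Q.n u.val) - Q.c * (X / Q.n u.val)) + (∑ m ∈ Q.I X, Q.Qs S m - δ * Q.c * X)) / X) - δ)
      atTop (𝓝 (-δ)) := by
    have := (l2.const_mul (-(1 / Q.c))).sub_const δ
    simpa using this
  refine l3.congr' ?_
  filter_upwards [eventually_gt_atTop 0] with X hX
  have d := Q.duality S X
  have e : ∑ u ∈ Q.F X, (if Q.D S u then (-1 : ℝ) ^ u.card else 0) *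
      (Q.cnt (X / Q.n u.val) - Q.c * (X / Q.n u.val)) = - ∑ m ∈ Q.I X, Q.Qs S m
      - Q.c * X * ∑ u ∈ (Q.F X).filter (Q.D S), (-1 : ℝ) ^ u.card / Q.n u.val := by
    rw [← d, Finset.mul_sum, ← Finset.sum_sub_distrib, Finset.sum_filter]
    refine Finset.sum_congr rfl fun u _ => ?_
    split_ifs
    · ring
    · simp
  rw [e]
  field_simp
  ring

end Sys
end Beu
end PartA7

section PartB1
namespace GeoNum
open NumberField NumberField.InfinitePlace NumberField.mixedEmbedding NumberField.mixedEmbedding.fundamentalCone NumberField.Units NumberField.Units.dirichletUnitTheorem MeasureTheory ENNReal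
open scoped Classical

variable (K : Type*) [Field K] [NumberField K]

/-- Thickened parameter box. -/
noncomputable def pbox (h : ℝ) : Set (realSpace K) :=
  Set.univ.pi fun w ↦ if w = w₀ then Set.Iic h else Set.Ico (-h) (1 + h)

lemma measurableSet_pbox (h : ℝ) : MeasurableSet (pbox K h) := by
  refine MeasurableSet.univ_pi fun _ ↦ ?_
  split_ifs
  · exact measurableSet_Iic
  · exact measurableSet_Ico

lemma mem_pbox {h : ℝ} {x : realSpace K} :
    x ∈ pbox K h ↔ x w₀ ≤ h ∧ ∀ w, w ≠ w₀ → -h ≤ x w ∧ x w < 1 + h := by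
  simp only [pbox, Set.mem_univ_pi]
  constructor
  · intro H
    refine ⟨by simpa using H w₀, fun w hw => by simpa [hw] using H w⟩
  · rintro ⟨h1, h2⟩ w
    split_ifs with hw
    · subst hw; exact h1
    · exact h2 w hw

lemma lint_pbox (h : ℝ) {n : ℕ} (hn : 0 < n) :
    ∫⁻ (x : realSpace K) in pbox K h, .ofReal (Real.exp (x w₀ * n)) =
      (ENNReal.ofReal (Real.exp (n * h)) * ENNReal.ofReal (1 + 2 * h) ^
        (Finset.univ.erase (w₀ : InfinitePlace K)).card) * (n : ℝ≥0∞)⁻¹ := by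
  have hn : 0 < (n : ℝ) := Nat.cast_pos.mpr hn
  rw [volume_pi, pbox, Measure.restrict_pi_pi, lintegral_eq_lmarginal_univ 0,
    lmarginal_erase' _ (by fun_prop) (Finset.mem_univ w₀), if_pos rfl]
  simp_rw [Function.update_self, lmarginal, lintegral_const, Measure.pi_univ, if_neg
    (Finset.ne_of_mem_erase (Subtype.prop _)), Measure.restrict_apply_univ, Real.volume_Ico,
    Finset.prod_const, Finset.card_univ, Fintype.card_coe, mul_comm _ (n : ℝ)]
  rw [← ofReal_integral_eq_lintegral_ofReal (integrableOn_exp_mul_Iic hn _), integral_exp_mul_Iic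
    hn, ofReal_div_of_pos hn, ofReal_natCast, ENNReal.div_eq_inv_mul]
  · rw [show 1 + h - -h = 1 + 2 * h by ring]
    ring
  · filter_upwards with _ using Real.exp_nonneg _

/-- region -/
noncomputable def G (h : ℝ) : Set (mixedSpace K) := normAtAllPlaces ⁻¹' (expMapBasis '' (pbox K h))

lemma G_zero : G K 0 = normLeOne K := by
  rw [normLeOne_eq_preimage, G, pbox]
  simp

lemma measurableSet_G (h : ℝ) : MeasurableSet (G K h) := by
  refine MeasurableSet.preimage ?_ (continuous_normAtAllPlaces K).measurable
  exact MeasurableSet.image_of_continuousOn_injOn (measurableSet_pbox K h)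
    (continuous_expMapBasis K).continuousOn (injective_expMapBasis K).injOn

lemma volume_G : ∃ V : ℝ≥0∞, V ≠ ⊤ ∧ ∀ h, volume (G K h) =
    V * (ENNReal.ofReal (Real.exp (Module.finrank ℚ K * h)) * ENNReal.ofReal (1 + 2 * h) ^
        (Finset.univ.erase (w₀ : InfinitePlace K)).card) := by
  refine ⟨2 ^ nrRealPlaces K * .ofReal (2 * Real.pi) ^ nrComplexPlaces K *
    ((2 : ℝ≥0∞)⁻¹ ^ nrComplexPlaces K * ENNReal.ofReal (regulator K) * (Module.finrank ℚ K) * (Module.finrank ℚ K : ℝ≥0∞)⁻¹), ?_, ?_⟩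
  · have : (Module.finrank ℚ K : ℝ≥0∞)⁻¹ ≠ ⊤ := by
      simp [Module.finrank_pos.ne']
    refine ENNReal.mul_ne_top (ENNReal.mul_ne_top (by simp) (ENNReal.pow_ne_top ENNReal.ofReal_ne_top))
      (ENNReal.mul_ne_top (ENNReal.mul_ne_top (ENNReal.mul_ne_top (ENNReal.pow_ne_top (by simp)) (by simp)) (by simp)) this)
  intro h
  rw [volume_eq_two_pow_mul_two_pi_pow_mul_integral (A := G K h)
    (by rw [G]; exact Set.preimage_image_preimage) (measurableSet_G K h), G,
    normAtAllPlaces_image_preimage_expMapBasis,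
    setLIntegral_expMapBasis_image (measurableSet_pbox K h) (by fun_prop)]
  simp_rw [ENNReal.inv_mul_cancel_right
    (Finset.prod_ne_zero_iff.mpr fun _ _ ↦ ofReal_ne_zero_iff.mpr (expMapBasis_pos _ _))
    (prod_ne_top fun _ _ ↦ ofReal_ne_top)]
  rw [lint_pbox K h Module.finrank_pos]
  ring

lemma volume_G_diff : ∃ C : ℝ, 0 ≤ C ∧ ∀ h, 0 ≤ h → h ≤ 1/4 →
    volume (G K h \ G K (-h)) ≤ ENNReal.ofReal (C * h) := by
  obtain ⟨V, hV, hG⟩ := volume_G K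
  set r := (Finset.univ.erase (w₀ : InfinitePlace K)).card
  set g : ℝ → ℝ := fun h => Real.exp (Module.finrank ℚ K * h) * (1 + 2 * h) ^ r with hg
  have hgs : ContDiff ℝ 1 g := by fun_prop
  have hlip : ∃ L : NNReal, LipschitzOnWith L g (Set.Icc (-(1/4)) (1/4)) := 
    hgs.contDiffOn.exists_lipschitzOnWith (by norm_num) (convex_Icc _ _) isCompact_Icc
  obtain ⟨L, hL⟩ := hlip
  refine ⟨V.toReal * (L * 2), by positivity, fun h h0 h1 => ?_⟩
  have hGg : ∀ t, -(1/4) ≤ t → volume (G K t) = ENNReal.ofReal (V.toReal * g t) := by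
    intro t ht
    rw [hG, ENNReal.ofReal_mul (by positivity), ENNReal.ofReal_toReal hV, hg,
      ENNReal.ofReal_mul (by positivity), ENNReal.ofReal_pow (by linarith)]
  have hsub : G K (-h) ⊆ G K h := by
    refine Set.preimage_mono (Set.image_mono ?_)
    intro x hx
    rw [mem_pbox] at hx ⊢
    exact ⟨by linarith [hx.1], fun w hw => ⟨by linarith [(hx.2 w hw).1], by linarith [(hx.2 w hw).2]⟩⟩
  have hgp : 0 ≤ g (-h) := by
    have : 0 ≤ 1 + 2 * -h := by linarith
    simp only [hg]; positivity
  rw [measure_sdiff hsub (measurableSet_G K _).nullMeasurableSet (by rw [hGg _ (by linarith)]; exact ENNReal.ofReal_ne_top),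
    hGg _ (by linarith), hGg _ (by linarith), ← ENNReal.ofReal_sub _ (by positivity)]
  refine ENNReal.ofReal_le_ofReal ?_
  have := hL.dist_le_mul h ⟨by linarith, h1⟩ (-h) ⟨by linarith, by linarith⟩
  rw [Real.dist_eq, Real.dist_eq, show h - -h = 2 * h by ring, abs_of_nonneg (by linarith : 0 ≤ 2 * h)] at this
  have h3 := (le_abs_self _).trans this
  have : 0 ≤ V.toReal := by positivity
  nlinarith

end GeoNum
end PartB1

section PartB2
namespace GeoNum
open NumberField NumberField.InfinitePlace NumberField.mixedEmbedding NumberField.mixedEmbedding.fundamentalCone NumberField.Units NumberField.Units.dirichletUnitTheorem MeasureTheory ENNReal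
open scoped Classical

/-- neighbourhood of the boundary -/
def Bd {E : Type*} [NormedAddCommGroup E] (D : Set E) (ε : ℝ) : Set E :=
  {y | ∃ x, ‖x - y‖ ≤ ε ∧ ¬ (x ∈ D ↔ y ∈ D)}

variable (K : Type*) [Field K] [NumberField K]

lemma normAtPlace_le_norm (w : InfinitePlace K) (x : mixedSpace K) : normAtPlace w x ≤ ‖x‖ := by
  rw [norm_eq_sup'_normAtPlace]
  exact Finset.le_sup' (fun w => normAtPlace w x) (Finset.mem_univ w)

lemma mem_cbody (f : InfinitePlace K → NNReal) (y : mixedSpace K) (h : ∀ w, normAtPlace w y < f w) :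
    y ∈ convexBodyLT K f := by
  refine ⟨fun w _ => ?_, fun w _ => ?_⟩
  · rw [mem_ball_zero_iff, ← normAtPlace_apply_of_isReal w.2 y]; exact h w
  · rw [mem_ball_zero_iff, ← normAtPlace_apply_of_isComplex w.2 y]; exact h w

lemma vol_cbody (w : InfinitePlace K) (R s : NNReal) (hR : 1 ≤ R) (hs : s ≤ 1) :
    volume (convexBodyLT K (fun w' => if w' = w then s else R)) ≤
      (convexBodyLTFactor K : ℝ≥0∞) * (((R ^ 2) ^ (Finset.univ.erase w).card * s : NNReal) : ℝ≥0∞) := by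
  rw [convexBodyLT_volume]
  gcongr
  rw [← Finset.mul_prod_erase _ _ (Finset.mem_univ w), mul_comm]
  refine mul_le_mul' ?_ ?_
  · refine Finset.prod_le_pow_card _ _ _ fun v hv => ?_
    rw [if_neg (Finset.ne_of_mem_erase hv)]
    refine pow_le_pow_right₀ hR ?_
    rw [mult]; split_ifs <;> norm_num
  · rw [if_pos rfl]
    exact pow_le_of_le_one zero_le hs mult_pos.ne'

/-- log coordinates -/
noncomputable def phi (x : mixedSpace K) : realSpace K :=
  (completeBasis K).equivFunL (expMap.symm (normAtAllPlaces x))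

lemma mem_G_iff (h : ℝ) (x : mixedSpace K) (hx : ∀ w, 0 < normAtPlace w x) :
    x ∈ G K h ↔ phi K x ∈ pbox K h := by
  have h1 : expMapBasis (phi K x) = normAtAllPlaces x := by
    rw [expMapBasis_apply, phi]
    have : (completeBasis K).equivFun.symm ((completeBasis K).equivFunL (expMap.symm (normAtAllPlaces x)))
        = expMap.symm (normAtAllPlaces x) := (completeBasis K).equivFun.symm_apply_apply _
    rw [this]
    apply expMap.right_inv
    rw [expMap_target]
    exact fun w _ => hx w
  rw [G, Set.mem_preimage, ← h1, (injective_expMapBasis K).mem_set_image]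

lemma phi_lip : ∃ C : ℝ, 0 < C ∧ ∀ (x y : mixedSpace K) (η : ℝ), 0 ≤ η →
    (∀ w, |Real.log (normAtPlace w x) - Real.log (normAtPlace w y)| ≤ η) →
    ∀ w, |phi K x w - phi K y w| ≤ C * η := by
  refine ⟨‖((completeBasis K).equivFunL : realSpace K →L[ℝ] realSpace K)‖ * 2 + 1, by positivity, ?_⟩
  intro x y η hη H w
  have h1 : phi K x - phi K y = ((completeBasis K).equivFunL : realSpace K →L[ℝ] realSpace K)
      (expMap.symm (normAtAllPlaces x) - expMap.symm (normAtAllPlaces y)) := by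
    simp [phi]
  have h2 : ‖expMap.symm (normAtAllPlaces x) - expMap.symm (normAtAllPlaces y)‖ ≤ 2 * η := by
    rw [pi_norm_le_iff_of_nonneg (by positivity)]
    intro v
    rw [Pi.sub_apply, expMap_symm_apply, expMap_symm_apply, ← mul_sub, norm_mul]
    refine mul_le_mul ?_ (by simpa [normAtAllPlaces_apply] using H v) (by positivity) (by norm_num)
    rw [mult]; split_ifs <;> norm_num
  have h3 := (norm_le_pi_norm (phi K x - phi K y) w).trans
    ((h1 ▸ ContinuousLinearMap.le_opNorm _ _).trans (mul_le_mul_of_nonneg_left h2 (norm_nonneg _)))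
  rw [Pi.sub_apply, Real.norm_eq_abs] at h3
  nlinarith

lemma log_diff {a b e s : ℝ} (hs : 0 < s) (ha : s ≤ a) (hb : s ≤ b) (hab : |a - b| ≤ e) :
    |Real.log a - Real.log b| ≤ e / s := by
  have key : ∀ a b : ℝ, s ≤ a → s ≤ b → |a - b| ≤ e → Real.log a - Real.log b ≤ e / s := by
    intro a b ha hb hab
    rw [← Real.log_div (by linarith) (by linarith)]
    have h1 := Real.log_le_sub_one_of_pos (show 0 < a / b from div_pos (by linarith) (by linarith))
    have h2 : a / b - 1 = (a - b) / b := by field_simp [show b ≠ 0 by linarith]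
    have h0 : 0 ≤ e := (abs_nonneg _).trans hab
    calc _ ≤ (a - b) / b := by linarith
      _ ≤ e / b := by gcongr; linarith; exact (le_abs_self _).trans hab
      _ ≤ e / s := by gcongr
  rw [abs_le]
  constructor
  · have := key b a hb ha (by rwa [abs_sub_comm]); linarith
  · exact key a b ha hb hab

lemma vol_Bd : ∃ C : ℝ, 0 ≤ C ∧ ∃ ε₀ : ℝ, 0 < ε₀ ∧ ∀ ε, 0 < ε → ε ≤ ε₀ →
    volume (Bd (normLeOne K) ε) ≤ ENNReal.ofReal (C * √ε) := by
  obtain ⟨CG, hCG, hG⟩ := volume_G_diff K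
  obtain ⟨Cp, hCp, hphi⟩ := phi_lip K
  obtain ⟨R, hR⟩ := Bornology.IsBounded.exists_norm_le (isBounded_normLeOne K)
  set R' : NNReal := Real.toNNReal (max R 0 + 2) with hR'
  have hR'c : (R' : ℝ) = max R 0 + 2 := Real.coe_toNNReal _ (by positivity)
  set M : ℝ := ∑ w : InfinitePlace K, (convexBodyLTFactor K : ℝ) * (((R':ℝ) ^ 2) ^ (Finset.univ.erase w).card * 3) with hM
  have hM0 : 0 ≤ M := by positivity
  refine ⟨M + CG * Cp, by positivity, min (1/9) ((1 / (4 * Cp)) ^ 2), by positivity, fun ε he he0 => ?_⟩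
  have hsq : 0 < √ε := Real.sqrt_pos.2 he
  have hs3 : √ε ≤ 1/3 := by
    rw [Real.sqrt_le_left (by norm_num)]; exact (he0.trans (min_le_left _ _)).trans (by norm_num)
  have hsC : √ε ≤ 1 / (4 * Cp) := by
    rw [Real.sqrt_le_left (by positivity)]; exact (he0.trans (min_le_right _ _))
  have hss : √ε * √ε = ε := Real.mul_self_sqrt he.le
  set s : NNReal := Real.toNNReal (3 * √ε) with hs
  have hsc : (s : ℝ) = 3 * √ε := Real.coe_toNNReal _ (by positivity)
  have hincl : Bd (normLeOne K) ε ⊆ (⋃ w : InfinitePlace K, convexBodyLT K (fun w' => if w' = w then s else R')) ∪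
      (G K (Cp * √ε) \ G K (-(Cp * √ε))) := by
    rintro y ⟨x, hxy, hne⟩
    have hyR : ‖y‖ < R' := by
      rw [hR'c]
      by_cases hy : y ∈ normLeOne K
      · have := hR y hy
        have := le_max_left R 0
        linarith
      · have hx : x ∈ normLeOne K := by tauto
        have h1 := hR x hx
        have h2 := le_max_left R 0
        have h3 : ‖y‖ ≤ ‖x‖ + ‖x - y‖ := by
          have := norm_sub_le x (x - y); simpa using this
        nlinarith
    by_cases hsm : ∃ w, normAtPlace w y < s
    · obtain ⟨w, hw⟩ := hsm
      left
      rw [Set.mem_iUnion]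
      refine ⟨w, mem_cbody K _ _ fun v => ?_⟩
      split_ifs with hv
      · rwa [hv]
      · exact (normAtPlace_le_norm K v y).trans_lt hyR
    · push Not at hsm
      right
      rw [hsc] at hsm
      have hd : ∀ w, |normAtPlace w x - normAtPlace w y| ≤ ε := by
        intro w
        have h1 := normAtPlace_le_norm K w (x - y)
        have h2 := normAtPlace_add_le w (x - y) y
        have h3 := normAtPlace_add_le w (-(x - y)) x
        rw [normAtPlace_neg] at h3
        rw [show x - y + y = x by abel] at h2
        rw [show -(x - y) + x = y by abel] at h3
        rw [abs_le]; constructor <;> linarith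
      have hxw : ∀ w, √ε ≤ normAtPlace w x := by
        intro w
        have h1 := (abs_le.1 (hd w)).1
        have h2 := hsm w
        nlinarith
      have hyw : ∀ w, √ε ≤ normAtPlace w y := by
        intro w
        have h2 := hsm w
        linarith
      have hlog := fun w => log_diff hsq (hxw w) (hyw w) (hd w)
      have hes : ε / √ε = √ε := by rw [div_eq_iff hsq.ne', hss]
      rw [hes] at hlog
      have hp := hphi x y _ hsq.le hlog
      have hx0 : ∀ w, 0 < normAtPlace w x := fun w => hsq.trans_le (hxw w)
      have hy0 : ∀ w, 0 < normAtPlace w y := fun w => hsq.trans_le (hyw w)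
      rw [← G_zero, mem_G_iff K 0 x hx0, mem_G_iff K 0 y hy0] at hne
      rw [Set.mem_sdiff, mem_G_iff K _ y hy0, mem_G_iff K _ y hy0]
      set h := Cp * √ε
      have hh : 0 < h := by positivity
      have mono : ∀ a b : ℝ, ∀ u v : realSpace K, (∀ w, |u w - v w| ≤ b) → u ∈ pbox K a → v ∈ pbox K (a + b) := by
        intro a b u v huv hu
        rw [mem_pbox] at hu ⊢
        refine ⟨by linarith [hu.1, (abs_le.1 (huv w₀)).1], fun w hw => ⟨?_, ?_⟩⟩
        · linarith [(hu.2 w hw).1, (abs_le.1 (huv w)).2]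
        · linarith [(hu.2 w hw).2, (abs_le.1 (huv w)).1]
      have hp' : ∀ w, |phi K y w - phi K x w| ≤ h := fun w => by rw [abs_sub_comm]; exact hp w
      have hself : ∀ w, |phi K y w - phi K y w| ≤ h := fun w => by simp [hh.le]
      constructor
      · by_cases hx : phi K x ∈ pbox K 0
        · simpa using mono 0 h _ _ hp hx
        · simpa using mono 0 h _ _ hself (by tauto)
      · intro hy
        have h1 := mono _ _ _ _ hp' hy
        have h2 := mono _ _ _ _ hself hy
        rw [neg_add_cancel] at h1 h2
        tauto
  refine (measure_mono hincl).trans ((measure_union_le _ _).trans ?_)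
  rw [add_mul, ENNReal.ofReal_add (by positivity) (by positivity)]
  refine add_le_add ?_ ?_
  · refine (measure_iUnion_le _).trans ?_
    rw [tsum_fintype]
    refine (Finset.sum_le_sum fun w _ => vol_cbody K w R' s ?_ ?_).trans ?_
    · rw [← NNReal.coe_le_coe, hR'c]; have := le_max_right R 0; push_cast; linarith
    · rw [← NNReal.coe_le_coe, hsc]; push_cast; linarith
    · rw [← ENNReal.ofReal_coe_nnreal (p := convexBodyLTFactor K)]
      simp_rw [← ENNReal.ofReal_coe_nnreal (p := (R' ^ 2) ^ _ * s)]
      rw [hM, Finset.sum_mul, ENNReal.ofReal_sum_of_nonneg (fun _ _ => by positivity)]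
      refine Finset.sum_le_sum fun w _ => ?_
      rw [← ENNReal.ofReal_mul (by positivity)]
      refine ENNReal.ofReal_le_ofReal (le_of_eq ?_)
      push_cast
      rw [hsc]; ring
  · rw [mul_assoc]
    refine hG _ (by positivity) ?_
    rw [le_div_iff₀ (by positivity)] at hsC
    linarith
end GeoNum
end PartB2

section PartB3
namespace GeoNum
open MeasureTheory ENNReal
open scoped Classical Pointwise

variable {E : Type*} [NormedAddCommGroup E] [NormedSpace ℝ E] [MeasurableSpace E] [BorelSpace E]
  [FiniteDimensional ℝ E] (μ : Measure E) [μ.IsAddHaarMeasure]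
  {ι : Type*} [Fintype ι] (b : Module.Basis ι ℝ E)

lemma lattice_count (A : Set E) (hb : Bornology.IsBounded A) :
    ((Set.ncard (A ∩ (Submodule.span ℤ (Set.range b) : Set E)) : ℕ) : ℝ≥0∞) * μ (ZSpan.fundamentalDomain b)
        ≤ μ A + μ (Bd A (∑ i, ‖b i‖)) ∧
    μ A ≤ ((Set.ncard (A ∩ (Submodule.span ℤ (Set.range b) : Set E)) : ℕ) : ℝ≥0∞) * μ (ZSpan.fundamentalDomain b)
      + μ (Bd A (∑ i, ‖b i‖)) := by
  set ρ := ∑ i, ‖b i‖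
  set F := ZSpan.fundamentalDomain b
  have hfin : (A ∩ (Submodule.span ℤ (Set.range b) : Set E)).Finite := ZSpan.setFinite_inter b hb
  have hFm : MeasurableSet F := ZSpan.fundamentalDomain_measurableSet b
  have hU : μ (⋃ l ∈ hfin.toFinset, (l +ᵥ F)) = ((Set.ncard (A ∩ (Submodule.span ℤ (Set.range b) : Set E)) : ℕ) : ℝ≥0∞) * μ F := by
    rw [measure_biUnion_finset]
    · simp only [measure_vadd, Finset.sum_const, nsmul_eq_mul]
      rw [Set.ncard_eq_toFinset_card _ hfin]
    · intro x hx y hy hxy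
      rw [Function.onFun, Set.disjoint_left]
      rintro z ⟨f, hf, hfz⟩ ⟨g, hg, hgz⟩
      apply hxy
      simp only [Set.Finite.coe_toFinset, Set.mem_inter_iff, SetLike.mem_coe] at hx hy
      obtain ⟨v, -, hv⟩ := ZSpan.exist_unique_vadd_mem_fundamentalDomain b z
      have h1 := hv ⟨-x, neg_mem hx.2⟩ (by
        change -x + z ∈ F
        rw [← hfz]; simpa using hf)
      have h2 := hv ⟨-y, neg_mem hy.2⟩ (by
        change -y + z ∈ F
        rw [← hgz]; simpa using hg)
      have := congrArg Subtype.val (h1.trans h2.symm)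
      simpa using this
    · intro x _
      exact hFm.const_vadd x
  have hFn : ∀ f ∈ F, ‖f‖ ≤ ρ := by
    intro f hf
    rw [← (ZSpan.fract_eq_self).2 hf]
    exact ZSpan.norm_fract_le b f
  rw [← hU]
  constructor
  · refine (measure_mono ?_).trans (measure_union_le _ _)
    intro y hy
    simp only [Set.mem_iUnion] at hy
    obtain ⟨l, hl, f, hf, rfl⟩ := hy
    simp only [Set.Finite.mem_toFinset, Set.mem_inter_iff, SetLike.mem_coe] at hl
    by_cases h : l +ᵥ f ∈ A
    · exact Or.inl h
    · refine Or.inr ⟨l, ?_, ?_⟩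
      · simpa using hFn f hf
      · simp only [vadd_eq_add] at h ⊢; tauto
  · refine (measure_mono ?_).trans (measure_union_le _ _)
    intro y hy
    have hfr : ZSpan.fract b y ∈ F := ZSpan.fract_mem_fundamentalDomain b y
    have hy2 : (ZSpan.floor b y : E) + ZSpan.fract b y = y := by simp [ZSpan.fract_apply]
    by_cases h : (ZSpan.floor b y : E) ∈ A
    · left
      simp only [Set.mem_iUnion]
      refine ⟨ZSpan.floor b y, ?_, ZSpan.fract b y, hfr, hy2⟩
      simp only [Set.Finite.mem_toFinset, Set.mem_inter_iff, SetLike.mem_coe]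
      exact ⟨h, (ZSpan.floor b y).2⟩
    · right
      refine ⟨ZSpan.floor b y, ?_, by tauto⟩
      have : (ZSpan.floor b y : E) - y = - ZSpan.fract b y := by
        rw [ZSpan.fract_apply]; abel
      rw [this, norm_neg]; exact hFn _ hfr

lemma Bd_smul (D : Set E) (t : ℝ) (ht : 0 < t) (ρ : ℝ) : Bd (t • D) ρ ⊆ t • Bd D (ρ / t) := by
  rintro y ⟨x, hxy, hne⟩
  rw [Set.mem_smul_set_iff_inv_smul_mem₀ ht.ne']
  refine ⟨t⁻¹ • x, ?_, ?_⟩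
  · rw [← smul_sub, norm_smul, norm_inv, Real.norm_of_nonneg ht.le, le_div_iff₀ ht]
    calc _ = (t⁻¹ * t) * ‖x - y‖ := by ring
      _ ≤ ρ := by rw [inv_mul_cancel₀ ht.ne', one_mul]; exact hxy
  · rwa [Set.mem_smul_set_iff_inv_smul_mem₀ ht.ne', Set.mem_smul_set_iff_inv_smul_mem₀ ht.ne'] at hne

lemma lattice_count_smul (D : Set E) (hb : Bornology.IsBounded D) {C ε₀ : ℝ} (hC : 0 ≤ C) (hε : 0 < ε₀)
    (hBd : ∀ ε, 0 < ε → ε ≤ ε₀ → μ (Bd D ε) ≤ ENNReal.ofReal (C * √ε)) [Nonempty ι] :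
    ∃ C' : ℝ, 0 ≤ C' ∧ ∃ t₀ : ℝ, 0 < t₀ ∧ ∀ t, t₀ ≤ t →
      |(Set.ncard ((t • D) ∩ (Submodule.span ℤ (Set.range b) : Set E)) : ℝ)
        - ((μ D).toReal / (μ (ZSpan.fundamentalDomain b)).toReal) * t ^ (Module.finrank ℝ E)| ≤
        C' * t ^ (Module.finrank ℝ E) / √t := by
  set ρ := ∑ i, ‖b i‖ with hρd
  set F := ZSpan.fundamentalDomain b
  have hρ : 0 < ρ := Finset.sum_pos (fun i _ => norm_pos_iff.2 (b.ne_zero i)) Finset.univ_nonempty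
  have hF0 : μ F ≠ 0 := ZSpan.measure_fundamentalDomain_ne_zero b
  have hFt : μ F ≠ ⊤ := (ZSpan.fundamentalDomain_isBounded b).measure_lt_top.ne
  have hDt : μ D ≠ ⊤ := hb.measure_lt_top.ne
  have hFp : 0 < (μ F).toReal := ENNReal.toReal_pos hF0 hFt
  refine ⟨C * √ρ / (μ F).toReal, by positivity, max 1 (ρ / ε₀), by positivity, fun t ht => ?_⟩
  have ht1 : 0 < t := by linarith [le_max_left 1 (ρ / ε₀)]
  have ht2 : ρ / t ≤ ε₀ := by
    have := (le_max_right 1 (ρ / ε₀)).trans ht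
    rw [div_le_iff₀ hε] at this
    rw [div_le_iff₀ ht1]; linarith
  set n := Module.finrank ℝ E
  obtain ⟨h1, h2⟩ := lattice_count μ b (t • D) (hb.smul₀ t)
  rw [← hρd] at h1 h2
  have hB : μ (Bd (t • D) ρ) ≤ ENNReal.ofReal (t ^ n * (C * √(ρ / t))) := by
    refine (measure_mono (Bd_smul D t ht1 ρ)).trans ?_
    rw [Measure.addHaar_smul, abs_of_nonneg (by positivity), ENNReal.ofReal_mul (by positivity)]
    exact mul_le_mul_right (hBd _ (by positivity) ht2) _
  have hv : μ (t • D) = ENNReal.ofReal (t ^ n * (μ D).toReal) := by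
    rw [Measure.addHaar_smul, abs_of_nonneg (by positivity), ENNReal.ofReal_mul (by positivity), ENNReal.ofReal_toReal hDt]
  set m := Set.ncard ((t • D) ∩ (Submodule.span ℤ (Set.range b) : Set E))
  have hm : (m : ℝ≥0∞) * μ F = ENNReal.ofReal (m * (μ F).toReal) := by
    rw [ENNReal.ofReal_mul (by positivity), ENNReal.ofReal_toReal hFt, ENNReal.ofReal_natCast]
  rw [hv, hm] at h1 h2
  have h1' := h1.trans (add_le_add le_rfl hB)
  have h2' := h2.trans (add_le_add le_rfl hB)
  rw [← ENNReal.ofReal_add (by positivity) (by positivity), ENNReal.ofReal_le_ofReal_iff (by positivity)] at h1' h2'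
  have hfin : |(m : ℝ) * (μ F).toReal - t ^ n * (μ D).toReal| ≤ t ^ n * (C * √(ρ / t)) := by
    rw [abs_le]; constructor <;> linarith
  have e1 : (m : ℝ) - ((μ D).toReal / (μ F).toReal) * t ^ n = ((m : ℝ) * (μ F).toReal - t ^ n * (μ D).toReal) / (μ F).toReal := by
    field_simp
  rw [e1, abs_div, abs_of_pos hFp, div_le_iff₀ hFp]
  refine hfin.trans (le_of_eq ?_)
  rw [Real.sqrt_div hρ.le]
  field_simp

end GeoNum
end PartB3

section PartB4
namespace GeoNum
open NumberField NumberField.InfinitePlace NumberField.mixedEmbedding NumberField.mixedEmbedding.fundamentalCone NumberField.Units MeasureTheory ENNReal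
open scoped Classical Pointwise nonZeroDivisors
open Ideal Filter Submodule

variable (K : Type*) [Field K] [NumberField K]

theorem class_aux {C : ClassGroup (𝓞 K)} {J : (Ideal (𝓞 K))⁰} {s : ℝ} (hJ : ClassGroup.mk0 J = C⁻¹) :
    Nat.card {I : (Ideal (𝓞 K))⁰ // absNorm (I : Ideal (𝓞 K)) ≤ s ∧ ClassGroup.mk0 I = C}
      = Nat.card {I : (Ideal (𝓞 K))⁰ // (J : Ideal (𝓞 K)) ∣ I ∧ IsPrincipal (I : Ideal (𝓞 K)) ∧
        absNorm (I : Ideal (𝓞 K)) ≤ s * absNorm (J : Ideal (𝓞 K))} := by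
  simp_rw [← nonZeroDivisors_dvd_iff_dvd_coe]
  refine Nat.card_congr ?_
  refine ((Equiv.dvd J).subtypeEquiv fun I ↦ ?_).trans
    (Equiv.subtypeSubtypeEquivSubtypeInter (fun I : (Ideal (𝓞 K))⁰ ↦ J ∣ I) _)
  rw [← ClassGroup.mk0_eq_one_iff (SetLike.coe_mem _)]
  simp_rw [Equiv.dvd_apply, Submonoid.coe_mul, ← Submonoid.mul_def, _root_.map_mul, hJ,
    inv_mul_eq_one, Nat.cast_mul, mul_comm s, eq_comm, and_comm, and_congr_left_iff]
  exact fun _ ↦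
    (mul_le_mul_iff_of_pos_left (Nat.cast_pos.mpr (absNorm_pos_of_nonZeroDivisors J))).symm

lemma mem_smul_normLeOne (t : ℝ) (ht : 0 < t) (x : mixedSpace K) :
    x ∈ t • normLeOne K ↔ x ∈ fundamentalCone K ∧ mixedEmbedding.norm x ≤ t ^ Module.finrank ℚ K := by
  rw [Set.mem_smul_set_iff_inv_smul_mem₀ ht.ne', mem_normLeOne, smul_mem_iff_mem (inv_ne_zero ht.ne'),
    mixedEmbedding.norm_smul, abs_of_pos (inv_pos.2 ht), inv_pow, inv_mul_le_iff₀ (by positivity), mul_one]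

lemma lattice_eq (J : (Ideal (𝓞 K))⁰) (t : ℝ) (ht : 0 < t) :
    Set.ncard ((t • normLeOne K) ∩ (Submodule.span ℤ (Set.range
      (fractionalIdealLatticeBasis K (FractionalIdeal.mk0 K J))) : Set (mixedSpace K))) =
    Nat.card {a : idealSet K J // mixedEmbedding.norm (a : mixedSpace K) ≤ t ^ Module.finrank ℚ K} := by
  rw [span_idealLatticeBasis, ← Nat.card_coe_set_eq]
  refine Nat.card_congr ((Equiv.subtypeEquivProp ?_).trans
    (Equiv.subtypeSubtypeEquivSubtypeInter _ (mixedEmbedding.norm · ≤ t ^ Module.finrank ℚ K)).symm)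
  ext x
  rw [Set.mem_inter_iff, mem_smul_normLeOne K t ht]
  simp only [idealSet, Set.mem_inter_iff]
  tauto

/-- the exponent -/
noncomputable def thK : ℝ := 1 / (2 * Module.finrank ℚ K)

lemma class_count (C : ClassGroup (𝓞 K)) : ∃ κ : ℝ, 0 < κ ∧ ∃ A : ℝ, 0 ≤ A ∧ ∀ᶠ s : ℝ in atTop,
    |(Nat.card {I : (Ideal (𝓞 K))⁰ // absNorm (I : Ideal (𝓞 K)) ≤ s ∧ ClassGroup.mk0 I = C} : ℝ) - κ * s|
      ≤ A * s ^ (1 - thK K) := by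
  obtain ⟨J, hJ⟩ := ClassGroup.mk0_surjective C⁻¹
  have hJ0 : (0 : ℝ) < absNorm J.1 := Nat.cast_pos.mpr (absNorm_pos_of_nonZeroDivisors J)
  obtain ⟨CB, hCB, ε₀, hε₀, hBd⟩ := vol_Bd K
  set b := fractionalIdealLatticeBasis K (FractionalIdeal.mk0 K J)
  have : Nonempty (Module.Free.ChooseBasisIndex ℤ (FractionalIdeal.mk0 K J : FractionalIdeal (𝓞 K)⁰ K)) := by
    exact b.index_nonempty
  obtain ⟨A, hA, t₀, ht₀, hcount⟩ := lattice_count_smul volume b (normLeOne K) (isBounded_normLeOne K) hCB hε₀ hBd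
  set n := Module.finrank ℚ K with hn
  have hnpos : 0 < n := Module.finrank_pos
  have hfr : Module.finrank ℝ (mixedSpace K) = n := mixedEmbedding.finrank K
  rw [hfr] at hcount
  set κ := (volume (normLeOne K)).toReal / (volume (ZSpan.fundamentalDomain b)).toReal with hκ
  have hκ0 : 0 < κ := by
    refine div_pos (ENNReal.toReal_pos ?_ (isBounded_normLeOne K).measure_lt_top.ne)
      (ENNReal.toReal_pos (ZSpan.measure_fundamentalDomain_ne_zero b) (ZSpan.fundamentalDomain_isBounded b).measure_lt_top.ne)
    rw [volume_normLeOne]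
    have h1 : ENNReal.ofReal (regulator K) ≠ 0 := by
      simpa using regulator_pos K
    have h2 : (NNReal.pi : ℝ≥0∞) ^ nrComplexPlaces K ≠ 0 := pow_ne_zero _ (by simpa using NNReal.pi_ne_zero)
    exact mul_ne_zero (mul_ne_zero (pow_ne_zero _ (by norm_num)) h2) h1
  have htor : (0 : ℝ) < torsionOrder K := Nat.cast_pos.2 (torsionOrder_pos K)
  refine ⟨κ * absNorm J.1 / torsionOrder K, by positivity,
    A * (absNorm J.1 : ℝ) ^ (1 - thK K) / torsionOrder K, by positivity, ?_⟩
  have hlim : Tendsto (fun s : ℝ => (s * absNorm J.1) ^ ((1 : ℝ) / n)) atTop atTop := by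
    refine (tendsto_rpow_atTop (by positivity)).comp (tendsto_id.atTop_mul_const hJ0)
  filter_upwards [hlim.eventually_ge_atTop t₀, eventually_gt_atTop 0] with s hs hs0
  set t := (s * absNorm J.1) ^ ((1 : ℝ) / n) with ht
  have hx : 0 < s * absNorm J.1 := by positivity
  have htp : 0 < t := by positivity
  have htn : t ^ n = s * absNorm J.1 := by
    rw [ht, ← Real.rpow_natCast, ← Real.rpow_mul hx.le, one_div, inv_mul_cancel₀ (by positivity), Real.rpow_one]
  have htn2 : t ^ n / √t = s ^ (1 - thK K) * (absNorm J.1 : ℝ) ^ (1 - thK K) := by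
    rw [htn, ← Real.mul_rpow hs0.le hJ0.le, Real.rpow_sub hx, Real.rpow_one]
    congr 1
    rw [Real.sqrt_eq_rpow, ht, ← Real.rpow_mul hx.le]
    congr 1
    rw [thK, ← hn]; field_simp
  have h1 := hcount t hs
  rw [lattice_eq K J t htp, ← hn, htn] at h1
  have h3 := card_isPrincipal_dvd_norm_le K J (s * absNorm J.1)
  rw [class_aux K hJ]
  rw [← h3, Nat.cast_mul] at h1
  rw [← htn, mul_div_assoc, htn2, htn] at h1
  set m : ℝ := (Nat.card {I : (Ideal (𝓞 K))⁰ // (J : Ideal (𝓞 K)) ∣ I ∧ IsPrincipal (I : Ideal (𝓞 K)) ∧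
        absNorm (I : Ideal (𝓞 K)) ≤ s * absNorm (J : Ideal (𝓞 K))} : ℝ)
  have e1 : m - κ * absNorm J.1 / torsionOrder K * s = (m * torsionOrder K - κ * (s * absNorm J.1)) / torsionOrder K := by
    field_simp
  rw [e1, abs_div, abs_of_pos htor, div_le_iff₀ htor]
  refine h1.trans (le_of_eq ?_)
  field_simp

lemma finite_ideals (s : ℝ) : Finite {I : (Ideal (𝓞 K))⁰ // absNorm (I : Ideal (𝓞 K)) ≤ s} := by
  rcases le_or_gt 0 s with hs | hs
  · simp_rw [← Nat.le_floor_iff hs]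
    exact finite_setOfPred_absNorm_le₀ ⌊s⌋₊
  · have : IsEmpty {I : (Ideal (𝓞 K))⁰ // (absNorm (I : Ideal (𝓞 K)) : ℝ) ≤ s} :=
      ⟨fun I => by have := I.2; have h2 : (0 : ℝ) ≤ absNorm (I.1 : Ideal (𝓞 K)) := by positivity
                   linarith⟩
    infer_instance

theorem ideal_count : ∃ c : ℝ, 0 < c ∧ ∃ A : ℝ, ∀ s : ℝ, 1 ≤ s →
    |(Nat.card {I : (Ideal (𝓞 K))⁰ // absNorm (I : Ideal (𝓞 K)) ≤ s} : ℝ) - c * s|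
      ≤ A * s ^ (1 - thK K) := by
  choose κ hκ A hA hcl using class_count K
  have hsum : ∀ s : ℝ, (Nat.card {I : (Ideal (𝓞 K))⁰ // absNorm (I : Ideal (𝓞 K)) ≤ s} : ℝ) =
      ∑ C : ClassGroup (𝓞 K), (Nat.card {I : (Ideal (𝓞 K))⁰ // absNorm (I : Ideal (𝓞 K)) ≤ s ∧ ClassGroup.mk0 I = C} : ℝ) := by
    intro s
    have := finite_ideals K s
    have : Fintype {I : (Ideal (𝓞 K))⁰ // absNorm (I : Ideal (𝓞 K)) ≤ s} := Fintype.ofFinite _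
    let e := fun C : ClassGroup (𝓞 K) ↦ Equiv.subtypeSubtypeEquivSubtypeInter
      (fun I : (Ideal (𝓞 K))⁰ ↦ absNorm I.1 ≤ s) (fun I ↦ ClassGroup.mk0 I = C)
    simp_rw [← Nat.card_congr (e _), Nat.card_eq_fintype_card, Fintype.subtype_card]
    rw [Fintype.card, Finset.card_eq_sum_card_fiberwise (f := fun I ↦ ClassGroup.mk0 I.1)
      (t := Finset.univ) (fun _ _ ↦ Finset.mem_univ _), Nat.cast_sum]
  set c := ∑ C, κ C
  have hc : 0 < c := Finset.sum_pos (fun C _ => hκ C) Finset.univ_nonempty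
  have hev : ∀ᶠ s : ℝ in atTop, |(Nat.card {I : (Ideal (𝓞 K))⁰ // absNorm (I : Ideal (𝓞 K)) ≤ s} : ℝ) - c * s|
      ≤ (∑ C, A C) * s ^ (1 - thK K) := by
    filter_upwards [eventually_all.2 hcl] with s hs
    rw [hsum, Finset.sum_mul, ← Finset.sum_sub_distrib, Finset.sum_mul]
    exact (Finset.abs_sum_le_sum_abs _ _).trans (Finset.sum_le_sum fun C _ => hs C)
  obtain ⟨s₀, hs₀⟩ := eventually_atTop.1 hev
  set M : ℝ := ((Nat.card {I : (Ideal (𝓞 K))⁰ // (absNorm (I : Ideal (𝓞 K)) : ℝ) ≤ s₀} : ℕ) : ℝ)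
  have hM : 0 ≤ M := by positivity
  have hA0 : 0 ≤ ∑ C, A C := Finset.sum_nonneg fun C _ => hA C
  have hth : 0 ≤ 1 - thK K := by
    have : (1 : ℝ) ≤ Module.finrank ℚ K := by exact_mod_cast (Module.finrank_pos : 0 < Module.finrank ℚ K)
    rw [thK, sub_nonneg, div_le_one (by positivity)]; linarith
  refine ⟨c, hc, (∑ C, A C) + M + c * |s₀|, fun s hs => ?_⟩
  have hp : 1 ≤ s ^ (1 - thK K) := Real.one_le_rpow hs hth
  rcases le_or_gt s₀ s with h | h
  · refine (hs₀ s h).trans ?_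
    gcongr
    have : 0 ≤ c * |s₀| := by positivity
    linarith
  · have h1 : (Nat.card {I : (Ideal (𝓞 K))⁰ // absNorm (I : Ideal (𝓞 K)) ≤ s} : ℝ) ≤ M := by
      have := finite_ideals K s₀
      refine Nat.cast_le.2 (Nat.card_le_card_of_injective (fun I : {I : (Ideal (𝓞 K))⁰ // (absNorm (I : Ideal (𝓞 K)) : ℝ) ≤ s} =>
        (⟨I.1, I.2.trans h.le⟩ : {I : (Ideal (𝓞 K))⁰ // (absNorm (I : Ideal (𝓞 K)) : ℝ) ≤ s₀}))
        (fun a b hab => Subtype.ext (congrArg (fun z => z.1) hab)))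
    have h2 : (0 : ℝ) ≤ Nat.card {I : (Ideal (𝓞 K))⁰ // (absNorm (I : Ideal (𝓞 K)) : ℝ) ≤ s} := by positivity
    have h3 : c * s ≤ c * |s₀| := by
      gcongr; exact h.le.trans (le_abs_self _)
    have h4 : 0 ≤ c * s := by positivity
    calc _ ≤ M + c * |s₀| := by rw [abs_le]; constructor <;> linarith
      _ ≤ (∑ C, A C) + M + c * |s₀| := by linarith
      _ ≤ _ := le_mul_of_one_le_right (by positivity) hp

end GeoNum
end PartB4

section PartB5
namespace Bridge
open NumberField Ideal Filter IsDedekindDomain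
open scoped nonZeroDivisors

variable (K : Type*) [Field K] [NumberField K]

/-- nonzero primes -/
abbrev PP := HeightOneSpectrum (𝓞 K)
/-- norms of primes -/
noncomputable def NN (p : PP K) : ℕ := absNorm p.asIdeal
/-- product of a multiset of primes -/
noncomputable def Phi (m : Multiset (PP K)) : Ideal (𝓞 K) := (m.map HeightOneSpectrum.asIdeal).prod

lemma absNorm_Phi (m : Multiset (PP K)) : absNorm (Phi K m) = Beu.nm (NN K) m := by
  unfold Phi Beu.nm
  rw [map_multiset_prod, Multiset.map_map]; rfl

lemma asIdeal_inj : Function.Injective (HeightOneSpectrum.asIdeal : PP K → Ideal (𝓞 K)) :=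
  fun _ _ h => HeightOneSpectrum.ext h

lemma nf_Phi (m : Multiset (PP K)) :
    UniqueFactorizationMonoid.normalizedFactors (Phi K m) = m.map HeightOneSpectrum.asIdeal := by
  apply UniqueFactorizationMonoid.normalizedFactors_prod_of_prime
  intro p hp
  obtain ⟨q, _, rfl⟩ := Multiset.mem_map.1 hp
  exact q.prime

lemma Phi_inj : Function.Injective (Phi K) := fun a b h => by
  have := congrArg UniqueFactorizationMonoid.normalizedFactors h
  rw [nf_Phi, nf_Phi] at this
  exact Multiset.map_injective (asIdeal_inj K) this

lemma Phi_ne (m : Multiset (PP K)) : Phi K m ≠ ⊥ := by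
  unfold Phi
  rw [← Submodule.zero_eq_bot]
  apply Multiset.prod_ne_zero
  intro h
  obtain ⟨q, _, h⟩ := Multiset.mem_map.1 h
  exact q.ne_bot h

lemma Phi_surj (a : Ideal (𝓞 K)) (ha : a ≠ ⊥) : ∃ m, Phi K m = a := by
  have h : ∀ s : Multiset (Ideal (𝓞 K)), (∀ p ∈ s, Prime p) →
      ∃ m : Multiset (PP K), m.map HeightOneSpectrum.asIdeal = s := by
    intro s
    induction s using Multiset.induction_on with
    | empty => intro _; exact ⟨0, rfl⟩
    | cons p s ih =>
      intro h
      obtain ⟨m, hm⟩ := ih fun q hq => h q (Multiset.mem_cons_of_mem hq)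
      have hp := h p (Multiset.mem_cons_self _ _)
      exact ⟨⟨p, Ideal.isPrime_of_prime hp, hp.ne_zero⟩ ::ₘ m, by simp [hm]⟩
  obtain ⟨m, hm⟩ := h (UniqueFactorizationMonoid.normalizedFactors a)
    fun p hp => UniqueFactorizationMonoid.prime_of_normalized_factor p hp
  refine ⟨m, ?_⟩
  unfold Phi
  rw [hm]
  exact associated_iff_eq.1 (UniqueFactorizationMonoid.prod_normalizedFactors ha)

lemma sqf_Phi (m : Multiset (PP K)) : Squarefree (Phi K m) ↔ m.Nodup := by
  rw [UniqueFactorizationMonoid.squarefree_iff_nodup_normalizedFactors (Phi_ne K m), nf_Phi,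
    Multiset.nodup_map_iff_of_injective (asIdeal_inj K)]

lemma Phi_le (m : Multiset (PP K)) (p : PP K) : Phi K m ≤ p.asIdeal ↔ p ∈ m := by
  unfold Phi
  rw [IsPrime.multiset_prod_map_le _ p.isPrime]
  constructor
  · rintro ⟨q, hq, h⟩
    have : q.asIdeal = p.asIdeal := (q.isPrime.isMaximal q.ne_bot).eq_of_le p.isPrime.ne_top h
    rwa [← asIdeal_inj K this]
  · intro h; exact ⟨p, h, le_rfl⟩

/-- multisets of primes are nonzero ideals -/
noncomputable def PhiE : Multiset (PP K) ≃ (Ideal (𝓞 K))⁰ :=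
  Equiv.ofBijective (fun m => ⟨Phi K m, mem_nonZeroDivisors_of_ne_zero (Phi_ne K m)⟩)
    ⟨fun a b h => Phi_inj K (congrArg Subtype.val h), fun a => by
      obtain ⟨m, hm⟩ := Phi_surj K a.1 (nonZeroDivisors.ne_zero a.2)
      exact ⟨m, Subtype.ext hm⟩⟩

/-- restricted version -/
noncomputable def PhiS (x : ℝ) : {m : Multiset (PP K) // (Beu.nm (NN K) m : ℝ) ≤ x} ≃
    {I : (Ideal (𝓞 K))⁰ // (absNorm (I : Ideal (𝓞 K)) : ℝ) ≤ x} :=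
  (PhiE K).subtypeEquiv fun m => by rw [← absNorm_Phi]; rfl

lemma fin_ms (x : ℝ) : {m : Multiset (PP K) | (Beu.nm (NN K) m : ℝ) ≤ x}.Finite := by
  have := GeoNum.finite_ideals K x
  exact (Finite.of_equiv _ (PhiS K x).symm)

lemma card_ms (x : ℝ) : (Beu.fs (Beu.nm (NN K)) (fin_ms K) x).card =
    Nat.card {I : (Ideal (𝓞 K))⁰ // (absNorm (I : Ideal (𝓞 K)) : ℝ) ≤ x} := by
  rw [← Nat.card_congr (PhiS K x)]
  unfold Beu.fs
  rw [← Set.ncard_eq_toFinset_card _ (fin_ms K x)]; rfl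

/-- rational prime below -/
noncomputable def qq (p : PP K) : ℕ := absNorm (under ℤ p.asIdeal)

lemma qq_prime (p : PP K) : (qq K p).Prime := by
  have := p.isPrime
  have : NeZero p.asIdeal := ⟨p.ne_bot⟩
  exact Nat.absNorm_under_prime _
lemma qq_dvd (p : PP K) : qq K p ∣ NN K p := Int.absNorm_under_dvd_absNorm _
lemma NN_ne (p : PP K) : NN K p ≠ 0 := by
  unfold NN; rw [Ne, absNorm_eq_zero_iff]; exact p.ne_bot
lemma absNorm_span_nat (q : ℕ) : absNorm (span {(q : 𝓞 K)}) = q ^ Module.finrank ℚ K := by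
  rw [absNorm_span_singleton]
  have := Algebra.norm_algebraMap (R := ℤ) (S := 𝓞 K) (q : ℤ)
  simp only [eq_intCast, Int.cast_natCast] at this
  rw [this, RingOfIntegers.rank]
  simp [Int.natAbs_pow]
lemma NN_dvd (p : PP K) : NN K p ∣ qq K p ^ Module.finrank ℚ K := by
  rw [← absNorm_span_nat]
  apply absNorm_dvd_absNorm_of_le
  rw [span_singleton_le_iff_mem]
  exact Int.absNorm_under_mem _
lemma qq_le (p : PP K) : qq K p ≤ NN K p := Nat.le_of_dvd (Nat.pos_of_ne_zero (NN_ne K p)) (qq_dvd K p)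
lemma NN_two (p : PP K) : 2 ≤ NN K p := (qq_prime K p).two_le.trans (qq_le K p)
lemma qq_eq (p : PP K) : qq K p = (NN K p).minFac := by
  have h2 : (NN K p).minFac.Prime := Nat.minFac_prime (by have := NN_two K p; omega)
  have h3 : (NN K p).minFac ∣ qq K p := h2.dvd_of_dvd_pow ((Nat.minFac_dvd _).trans (NN_dvd K p))
  exact ((Nat.prime_dvd_prime_iff_eq h2 (qq_prime K p)).1 h3).symm

lemma fib (q : ℕ) : {p : PP K | qq K p = q}.ncard ≤ Module.finrank ℚ K := by
  classical
  by_cases hf : {p : PP K | qq K p = q}.Finite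
  swap
  · rw [Set.Infinite.ncard hf]; exact Nat.zero_le _
  rw [Set.ncard_eq_toFinset_card _ hf]
  rcases hf.toFinset.eq_empty_or_nonempty with h0 | ⟨p0, hp0⟩
  · simp [h0]
  have hq : q.Prime := by
    have : qq K p0 = q := by simpa using hp0
    rw [← this]; exact qq_prime K p0
  have h1 : ∏ p ∈ hf.toFinset, p.asIdeal ∣ span {(q : 𝓞 K)} := by
    have := Finset.prod_primes_dvd (s := hf.toFinset.image HeightOneSpectrum.asIdeal) (span {(q : 𝓞 K)})
      (by intro a ha; obtain ⟨p, _, rfl⟩ := Finset.mem_image.1 ha; exact p.prime)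
      (by
        intro a ha; obtain ⟨p, hp, rfl⟩ := Finset.mem_image.1 ha
        have hp : qq K p = q := by simpa using hp
        rw [Ideal.dvd_iff_le, span_singleton_le_iff_mem, ← hp]
        exact Int.absNorm_under_mem _)
    rwa [Finset.prod_image (fun a _ b _ h => asIdeal_inj K h)] at this
  have h2 := absNorm_dvd_absNorm_of_le (Ideal.dvd_iff_le.1 h1)
  rw [absNorm_span_nat, map_prod] at h2
  have h3 := Nat.le_of_dvd (pow_pos hq.pos _) h2
  have h4 : q ^ hf.toFinset.card ≤ ∏ p ∈ hf.toFinset, absNorm p.asIdeal := by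
    apply Finset.pow_card_le_prod
    intro p hp
    have hp : qq K p = q := by simpa using hp
    rw [← hp]; exact qq_le K p
  exact (Nat.pow_le_pow_iff_right hq.one_lt).1 (h4.trans h3)

lemma finPP (x : ℝ) : {p : PP K | (NN K p : ℝ) ≤ x}.Finite := by
  have := Set.Finite.preimage (f := fun p : PP K => ({p} : Multiset (PP K)))
    (fun a _ b _ h => Multiset.singleton_inj.1 h) (fin_ms K x)
  convert this using 1
  ext p; simp [Beu.nm]

lemma hd' (n : ℕ) : {p : PP K | NN K p = n}.ncard ≤ Module.finrank ℚ K := by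
  by_cases hf : {p : PP K | qq K p = n.minFac}.Finite
  · refine (Set.ncard_le_ncard ?_ hf).trans (fib K n.minFac)
    rintro p hp
    have hp : NN K p = n := hp
    simp [qq_eq, hp]
  · exact absurd ((finPP K ((n.minFac : ℝ) ^ Module.finrank ℚ K)).subset (fun p hp => by
      have hp : qq K p = n.minFac := hp
      have := Nat.le_of_dvd (pow_pos (qq_prime K p).pos _) (NN_dvd K p)
      rw [hp] at this
      show (NN K p : ℝ) ≤ _
      exact_mod_cast this)) hf

lemma count_le (x : ℝ) (hx : 0 ≤ x) : {p : PP K | (NN K p : ℝ) ≤ x}.ncard ≤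
    Nat.primeCounting ⌊x⌋₊ * Module.finrank ℚ K := by
  classical
  have hf := finPP K x
  rw [Set.ncard_eq_toFinset_card _ hf]
  have h := Finset.card_le_mul_card_image_of_maps_to (s := hf.toFinset)
    (t := (Finset.range (⌊x⌋₊ + 1)).filter Nat.Prime) (f := qq K) (by
      intro p hp
      have hp : (NN K p : ℝ) ≤ x := by simpa using hp
      simp only [Finset.mem_filter, Finset.mem_range]
      refine ⟨?_, qq_prime K p⟩
      rw [Nat.lt_succ_iff]
      exact (qq_le K p).trans (Nat.le_floor hp)) (Module.finrank ℚ K) (by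
      intro q _
      rw [← Set.ncard_coe_finset]
      by_cases hg : {p : PP K | qq K p = q}.Finite
      · refine (Set.ncard_le_ncard ?_ hg).trans (fib K q)
        intro p hp
        simp at hp; exact hp.2
      · exact absurd ((finPP K ((q : ℝ) ^ Module.finrank ℚ K)).subset (fun p hp => by
          have hp : qq K p = q := hp
          have := Nat.le_of_dvd (pow_pos (qq_prime K p).pos _) (NN_dvd K p)
          rw [hp] at this
          show (NN K p : ℝ) ≤ _
          exact_mod_cast this)) hg)
  rw [Nat.primeCounting, Nat.primeCounting', Nat.count_eq_card_filter_range, mul_comm]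
  exact h

lemma hpi' (x : ℝ) (hx : 2 ≤ x) : ({p : PP K | (NN K p : ℝ) ≤ x}.ncard : ℝ) ≤
    (Module.finrank ℚ K * (2 * Real.log 4 + 2)) * x / Real.log x := by
  have h1 := count_le K x (by linarith)
  have h2 := Chebyshev.pi_le_log4_mul_div (x := x) (by linarith)
  have hl : 0 < Real.log x := Real.log_pos (by linarith)
  have h3 : Real.sqrt x ≤ 2 * x / Real.log x := by
    rw [le_div_iff₀ hl]
    have h4 : Real.log x ≤ 2 * Real.sqrt x := by
      have := Real.log_le_sub_one_of_pos (Real.sqrt_pos.2 (by linarith : 0 < x))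
      rw [Real.log_sqrt (by linarith)] at this
      linarith
    have := Real.mul_self_sqrt (by linarith : 0 ≤ x)
    nlinarith [Real.sqrt_nonneg x]
  rw [Real.log_sqrt (by linarith)] at h2
  have h5 : Real.log 4 * x / (Real.log x / 2) = 2 * Real.log 4 * x / Real.log x := by
    field_simp
  rw [h5] at h2
  have h6 : (({p : PP K | (NN K p : ℝ) ≤ x}.ncard : ℕ) : ℝ) ≤
    (Nat.primeCounting ⌊x⌋₊ : ℝ) * Module.finrank ℚ K := by exact_mod_cast h1
  refine h6.trans ?_
  calc (Nat.primeCounting ⌊x⌋₊ : ℝ) * Module.finrank ℚ K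
      ≤ (2 * Real.log 4 * x / Real.log x + 2 * x / Real.log x) * Module.finrank ℚ K := by
        gcongr; linarith
    _ = _ := by ring

lemma thK_pos : 0 < GeoNum.thK K := by
  have : 0 < Module.finrank ℚ K := Module.finrank_pos
  unfold GeoNum.thK; positivity
lemma thK_lt : GeoNum.thK K < 1 := by
  have : 1 ≤ Module.finrank ℚ K := Module.finrank_pos
  have : (1:ℝ) ≤ Module.finrank ℚ K := by exact_mod_cast this
  unfold GeoNum.thK
  rw [div_lt_one (by positivity)]; linarith

/-- the system of primes of a number field -/
noncomputable def sys : Beu.Sys (PP K) where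
  N := NN K
  two_le := NN_two K
  fin := fin_ms K
  c := (GeoNum.ideal_count K).choose
  θ := GeoNum.thK K
  C := (GeoNum.ideal_count K).choose_spec.2.choose
  A := Module.finrank ℚ K * (2 * Real.log 4 + 2)
  d := Module.finrank ℚ K
  hc := (GeoNum.ideal_count K).choose_spec.1
  hθ := thK_pos K
  hθ1 := thK_lt K
  hcnt := fun x hx => by
    rw [card_ms]
    exact (GeoNum.ideal_count K).choose_spec.2.choose_spec x hx
  hpi := hpi' K
  hd := hd' K

end Bridge
end PartB5

section PartB6
namespace Bridge
open NumberField Ideal Filter IsDedekindDomain AlladiGen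
open scoped nonZeroDivisors

variable (K : Type*) [Field K] [NumberField K]

/-- primes in `S` -/
def SS (S : Set (Ideal (𝓞 K))) : Set (PP K) := {p | p.asIdeal ∈ S}

open Classical in
lemma pc_eq (S : Set (Ideal (𝓞 K))) (X : ℝ) : ((sys K).piS (SS K S) X : ℝ) ≤ primeCount K S X ∧
    (primeCount K S X : ℝ) ≤ (sys K).piS (SS K S) X + 1 := by
  set T : Finset (PP K) := ((sys K).Pr X).filter (· ∈ SS K S) with hT
  set T' : Finset (Ideal (𝓞 K)) := T.image HeightOneSpectrum.asIdeal with hT'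
  have hc : T'.card = T.card := Finset.card_image_of_injective _ (asIdeal_inj K)
  set U : Set (Ideal (𝓞 K)) := {p | p.IsPrime ∧ p ∈ S ∧ (absNorm p : ℝ) ≤ X} with hU
  have h1 : primeCount K S X = U.ncard := rfl
  have h2 : (sys K).piS (SS K S) X = (T'.card : ℝ) := by rw [hc]; rfl
  have h3 : (T' : Set (Ideal (𝓞 K))) ⊆ U := by
    intro a ha
    rw [Finset.mem_coe, hT', Finset.mem_image] at ha
    obtain ⟨p, hp, rfl⟩ := ha
    rw [hT, Finset.mem_filter, Beu.Sys.mem_Pr] at hp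
    exact ⟨p.isPrime, hp.2, hp.1⟩
  have h4 : U ⊆ ((insert ⊥ T' : Finset (Ideal (𝓞 K))) : Set (Ideal (𝓞 K))) := by
    rintro a ⟨ha, haS, hn⟩
    rw [Finset.mem_coe, Finset.mem_insert]
    by_cases hb : a = ⊥
    · exact Or.inl hb
    · right
      rw [hT', Finset.mem_image]
      refine ⟨⟨a, ha, hb⟩, ?_, rfl⟩
      rw [hT, Finset.mem_filter, Beu.Sys.mem_Pr]
      exact ⟨hn, haS⟩
  rw [h1, h2]
  constructor
  · have := Set.ncard_le_ncard h3 (Set.Finite.subset (Finset.finite_toSet _) h4)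
    rw [Set.ncard_coe_finset] at this
    exact_mod_cast this
  · have := Set.ncard_le_ncard h4 (Finset.finite_toSet _)
    rw [Set.ncard_coe_finset] at this
    have := this.trans (Finset.card_insert_le _ _)
    exact_mod_cast this

lemma pc_pos (X : ℝ) (hX : 0 ≤ X) : 0 < primeCount K Set.univ X := by
  have hfin : Finite {p : Ideal (𝓞 K) // p.IsPrime ∧ p ∈ Set.univ ∧ (absNorm p : ℝ) ≤ X} := by
    have : {p : Ideal (𝓞 K) | p.IsPrime ∧ p ∈ Set.univ ∧ (absNorm p : ℝ) ≤ X} ⊆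
      insert ⊥ (HeightOneSpectrum.asIdeal '' {p : PP K | (NN K p : ℝ) ≤ X}) := by
      rintro a ⟨ha, haS, hn⟩
      by_cases hb : a = ⊥
      · exact Or.inl hb
      · exact Or.inr ⟨⟨a, ha, hb⟩, hn, rfl⟩
    exact Set.Finite.subset (((finPP K X).image _).insert _) this
  have hne : Nonempty {p : Ideal (𝓞 K) // p.IsPrime ∧ p ∈ Set.univ ∧ (absNorm p : ℝ) ≤ X} :=
    ⟨⟨⊥, Ideal.isPrime_bot, trivial, by simpa using hX⟩⟩
  exact Nat.card_pos

open Classical in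
lemma piS_le (S : Set (PP K)) (y : ℝ) : 0 ≤ (sys K).piS S y ∧
    (sys K).piS S y ≤ (sys K).piS Set.univ y := by
  rw [Beu.Sys.piS_univ]
  unfold Beu.Sys.piS
  refine ⟨by positivity, ?_⟩
  exact_mod_cast Finset.card_le_card (Finset.filter_subset _ _)

open Classical in
lemma piS_mono (S : Set (PP K)) {y z : ℝ} (h : y ≤ z) :
    (sys K).piS S y ≤ (sys K).piS S z := by
  unfold Beu.Sys.piS
  norm_cast
  apply Finset.card_le_card
  intro p hp
  rw [Finset.mem_filter, Beu.Sys.mem_Pr] at hp ⊢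
  exact ⟨hp.1.trans h, hp.2⟩

lemma dens (S : Set (Ideal (𝓞 K))) (δ : ℝ) (hδ : HasPrimeDensity K S δ) :
    ∀ ε > 0, ∃ C, 0 ≤ C ∧ ∀ y : ℝ, |(sys K).piS (SS K S) y - δ * (sys K).piS Set.univ y| ≤
      ε * (sys K).piS Set.univ y + C := by
  intro ε hε
  have hev := (Metric.tendsto_nhds.1 hδ) ε hε
  obtain ⟨y0, hy0⟩ := eventually_atTop.1 hev
  set z := max y0 0 with hz
  have hu : SS K Set.univ = Set.univ := by ext; simp [SS]
  have hW : 0 ≤ (sys K).piS Set.univ z := (piS_le K Set.univ z).1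
  refine ⟨(ε + 1 + |δ|) + (1 + |δ|) * (sys K).piS Set.univ z, by positivity, fun y => ?_⟩
  obtain ⟨h1, h2⟩ := piS_le K (SS K S) y
  rcases le_total z y with h | h
  · have hd := hy0 y ((le_max_left _ _).trans h)
    have hp : (0:ℝ) < primeCount K Set.univ y := by
      exact_mod_cast pc_pos K y ((le_max_right _ _).trans h)
    rw [Real.dist_eq] at hd
    have hd' : |(primeCount K S y : ℝ) - δ * primeCount K Set.univ y| ≤ ε * primeCount K Set.univ y := by
      have e : (primeCount K S y : ℝ) - δ * primeCount K Set.univ y =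
        ((primeCount K S y : ℝ) / primeCount K Set.univ y - δ) * primeCount K Set.univ y := by
        field_simp
      rw [e, abs_mul, abs_of_pos hp]
      exact mul_le_mul_of_nonneg_right hd.le hp.le
    obtain ⟨a1, a2⟩ := pc_eq K S y
    obtain ⟨b1, b2⟩ := pc_eq K Set.univ y
    rw [hu] at b1 b2
    set s := (sys K).piS (SS K S) y
    set t := (sys K).piS Set.univ y
    set s' : ℝ := (primeCount K S y : ℝ)
    set t' : ℝ := (primeCount K Set.univ y : ℝ)
    have e : s - δ * t = (s' - δ * t') + ((s - s') + δ * (t' - t)) := by ring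
    have k1 : |s - s'| ≤ 1 := by rw [abs_le]; constructor <;> linarith
    have k2 : |δ * (t' - t)| ≤ |δ| := by
      rw [abs_mul]
      have : |t' - t| ≤ 1 := by rw [abs_le]; constructor <;> linarith
      nlinarith [abs_nonneg δ]
    have k3 : ε * t' ≤ ε * t + ε := by nlinarith
    have k4 : 0 ≤ (1 + |δ|) * (sys K).piS Set.univ z := by positivity
    rw [e]
    linarith [abs_add_le (s' - δ * t') ((s - s') + δ * (t' - t)), abs_add_le (s - s') (δ * (t' - t))]
  · have hm := piS_mono K Set.univ h
    have h0 := (piS_le K Set.univ y).1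
    set s := (sys K).piS (SS K S) y
    set t := (sys K).piS Set.univ y
    have k1 : |s - δ * t| ≤ |s| + |δ * t| := abs_sub _ _
    rw [abs_of_nonneg h1, abs_mul, abs_of_nonneg h0] at k1
    have k2 : |δ| * t ≤ |δ| * (sys K).piS Set.univ z := by gcongr
    have k3 : 0 ≤ ε * t := by positivity
    have := abs_nonneg δ
    nlinarith

lemma prime_ne_bot {a p : Ideal (𝓞 K)} (ha : a ≠ ⊥) (h : a ≤ p) : p ≠ ⊥ := fun hp =>
  ha (le_bot_iff.1 (hp ▸ h))

lemma muK_Phi (u : Finset (PP K)) : muK K (Phi K u.val) = (-1) ^ u.card := by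
  unfold muK
  rw [if_pos ((sqf_Phi K _).2 u.nodup)]
  congr 1
  have e : {p : PP K // p ∈ u} ≃ {p : Ideal (𝓞 K) // p.IsPrime ∧ Phi K u.val ≤ p} :=
    Equiv.ofBijective (fun p => ⟨p.1.asIdeal, p.1.isPrime, (Phi_le K _ _).2 p.2⟩)
      ⟨fun a b h => Subtype.ext (asIdeal_inj K (congrArg Subtype.val h)), fun ⟨p, hp, hle⟩ =>
        ⟨⟨⟨p, hp, prime_ne_bot K (Phi_ne K _) hle⟩,
          (Phi_le K u.val ⟨p, hp, prime_ne_bot K (Phi_ne K _) hle⟩).1 hle⟩, rfl⟩⟩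
  rw [← Nat.card_congr e]
  simp

lemma InD_Phi (S : Set (Ideal (𝓞 K))) (u : Finset (PP K)) :
    InD K S (Phi K u.val) ↔ (sys K).D (SS K S) u := by
  have hmin : ∀ p : PP K, MinimalPrime K (Phi K u.val) p.asIdeal ↔
      p ∈ u ∧ ∀ q ∈ u, NN K p ≤ NN K q := by
    intro p
    unfold MinimalPrime
    rw [Phi_le]
    constructor
    · rintro ⟨_, h2, h3⟩
      exact ⟨h2, fun q hq => h3 q.asIdeal q.isPrime ((Phi_le K _ _).2 hq)⟩
    · rintro ⟨h1, h2⟩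
      exact ⟨p.isPrime, h1, fun q hq hle => h2 ⟨q, hq, prime_ne_bot K (Phi_ne K _) hle⟩
        ((Phi_le K u.val ⟨q, hq, prime_ne_bot K (Phi_ne K _) hle⟩).1 hle)⟩
  constructor
  · rintro ⟨p, hp, hpS, huq⟩
    have hpb : p ≠ ⊥ := prime_ne_bot K (Phi_ne K _) hp.2.1
    obtain ⟨P, rfl⟩ : ∃ P : PP K, P.asIdeal = p := ⟨⟨p, hp.1, hpb⟩, rfl⟩
    rw [hmin] at hp
    refine ⟨P, hp.1, hpS, fun q hq hne => ?_⟩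
    refine lt_of_le_of_ne (hp.2 q hq) fun heq => hne ?_
    refine asIdeal_inj K (huq _ ((hmin q).2 ⟨hq, fun r hr => ?_⟩))
    have heq : NN K P = NN K q := heq
    rw [← heq]; exact hp.2 r hr
  · rintro ⟨p, hp, hpS, h⟩
    refine ⟨p.asIdeal, (hmin p).2 ⟨hp, fun q hq => ?_⟩, hpS, fun q hq => ?_⟩
    · by_cases hqp : q = p
      · rw [hqp]
      · exact (h q hq hqp).le
    · have hqb : q ≠ ⊥ := prime_ne_bot K (Phi_ne K _) hq.2.1
      obtain ⟨Q, rfl⟩ : ∃ P : PP K, P.asIdeal = q := ⟨⟨q, hq.1, hqb⟩, rfl⟩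
      rw [hmin] at hq
      by_contra hne
      have := h Q hq.1 (fun e => hne (by rw [e]))
      have h2 : NN K Q ≤ NN K p := hq.2 p hp
      exact absurd this (not_lt.2 h2)

open Classical in
lemma tsum_eq (S : Set (Ideal (𝓞 K))) (X : ℝ) :
    ∑' a : {a : Ideal (𝓞 K) // 2 ≤ absNorm a ∧ (absNorm a : ℝ) ≤ X ∧ InD K S a},
          (muK K a.1 : ℝ) / (absNorm a.1 : ℝ) =
    ∑ u ∈ ((sys K).F X).filter ((sys K).D (SS K S)), (-1 : ℝ) ^ u.card / (sys K).n u.val := by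
  set T := ((sys K).F X).filter ((sys K).D (SS K S)) with hT
  have hnorm : ∀ m, absNorm (Phi K m) = (sys K).n m := absNorm_Phi K
  have hinj : Function.Injective (fun u : Finset (PP K) => Phi K u.val) :=
    fun a b h => Finset.val_injective (Phi_inj K h)
  set V : Set (Ideal (𝓞 K)) := {a | 2 ≤ absNorm a ∧ (absNorm a : ℝ) ≤ X ∧ InD K S a} with hV
  have e1 : ∑' a : {a : Ideal (𝓞 K) // 2 ≤ absNorm a ∧ (absNorm a : ℝ) ≤ X ∧ InD K S a},
      (muK K a.1 : ℝ) / (absNorm a.1 : ℝ) =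
      ∑' a : Ideal (𝓞 K), V.indicator (fun a => (muK K a : ℝ) / (absNorm a : ℝ)) a :=
    tsum_subtype V (fun a => (muK K a : ℝ) / (absNorm a : ℝ))
  have hmemV : ∀ u ∈ T, Phi K u.val ∈ V := by
    intro u hu
    rw [hT, Finset.mem_filter, Beu.Sys.mem_F] at hu
    refine ⟨?_, by rw [hnorm]; exact hu.1, (InD_Phi K S u).2 hu.2⟩
    obtain ⟨p, hp, _⟩ := hu.2
    obtain ⟨m, hm⟩ := Multiset.exists_cons_of_mem hp
    rw [hnorm, hm, Beu.Sys.n_cons]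
    have h1 := (sys K).n_pos m
    have h2 := (sys K).two_le p
    nlinarith
  rw [e1, tsum_eq_sum (s := T.image (fun u : Finset (PP K) => Phi K u.val))]
  · rw [Finset.sum_image (fun a _ b _ h => hinj h)]
    refine Finset.sum_congr rfl fun u hu => ?_
    rw [Set.indicator_of_mem (hmemV u hu), muK_Phi, hnorm]
    push_cast; rfl
  · intro a ha
    by_cases haV : a ∈ V
    · rw [Set.indicator_of_mem haV]
      by_cases hsq : Squarefree a
      · exfalso
        apply ha
        have hab : a ≠ ⊥ := fun h => by
          have := haV.1
          rw [h, absNorm_bot] at this; omega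
        obtain ⟨m, rfl⟩ := Phi_surj K a hab
        rw [sqf_Phi] at hsq
        rw [Finset.mem_image]
        refine ⟨⟨m, hsq⟩, ?_, rfl⟩
        rw [hT, Finset.mem_filter, Beu.Sys.mem_F]
        refine ⟨?_, (InD_Phi K S ⟨m, hsq⟩).1 haV.2.2⟩
        rw [← hnorm]; exact haV.2.1
      · unfold muK
        rw [if_neg hsq]; simp
    · exact Set.indicator_of_notMem haV _

theorem final (S : Set (Ideal (𝓞 K))) (δ : ℝ) (hδ : HasPrimeDensity K S δ) :
    Tendsto (fun X : ℝ =>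
        ∑' a : {a : Ideal (𝓞 K) // 2 ≤ absNorm a ∧ (absNorm a : ℝ) ≤ X ∧ InD K S a},
          (muK K a.1 : ℝ) / (absNorm a.1 : ℝ))
      atTop (nhds (-δ)) := by
  have h := (sys K).main (SS K S) δ (dens K S δ hδ)
  simp_rw [tsum_eq]
  convert h

end Bridge
end PartB6

open NumberField Ideal Filter

noncomputable section

namespace AlladiGen

variable (K : Type*) [Field K] [NumberField K]

/-- Main theorem: the Möbius sum over distinguishable ideals with minimal prime in `S`
converges to `-δ(S)`. -/
theorem mobius_sum_density (S : Set (Ideal (𝓞 K))) (hS : ∀ p ∈ S, p.IsPrime)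
    (δ : ℝ) (hδ : HasPrimeDensity K S δ) :
    Tendsto (fun X : ℝ =>
        ∑' a : {a : Ideal (𝓞 K) // 2 ≤ absNorm a ∧ (absNorm a : ℝ) ≤ X ∧ InD K S a},
          (muK K a.1 : ℝ) / (absNorm a.1 : ℝ))
      atTop (nhds (-δ)) := by
  exact Bridge.final K S δ hδ

end AlladiGen
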